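/- Let n ≥ 1 be an integer, m ∈ (0,1) with m > (n−2)/n, and set m₂ := n/(n+2). Suppose ρ is a solution of the fast diffusion equation and B > 0 is such that lim_{τ→∞} sup_{y∈ℝⁿ} |ρ(τ,y)/ρ_B(τ,y) − 1| = 0. (i) If m ≠ m₂, or if m = m₂ and moreover ∫_{ℝⁿ} |1 − ρ(0,y)/ρ_B(0,y)|² (1+|y|²)^{−n/2} dy < ∞, then there exists z ∈ ℝⁿ such that limsup_{τ→∞} sup_{y∈ℝⁿ} τ · |ρ(τ, y−z)/ρ_B(τ,y) − 1| < ∞. (ii) If m = m₂ (without the moment condition), then for every ε > 0 there exists z ∈ ℝⁿ such that limsup_{τ→∞} sup_{y∈ℝⁿ} τ^{1−ε} · |ρ(τ, y−z)/ρ_B(τ,y) − 1| < ∞. -/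

import Mathlib

open MeasureTheory Filter
open scoped BigOperators ENNReal Topology

noncomputable section

/-- The `i`-th standard basis vector of `ℝⁿ`. -/
def stdBasis (n : ℕ) (i : Fin n) : EuclideanSpace ℝ (Fin n) :=
  EuclideanSpace.single i 1

/-- The Laplacian (sum of second partial derivatives) of `f : ℝⁿ → ℝ`. -/
def lap (n : ℕ) (f : EuclideanSpace ℝ (Fin n) → ℝ) (x : EuclideanSpace ℝ (Fin n)) : ℝ :=
  ∑ i : Fin n, fderiv ℝ (fun y => fderiv ℝ f y (stdBasis n i)) x (stdBasis n i)

/-- `x · ∇f x`. -/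
def gradDot (n : ℕ) (f : EuclideanSpace ℝ (Fin n) → ℝ) (x : EuclideanSpace ℝ (Fin n)) : ℝ :=
  ∑ i : Fin n, x i * fderiv ℝ f x (stdBasis n i)

/-- The moment parameter `p = 2/(1-m) - n`. -/
def pPar (n : ℕ) (m : ℝ) : ℝ := 2 / (1 - m) - n

/-- The scaling exponent `β = (1 + n/p)/2`. -/
def betaPar (n : ℕ) (m : ℝ) : ℝ := (1 + n / pPar n m) / 2

/-- The Barenblatt profile `u_B(x) = (B + |x|²)^{-1/(1-m)}`. -/
def uB (n : ℕ) (m B : ℝ) (x : EuclideanSpace ℝ (Fin n)) : ℝ :=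
  (B + ‖x‖ ^ 2) ^ (-(1 / (1 - m)))

/-- The Barenblatt solution `ρ_B(τ,y) = (1+2pτ)^{-nβ} u_B((1+2pτ)^{-β} y)`. -/
def rhoB (n : ℕ) (m B : ℝ) (τ : ℝ) (y : EuclideanSpace ℝ (Fin n)) : ℝ :=
  (1 + 2 * pPar n m * τ) ^ (-(n : ℝ) * betaPar n m) *
    uB n m B ((1 + 2 * pPar n m * τ) ^ (-betaPar n m) • y)

/-- A (positive, continuous up to time 0, smooth for positive times) solution of the
fast diffusion equation `∂_τ ρ = (1/m) Δ (ρ^m)` on `[0,∞) × ℝⁿ`. -/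
def IsFDESol (n : ℕ) (m : ℝ) (ρ : ℝ → EuclideanSpace ℝ (Fin n) → ℝ) : Prop :=
  (∀ τ ∈ Set.Ici (0 : ℝ), ∀ y, 0 < ρ τ y) ∧
  ContinuousOn (fun q : ℝ × EuclideanSpace ℝ (Fin n) => ρ q.1 q.2)
    (Set.Ici 0 ×ˢ Set.univ) ∧
  ContDiffOn ℝ (⊤ : ℕ∞) (fun q : ℝ × EuclideanSpace ℝ (Fin n) => ρ q.1 q.2)
    (Set.Ioi 0 ×ˢ Set.univ) ∧
  ∀ τ ∈ Set.Ioi (0 : ℝ), ∀ y,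
    deriv (fun s => ρ s y) τ = (1 / m) * lap n (fun x => ρ τ x ^ m) y

/-- Space-time points with positive time. -/
abbrev SpaceTime (n : ℕ) := {z : ℝ × EuclideanSpace ℝ (Fin n) // 0 < z.1}

/-- Extension by zero of a function on the open upper half of space-time. -/
def extZero {n : ℕ} (f : SpaceTime n → ℝ) (z : ℝ × EuclideanSpace ℝ (Fin n)) : ℝ :=
  if h : 0 < z.1 then f ⟨z, h⟩ else 0

/-- The open set of points with positive time. -/
def posTime (n : ℕ) : Set (ℝ × EuclideanSpace ℝ (Fin n)) := {z | 0 < z.1}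

theorem isOpen_posTime (n : ℕ) : IsOpen (posTime n) :=
  isOpen_lt continuous_const continuous_fst

theorem extZero_apply {n : ℕ} (f : SpaceTime n → ℝ) (z : SpaceTime n) :
    extZero f z.1 = f z := by
  simp [extZero, z.2]

theorem extZero_of_pos {n : ℕ} (f : SpaceTime n → ℝ) {z : ℝ × EuclideanSpace ℝ (Fin n)}
    (hz : 0 < z.1) : extZero f z = f ⟨z, hz⟩ := by
  simp [extZero, hz]

/-- The subalgebra of smooth functions of space-time with positive time. -/
def smoothSubalgebra (n : ℕ) : Subalgebra ℝ (SpaceTime n → ℝ) where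
  carrier := {f | ContDiffOn ℝ (⊤ : ℕ∞) (extZero f) (posTime n)}
  mul_mem' {f g} hf hg := (hf.mul hg).congr fun z hz => by
    simp [extZero_of_pos _ (show 0 < z.1 from hz)]
  add_mem' {f g} hf hg := (hf.add hg).congr fun z hz => by
    simp [extZero_of_pos _ (show 0 < z.1 from hz)]
  algebraMap_mem' r := (contDiffOn_const (c := r)).congr fun z hz => by
    simp [extZero_of_pos _ (show 0 < z.1 from hz)]

/-- The algebra of smooth functions of space-time with positive time. -/
def Sm (n : ℕ) : Type := smoothSubalgebra n

instance (n : ℕ) : CommRing (Sm n) := inferInstanceAs (CommRing (smoothSubalgebra n))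

instance (n : ℕ) : Algebra ℝ (Sm n) := inferInstanceAs (Algebra ℝ (smoothSubalgebra n))

namespace Sm

variable {n : ℕ}

/-- Evaluation at a point. -/
def ev (z : SpaceTime n) : Sm n →ₐ[ℝ] ℝ := (Pi.evalAlgHom ℝ _ z).comp (smoothSubalgebra n).val

theorem ext_ev {f g : Sm n} (h : ∀ z, ev z f = ev z g) : f = g :=
  Subtype.ext (funext h)

/-- The extension by zero of an element of `Sm n`. -/
def toFun (f : Sm n) : ℝ × EuclideanSpace ℝ (Fin n) → ℝ := extZero f.1

theorem toFun_apply (f : Sm n) (z : SpaceTime n) : toFun f z.1 = ev z f :=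
  extZero_apply _ z

theorem contDiffOn (f : Sm n) : ContDiffOn ℝ (⊤ : ℕ∞) (toFun f) (posTime n) := f.2

theorem contDiffAt (f : Sm n) (z : SpaceTime n) : ContDiffAt ℝ (⊤ : ℕ∞) (toFun f) z.1 :=
  (Sm.contDiffOn f).contDiffAt ((isOpen_posTime n).mem_nhds z.2)

theorem differentiableAt (f : Sm n) (z : SpaceTime n) : DifferentiableAt ℝ (toFun f) z.1 :=
  ((Sm.contDiffAt f) z).differentiableAt (by simp)

/-- The element of `Sm n` given by a function smooth for positive times. -/
def mk' (g : ℝ × EuclideanSpace ℝ (Fin n) → ℝ)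
    (hg : ContDiffOn ℝ (⊤ : ℕ∞) g (posTime n)) : Sm n :=
  ⟨fun z => g z.1, hg.congr fun z hz => by rw [extZero_of_pos _ (show 0 < z.1 from hz)]⟩

@[simp] theorem ev_mk' (g : ℝ × EuclideanSpace ℝ (Fin n) → ℝ)
    (hg : ContDiffOn ℝ (⊤ : ℕ∞) g (posTime n)) (z : SpaceTime n) : ev z (mk' g hg) = g z.1 := rfl

theorem toFun_eventuallyEq {f : Sm n} {g : ℝ × EuclideanSpace ℝ (Fin n) → ℝ}
    (h : ∀ z : SpaceTime n, ev z f = g z.1) (z : SpaceTime n) : toFun f =ᶠ[𝓝 z.1] g := by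
  filter_upwards [(isOpen_posTime n).mem_nhds z.2] with y hy
  exact (toFun_apply f ⟨y, hy⟩).trans (h ⟨y, hy⟩)

/-- The derivation given by the directional derivative. -/
def dir (v : ℝ × EuclideanSpace ℝ (Fin n)) : Derivation ℝ (Sm n) (Sm n) :=
  Derivation.mk'
    { toFun := fun f => mk' (fun z => fderiv ℝ (toFun f) z v)
        (((Sm.contDiffOn f).fderiv_of_isOpen (isOpen_posTime n) (by simp)).clm_apply
          contDiffOn_const)
      map_add' := fun f g => ext_ev fun z => by
        have h : toFun (f + g) =ᶠ[𝓝 z.1] toFun f + toFun g :=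
          toFun_eventuallyEq (fun y => by simp [toFun_apply]) z
        simp [h.fderiv_eq, fderiv_add ((Sm.differentiableAt f) z) ((Sm.differentiableAt g) z)]
      map_smul' := fun c f => ext_ev fun z => by
        have h : toFun (c • f) =ᶠ[𝓝 z.1] c • toFun f :=
          toFun_eventuallyEq (fun y => by simp [toFun_apply]) z
        simp [h.fderiv_eq, fderiv_const_smul ((Sm.differentiableAt f) z)] }
    (fun f g => ext_ev fun z => by
      have h : toFun (f * g) =ᶠ[𝓝 z.1] toFun f * toFun g :=
        toFun_eventuallyEq (fun y => by simp [toFun_apply]) z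
      simp [h.fderiv_eq, fderiv_mul ((Sm.differentiableAt f) z) ((Sm.differentiableAt g) z),
        toFun_apply])

theorem ev_dir (v : ℝ × EuclideanSpace ℝ (Fin n)) (f : Sm n) (z : SpaceTime n) :
    ev z (dir v f) = fderiv ℝ (toFun f) z.1 v := rfl

theorem ev_dir_of {f : Sm n} {g : ℝ × EuclideanSpace ℝ (Fin n) → ℝ}
    (h : ∀ z : SpaceTime n, ev z f = g z.1) (v : ℝ × EuclideanSpace ℝ (Fin n))
    (z : SpaceTime n) : ev z (dir v f) = fderiv ℝ g z.1 v := by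
  rw [ev_dir, (toFun_eventuallyEq h z).fderiv_eq]

theorem dir_comm (v w : ℝ × EuclideanSpace ℝ (Fin n)) (f : Sm n) :
    dir v (dir w f) = dir w (dir v f) := by
  refine ext_ev fun z => ?_
  have hd : DifferentiableAt ℝ (fderiv ℝ (toFun f)) z.1 :=
    (((Sm.contDiffAt f) z).fderiv_right (m := 1)
      (WithTop.coe_le_coe.2 (le_top : (2 : ℕ∞) ≤ ⊤))).differentiableAt (by simp)
  have key : ∀ v w : ℝ × EuclideanSpace ℝ (Fin n),
      ev z (dir v (dir w f)) = fderiv ℝ (fderiv ℝ (toFun f)) z.1 v w := by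
    intro v w
    rw [ev_dir_of (g := fun y => fderiv ℝ (toFun f) y w) (fun y => rfl),
      fderiv_clm_apply hd (by fun_prop)]
    simp
  rw [key, key]
  exact (((Sm.contDiffAt f) z).isSymmSndFDerivAt (by
    simpa using WithTop.coe_le_coe.2 (le_top : (2 : ℕ∞) ≤ ⊤))) v w

/-- The time derivative. -/
def dt : Derivation ℝ (Sm n) (Sm n) := dir (1, 0)

/-- The space derivatives. -/
def dx (i : Fin n) : Derivation ℝ (Sm n) (Sm n) := dir (0, stdBasis n i)

theorem dx_comm (i j : Fin n) (f : Sm n) : dx i (dx j f) = dx j (dx i f) := dir_comm _ _ _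

theorem dt_dx_comm (i : Fin n) (f : Sm n) : dt (dx i f) = dx i (dt f) := dir_comm _ _ _

/-- The coordinate functions. -/
def X (i : Fin n) : Sm n := mk' (fun z => z.2 i) (by fun_prop)

/-- A smooth function of time. -/
def time (g : ℝ → ℝ) (hg : ContDiff ℝ (⊤ : ℕ∞) g) : Sm n :=
  mk' (fun z => g z.1) (by fun_prop)

@[simp] theorem ev_X (i : Fin n) (z : SpaceTime n) : ev z (X i) = z.1.2 i := rfl

@[simp] theorem ev_time (g : ℝ → ℝ) (hg : ContDiff ℝ (⊤ : ℕ∞) g) (z : SpaceTime n) :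
    ev z (time g hg) = g z.1.1 := rfl

theorem fderiv_coord (i : Fin n) (z v : ℝ × EuclideanSpace ℝ (Fin n)) :
    fderiv ℝ (fun z : ℝ × EuclideanSpace ℝ (Fin n) => z.2 i) z v = v.2 i := by
  have : (fun z : ℝ × EuclideanSpace ℝ (Fin n) => z.2 i) =
    ((EuclideanSpace.proj i : EuclideanSpace ℝ (Fin n) →L[ℝ] ℝ).comp
      (ContinuousLinearMap.snd ℝ ℝ (EuclideanSpace ℝ (Fin n)))) := rfl
  rw [this, ContinuousLinearMap.fderiv]; rfl

theorem dx_X (i j : Fin n) : dx i (X j) = if i = j then 1 else 0 := by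
  refine ext_ev fun z => ?_
  rw [dx, ev_dir_of (g := fun z => z.2 j) (fun y => rfl), fderiv_coord]
  by_cases h : i = j
  · simp [stdBasis, h]
  · simp [stdBasis, h, Ne.symm h]

theorem dt_X (j : Fin n) : dt (X j) = 0 := by
  refine ext_ev fun z => ?_
  rw [dt, ev_dir_of (g := fun z => z.2 j) (fun y => rfl), fderiv_coord]
  simp

theorem fderiv_comp_fst (g : ℝ → ℝ) (hg : ContDiff ℝ (⊤ : ℕ∞) g)
    (z v : ℝ × EuclideanSpace ℝ (Fin n)) :
    fderiv ℝ (fun z : ℝ × EuclideanSpace ℝ (Fin n) => g z.1) z v = deriv g z.1 * v.1 := by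
  have h1 : HasDerivAt g (deriv g z.1) z.1 := (hg.differentiable (by simp) _).hasDerivAt
  have h2 := h1.comp_hasFDerivAt z (hasFDerivAt_fst (𝕜 := ℝ) (p := z))
  have h3 := h2.fderiv
  simp only [Function.comp_def] at h3
  rw [h3]; simp

theorem dx_time (i : Fin n) (g : ℝ → ℝ) (hg : ContDiff ℝ (⊤ : ℕ∞) g) :
    dx i (time (n := n) g hg) = 0 := by
  refine ext_ev fun z => ?_
  rw [dx, ev_dir_of (g := fun z => g z.1) (fun y => rfl), fderiv_comp_fst g hg]
  simp

theorem ev_dt_time (g : ℝ → ℝ) (hg : ContDiff ℝ (⊤ : ℕ∞) g) (z : SpaceTime n) :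
    ev z (dt (time (n := n) g hg)) = deriv g z.1.1 := by
  rw [dt, ev_dir_of (g := fun z => g z.1) (fun y => rfl), fderiv_comp_fst g hg]
  simp

end Sm

section Algebra

variable {A : Type*} [CommRing A] [Algebra ℝ A] {n : ℕ}

/-- The Laplacian attached to a family of derivations. -/
def lapD (d : Fin n → Derivation ℝ A A) (f : A) : A := ∑ i, d i (d i f)

/-- The parabolic operator `∂ₜ - P Δ + b · ∇`. -/
def parOp (d : Fin n → Derivation ℝ A A) (t : Derivation ℝ A A) (P : A) (b : Fin n → A)
    (f : A) : A := t f - P * lapD d f + ∑ k, b k * d k f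

variable {d : Fin n → Derivation ℝ A A} {t : Derivation ℝ A A} {P : A} {b : Fin n → A}

theorem Derivation.map_two (D : Derivation ℝ A A) : D 2 = 0 := by
  simpa using Derivation.map_natCast D 2

theorem lapD_add (f g : A) : lapD d (f + g) = lapD d f + lapD d g := by
  simp [lapD, Finset.sum_add_distrib]

theorem lapD_sub (f g : A) : lapD d (f - g) = lapD d f - lapD d g := by
  simp [lapD, Finset.sum_sub_distrib]

theorem lapD_mul (f g : A) :
    lapD d (f * g) = f * lapD d g + g * lapD d f + 2 * ∑ k, d k f * d k g := by
  simp only [lapD, Derivation.leibniz, smul_eq_mul, map_add, Finset.mul_sum,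
    ← Finset.sum_add_distrib]
  refine Finset.sum_congr rfl fun k _ => ?_
  ring

theorem parOp_add (f g : A) : parOp d t P b (f + g) = parOp d t P b f + parOp d t P b g := by
  simp only [parOp, lapD_add, map_add, mul_add, Finset.sum_add_distrib]; ring

theorem parOp_sub (f g : A) : parOp d t P b (f - g) = parOp d t P b f - parOp d t P b g := by
  simp only [parOp, lapD_sub, map_sub, mul_sub, Finset.sum_sub_distrib]; ring

theorem parOp_sum {ι : Type*} (s : Finset ι) (f : ι → A) :
    parOp d t P b (∑ a ∈ s, f a) = ∑ a ∈ s, parOp d t P b (f a) := by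
  classical
  induction s using Finset.induction_on with
  | empty => simp [parOp, lapD]
  | insert a s ha ih => rw [Finset.sum_insert ha, Finset.sum_insert ha, parOp_add, ih]

theorem parOp_mul (f g : A) : parOp d t P b (f * g) =
    f * parOp d t P b g + g * parOp d t P b f - 2 * P * ∑ k, d k f * d k g := by
  have h : ∑ k, b k * d k (f * g) = f * ∑ k, b k * d k g + g * ∑ k, b k * d k f := by
    simp only [Finset.mul_sum, ← Finset.sum_add_distrib, Derivation.leibniz, smul_eq_mul]
    exact Finset.sum_congr rfl fun k _ => by ring
  simp only [parOp, h]
  simp only [lapD_mul, Derivation.leibniz, smul_eq_mul]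
  ring

/-- Multiplication by a function constant in space. -/
theorem parOp_mul_time (f g : A) (hf : ∀ k, d k f = 0) : parOp d t P b (f * g) =
    f * parOp d t P b g + g * t f := by
  rw [parOp_mul]
  simp [parOp, lapD, hf]

theorem parOp_sq (f : A) : parOp d t P b (f ^ 2) =
    2 * f * parOp d t P b f - 2 * P * ∑ k, d k f ^ 2 := by
  rw [sq, parOp_mul]; simp only [sq]; ring

theorem parOp_sum_sq {ι : Type*} (s : Finset ι) (f : ι → A) :
    parOp d t P b (∑ a ∈ s, f a ^ 2) =
    2 * ∑ a ∈ s, f a * parOp d t P b (f a) - 2 * P * ∑ a ∈ s, ∑ k, d k (f a) ^ 2 := by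
  rw [parOp_sum]
  simp only [parOp_sq, Finset.sum_sub_distrib, Finset.mul_sum]
  congr 1
  exact Finset.sum_congr rfl fun a _ => by ring

theorem parOp_drift (b' : Fin n → A) (f : A) : parOp d t P (fun k => b k + b' k) f =
    parOp d t P b f + ∑ k, b' k * d k f := by
  simp only [parOp, add_mul, Finset.sum_add_distrib]; ring

section Commutators

variable (hd : ∀ i j f, d i (d j f) = d j (d i f)) (ht : ∀ i f, t (d i f) = d i (t f))

include hd in
theorem lapD_deriv (i : Fin n) (f : A) : lapD d (d i f) = d i (lapD d f) := by
  simp only [lapD, map_sum]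
  exact Finset.sum_congr rfl fun k _ => by rw [hd k i f, hd k i (d k f)]

include hd ht in
theorem parOp_deriv (i : Fin n) (f : A) : parOp d t P b (d i f) =
    d i (parOp d t P b f) + d i P * lapD d f - ∑ k, d i (b k) * d k f := by
  simp only [parOp, map_add, map_sub, map_sum, Derivation.leibniz, smul_eq_mul,
    Finset.sum_add_distrib, ht, lapD_deriv hd]
  have h : ∀ k, d k (d i f) = d i (d k f) := fun k => hd k i f
  simp only [h]
  have h2 : ∑ k, d k f * d i (b k) = ∑ k, d i (b k) * d k f :=
    Finset.sum_congr rfl fun k _ => mul_comm _ _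
  rw [h2]; ring

end Commutators

/-- The algebraic setting of the rescaled pressure equation: `W` is the stationary pressure,
`h` the deviation from it, `x` the coordinates and `q` the nonlinearity constant. -/
structure PressureFlow (d : Fin n → Derivation ℝ A A) (t : Derivation ℝ A A)
    (x : Fin n → A) (q W h : A) : Prop where
  comm : ∀ i j f, d i (d j f) = d j (d i f)
  comm_time : ∀ i f, t (d i f) = d i (t f)
  d_x : ∀ i j, d i (x j) = if i = j then 1 else 0
  d_q : ∀ i, d i q = 0
  d_W : ∀ i, d i W = 2 * x i
  t_W : t W = 0
  pde : t h = (W + h) * lapD d h - 2 * q * ∑ k, x k * d k h - q * ∑ k, d k h ^ 2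

/-- The drift of the linearised pressure equation. -/
def drift (d : Fin n → Derivation ℝ A A) (x : Fin n → A) (q h : A) (k : Fin n) : A :=
  2 * q * (x k + d k h)

/-- The drift adapted to the equation of the Laplacian. -/
def drift' (d : Fin n → Derivation ℝ A A) (x : Fin n → A) (q h : A) (k : Fin n) : A :=
  drift d x q h k + (-2) * (2 * x k + d k h)

namespace PressureFlow

variable {x : Fin n → A} {q W h : A} (S : PressureFlow d t x q W h)
include S

theorem d_P (i : Fin n) : d i (W + h) = 2 * x i + d i h := by rw [map_add, S.d_W]

theorem parOp_h : parOp d t (W + h) (drift d x q h) h = q * ∑ k, d k h ^ 2 := by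
  have h1 : ∑ k, drift d x q h k * d k h = 2 * q * ∑ k, x k * d k h + 2 * q * ∑ k, d k h ^ 2 := by
    simp only [drift, Finset.mul_sum, ← Finset.sum_add_distrib]
    exact Finset.sum_congr rfl fun k _ => by ring
  rw [parOp, S.pde, h1]; ring

theorem parOp_W (b : Fin n → A) : parOp d t (W + h) b W =
    2 * ∑ k, b k * x k - 2 * n * (W + h) := by
  have h1 : lapD d W = 2 * n := by
    simp [lapD, S.d_W, S.d_x, mul_comm, Derivation.map_two]
  have h2 : ∑ k, b k * d k W = 2 * ∑ k, b k * x k := by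
    simp only [S.d_W, Finset.mul_sum]
    exact Finset.sum_congr rfl fun k _ => by ring
  rw [parOp, S.t_W, h1, h2]; ring

theorem sum_d_drift (i : Fin n) (f : A) : ∑ k, d i (drift d x q h k) * d k f =
    2 * q * d i f + 2 * q * ∑ k, d i (d k h) * d k f := by
  have h1 : ∀ k, d i (drift d x q h k) = 2 * q * ((if i = k then 1 else 0) + d i (d k h)) := by
    intro k
    simp [drift, Derivation.leibniz, S.d_x, S.d_q, Derivation.map_two]
  simp only [h1, mul_add, add_mul, Finset.sum_add_distrib]
  congr 1
  · simp
  · simp only [Finset.mul_sum]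
    exact Finset.sum_congr rfl fun k _ => by ring

theorem parOp_deriv (i : Fin n) (f : A) : parOp d t (W + h) (drift d x q h) (d i f) =
    d i (parOp d t (W + h) (drift d x q h) f) + (2 * x i + d i h) * lapD d f
    - 2 * q * d i f - 2 * q * ∑ k, d i (d k h) * d k f := by
  rw [_root_.parOp_deriv S.comm S.comm_time, S.d_P, S.sum_d_drift]; ring

theorem parOp_dh (i : Fin n) : parOp d t (W + h) (drift d x q h) (d i h) =
    (2 * x i + d i h) * lapD d h - 2 * q * d i h := by
  have h1 : d i (q * ∑ k, d k h ^ 2) = 2 * q * ∑ k, d i (d k h) * d k h := by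
    simp only [Derivation.leibniz, S.d_q, smul_eq_mul, map_sum, mul_zero, add_zero, Finset.mul_sum,
      sq]
    exact Finset.sum_congr rfl fun k _ => by ring
  rw [S.parOp_deriv, S.parOp_h, h1]; ring

theorem parOp_ddh (i j : Fin n) : parOp d t (W + h) (drift d x q h) (d j (d i h)) =
    (2 * x i + d i h) * d j (lapD d h) + (2 * x j + d j h) * d i (lapD d h)
    + (2 * (if j = i then 1 else 0) + d j (d i h)) * lapD d h - 4 * q * d j (d i h)
    - 2 * q * ∑ k, d j (d k h) * d k (d i h) := by
  rw [S.parOp_deriv, S.parOp_dh, lapD_deriv S.comm]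
  simp only [map_sub, map_add, Derivation.leibniz, smul_eq_mul, S.d_q, S.d_x,
    Derivation.map_two]
  ring

theorem parOp_dddh (i j k : Fin n) :
    parOp d t (W + h) (drift d x q h) (d k (d j (d i h))) =
    (2 * x i + d i h) * d k (d j (lapD d h)) + (2 * x j + d j h) * d k (d i (lapD d h))
    + (2 * x k + d k h) * d j (d i (lapD d h))
    + (2 * (if k = i then 1 else 0) + d k (d i h)) * d j (lapD d h)
    + (2 * (if k = j then 1 else 0) + d k (d j h)) * d i (lapD d h)
    + (2 * (if j = i then 1 else 0) + d j (d i h)) * d k (lapD d h)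
    + d k (d j (d i h)) * lapD d h - 6 * q * d k (d j (d i h))
    - 2 * q * (∑ l, d j (d l h) * d k (d l (d i h)) + ∑ l, d l (d i h) * d k (d j (d l h))
      + ∑ l, d k (d l h) * d l (d j (d i h))) := by
  have h4 : d k (4 : A) = 0 := by simpa using Derivation.map_natCast (d k) 4
  have hite : d k (if j = i then (1 : A) else 0) = 0 := by split_ifs <;> simp
  have hsum : d k (∑ l, d j (d l h) * d l (d i h)) =
      ∑ l, d j (d l h) * d k (d l (d i h)) + ∑ l, d l (d i h) * d k (d j (d l h)) := by
    simp only [map_sum, Derivation.leibniz, smul_eq_mul, Finset.sum_add_distrib]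
  rw [S.parOp_deriv, S.parOp_ddh, lapD_deriv S.comm, lapD_deriv S.comm]
  simp only [map_sub, map_add, Derivation.leibniz, smul_eq_mul, S.d_q, S.d_x,
    Derivation.map_two, h4, hite, hsum]
  ring

theorem parOp_lap : parOp d t (W + h) (drift' d x q h) (lapD d h) =
    (2 * n - 4 * q) * lapD d h + lapD d h ^ 2 - 2 * q * ∑ i, ∑ k, d i (d k h) ^ 2 := by
  have h1 : parOp d t (W + h) (drift d x q h) (lapD d h) =
      ∑ i, parOp d t (W + h) (drift d x q h) (d i (d i h)) := by
    rw [lapD, parOp_sum]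
  have h2 : ∀ i, parOp d t (W + h) (drift d x q h) (d i (d i h)) =
      2 * ((2 * x i + d i h) * d i (lapD d h)) + 2 * lapD d h + d i (d i h) * lapD d h
      - 4 * q * d i (d i h) - 2 * q * ∑ k, d i (d k h) ^ 2 := by
    intro i
    have h3 : ∑ k, d i (d k h) ^ 2 = ∑ k, d i (d k h) * d k (d i h) :=
      Finset.sum_congr rfl fun k _ => by rw [S.comm k i, sq]
    rw [S.parOp_ddh, h3]; simp only [if_true]; ring
  unfold drift'
  rw [parOp_drift, h1]
  simp only [h2, Finset.sum_add_distrib, Finset.sum_sub_distrib, ← Finset.mul_sum,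
    ← Finset.sum_mul]
  have h5 : ∑ i, d i (d i h) = lapD d h := rfl
  have h6 : ∑ k, -2 * (2 * x k + d k h) * d k (lapD d h) =
      -2 * ∑ k, (2 * x k + d k h) * d k (lapD d h) := by
    rw [Finset.mul_sum]; exact Finset.sum_congr rfl fun k _ => by ring
  rw [h5, h6]
  simp only [Finset.sum_const, Finset.card_univ, Fintype.card_fin, nsmul_eq_mul]
  ring

theorem parOp_dlap (i : Fin n) :
    parOp d t (W + h) (drift' d x q h) (d i (lapD d h)) =
    (2 * x i + d i h) * lapD d (lapD d h) + (2 * n - 6 * q + 4) * d i (lapD d h)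
    + 2 * lapD d h * d i (lapD d h) - 4 * q * ∑ j, ∑ k, d j (d k h) * d i (d j (d k h))
    - (2 * q - 2) * ∑ k, d i (d k h) * d k (lapD d h) := by
  have h1 : ∀ f, ∑ k, d i (drift' d x q h k) * d k f =
      (2 * q - 4) * d i f + (2 * q - 2) * ∑ k, d i (d k h) * d k f := by
    intro f
    have h2 : ∀ k, d i (drift' d x q h k) * d k f =
      d i (drift d x q h k) * d k f - 4 * ((if i = k then 1 else 0) * d k f)
        - 2 * (d i (d k h) * d k f) := by
      intro k
      simp only [drift', map_add, map_neg, Derivation.leibniz, smul_eq_mul, S.d_x,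
        Derivation.map_two]
      ring
    simp only [h2, Finset.sum_sub_distrib, S.sum_d_drift, ← Finset.mul_sum]
    simp
    ring
  have h3 : d i (∑ j, ∑ k, d j (d k h) ^ 2) =
      2 * ∑ j, ∑ k, d j (d k h) * d i (d j (d k h)) := by
    simp only [map_sum, Finset.mul_sum, sq, Derivation.leibniz, smul_eq_mul]
    exact Finset.sum_congr rfl fun j _ => Finset.sum_congr rfl fun k _ => by ring
  have h4 : d i (4 : A) = 0 := by simpa using Derivation.map_natCast (d i) 4
  rw [_root_.parOp_deriv S.comm S.comm_time, S.parOp_lap, h1, S.d_P]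
  simp only [map_sub, map_add, Derivation.leibniz, smul_eq_mul, S.d_q,
    Derivation.map_two, Derivation.map_natCast, h3, h4, sq (lapD d h)]
  ring

end PressureFlow
end Algebra

namespace Sm

variable {n : ℕ}

theorem ev_dir_eq_toFun (f : Sm n) (v : ℝ × EuclideanSpace ℝ (Fin n))
    {z : ℝ × EuclideanSpace ℝ (Fin n)} (hz : 0 < z.1) :
    toFun (dir v f) z = fderiv ℝ (toFun f) z v := by
  have := toFun_apply (dir v f) ⟨z, hz⟩
  rw [this]; rfl

theorem hasDerivAt_line (f : Sm n) (z v : ℝ × EuclideanSpace ℝ (Fin n)) (s : ℝ)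
    (hz : 0 < (z + s • v).1) :
    HasDerivAt (fun r : ℝ => toFun f (z + r • v)) (toFun (dir v f) (z + s • v)) s := by
  have h1 : HasDerivAt (fun r : ℝ => z + r • v) v s := by
    simpa using ((hasDerivAt_id s).smul_const v).const_add z
  have h2 := (differentiableAt f ⟨z + s • v, hz⟩).hasFDerivAt.comp_hasDerivAt s h1
  rw [ev_dir_eq_toFun f v hz]
  exact h2

theorem continuousAt (f : Sm n) {z : ℝ × EuclideanSpace ℝ (Fin n)} (hz : 0 < z.1) :
    ContinuousAt (toFun f) z := (differentiableAt f ⟨z, hz⟩).continuousAt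

theorem second_deriv_nonpos {φ φ' : ℝ → ℝ} {c : ℝ} (h1 : ∀ s, HasDerivAt φ (φ' s) s)
    (h2 : HasDerivAt φ' c 0) (hmax : IsLocalMax φ 0) : c ≤ 0 := by
  by_contra! hc
  have hd : deriv φ = φ' := funext fun s => (h1 s).deriv
  have h0 : deriv φ 0 = 0 := hmax.deriv_eq_zero
  have hmin : IsLocalMin φ 0 :=
    isLocalMin_of_deriv_deriv_pos (by rw [hd, h2.deriv]; exact hc) h0 (h1 0).continuousAt
  have heq : φ =ᶠ[𝓝 0] fun _ => φ 0 := by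
    filter_upwards [hmax, hmin] with s ha hb using le_antisymm ha hb
  have h3 := heq.deriv
  have h4 := h3.deriv_eq
  rw [hd, h2.deriv] at h4
  simp at h4
  exact hc.ne' h4

/-- First touching argument for a finite family of functions on a space-time cylinder. -/
theorem neg_of_no_touching {ι : Type*} [Finite ι] (F : ι → Sm n)
    {K : Set (EuclideanSpace ℝ (Fin n))} (hK : IsCompact K) {t₀ t₁ : ℝ} (ht₀ : 0 < t₀)
    (hinit : ∀ i (z : SpaceTime n), z.1.1 = t₀ → z.1.2 ∈ K → ev z (F i) < 0)
    (hbdry : ∀ i (z : SpaceTime n), t₀ ≤ z.1.1 → z.1.1 ≤ t₁ → z.1.2 ∈ K → z.1.2 ∉ interior K →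
      ev z (F i) < 0)
    (htouch : ∀ i (z : SpaceTime n), t₀ ≤ z.1.1 → z.1.1 ≤ t₁ → z.1.2 ∈ interior K →
      ev z (F i) = 0 → (∀ j, ev z (F j) ≤ 0) → 0 ≤ ev z (dt (F i)) →
      (∀ k, ev z (dx k (F i)) = 0) → (∀ k, ev z (dx k (dx k (F i))) ≤ 0) → False)
    (i : ι) (z : SpaceTime n) (hz₀ : t₀ ≤ z.1.1) (hz₁ : z.1.1 ≤ t₁) (hzK : z.1.2 ∈ K) :
    ev z (F i) < 0 := by
  by_contra! hneg
  set C : Set (ℝ × EuclideanSpace ℝ (Fin n)) := Set.Icc t₀ t₁ ×ˢ K with hC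
  have hCc : IsCompact C := isCompact_Icc.prod hK
  have hCpos : ∀ w ∈ C, 0 < w.1 := fun w hw => ht₀.trans_le hw.1.1
  set S : Set (ℝ × EuclideanSpace ℝ (Fin n)) := ⋃ j, C ∩ toFun (F j) ⁻¹' Set.Ici 0 with hS
  have hcont : ∀ j, ContinuousOn (toFun (F j)) C := fun j w hw =>
    (continuousAt (F j) (hCpos w hw)).continuousWithinAt
  have hSc : IsClosed S := isClosed_iUnion_of_finite fun j =>
    (hcont j).preimage_isClosed_of_isClosed hCc.isClosed isClosed_Ici
  have hSC : S ⊆ C := Set.iUnion_subset fun j => Set.inter_subset_left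
  have hScomp : IsCompact S := hCc.of_isClosed_subset hSc hSC
  have hzS : z.1 ∈ S := Set.mem_iUnion.2 ⟨i, ⟨⟨⟨hz₀, hz₁⟩, hzK⟩, by
    simpa [toFun_apply] using hneg⟩⟩
  obtain ⟨w, hwS, hwmin⟩ := hScomp.exists_isMinOn ⟨_, hzS⟩ continuous_fst.continuousOn
  obtain ⟨j, hwC, hwj⟩ := Set.mem_iUnion.1 hwS
  obtain ⟨τ, x⟩ := w
  have hτ₀ : t₀ ≤ τ := hwC.1.1
  have hτ₁ : τ ≤ t₁ := hwC.1.2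
  have hxK : x ∈ K := hwC.2
  have hτ : 0 < τ := ht₀.trans_le hτ₀
  replace hwj : 0 ≤ toFun (F j) (τ, x) := hwj
  let z' : SpaceTime n := ⟨(τ, x), hτ⟩
  have hev : ∀ f : Sm n, toFun f (τ, x) = ev z' f := fun f => toFun_apply f z'
  have hτlt : t₀ < τ := by
    rcases hτ₀.lt_or_eq with h | h
    · exact h
    · exact absurd (hinit j z' h.symm hxK) (not_lt.2 (by rw [← hev]; exact hwj))
  have hbefore : ∀ k s y, t₀ ≤ s → s < τ → y ∈ K → toFun (F k) (s, y) < 0 := by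
    intro k s y hs hsτ hy
    by_contra! hk
    have : (s, y) ∈ S := Set.mem_iUnion.2 ⟨k, ⟨⟨hs, hsτ.le.trans hτ₁⟩, hy⟩, hk⟩
    exact absurd (hwmin this) (not_le.2 hsτ)
  have hleft : ∀ᶠ s in 𝓝[<] τ, t₀ ≤ s ∧ s < τ := by
    filter_upwards [Ico_mem_nhdsLT hτlt] with s hs using ⟨hs.1, hs.2⟩
  have hle : ∀ k y, y ∈ K → toFun (F k) (τ, y) ≤ 0 := by
    intro k y hy
    have hc : Tendsto (fun s : ℝ => toFun (F k) (s, y)) (𝓝[<] τ) (𝓝 (toFun (F k) (τ, y))) :=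
      ((continuousAt (F k) (z := (τ, y)) hτ).comp (f := fun s : ℝ => (s, y))
        (by fun_prop)).tendsto.mono_left nhdsWithin_le_nhds
    exact le_of_tendsto hc (hleft.mono fun s hs => (hbefore k s y hs.1 hs.2 hy).le)
  have hzero : toFun (F j) (τ, x) = 0 := le_antisymm (hle j x hxK) hwj
  have hxint : x ∈ interior K := by
    by_contra hx
    exact absurd (hbdry j z' hτ₀ hτ₁ hxK hx) (not_lt.2 (by rw [← hev]; exact hwj))
  refine htouch j z' hτ₀ hτ₁ hxint ((hev _).symm.trans hzero)
    (fun k => (hev _).symm.trans_le (hle k x hxK)) ?_ ?_ ?_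
  · have h1 := hasDerivAt_line (F j) (0, x) (1, 0) τ (by simpa using hτ)
    simp only [Prod.smul_mk, smul_eq_mul, mul_one, smul_zero, Prod.mk_add_mk, zero_add,
      add_zero] at h1
    rw [← hev]
    have h2 := h1.hasDerivWithinAt (s := Set.Iio τ)
    rw [hasDerivWithinAt_iff_tendsto_slope' (by simp)] at h2
    refine ge_of_tendsto h2 ?_
    filter_upwards [hleft] with s hs
    rw [slope_def_field, hzero]
    exact div_nonneg_of_nonpos (by linarith [hbefore j s x hs.1 hs.2 hxK]) (by linarith [hs.2])
  all_goals
    intro k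
    set v : ℝ × EuclideanSpace ℝ (Fin n) := (0, stdBasis n k) with hv
    have hpos : ∀ s : ℝ, 0 < ((τ, x) + s • v).1 := fun s => by simpa [hv] using hτ
    have h1 := fun s => hasDerivAt_line (F j) (τ, x) v s (hpos s)
    have h2 := hasDerivAt_line (dx k (F j)) (τ, x) v 0 (hpos 0)
    have hmax : IsLocalMax (fun r : ℝ => toFun (F j) ((τ, x) + r • v)) 0 := by
      have hc : Tendsto (fun r : ℝ => x + r • stdBasis n k) (𝓝 0) (𝓝 x) := by
        have : Continuous fun r : ℝ => x + r • stdBasis n k := by fun_prop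
        simpa using this.tendsto 0
      filter_upwards [hc (mem_interior_iff_mem_nhds.1 hxint)] with r hr
      simpa [hv, hzero] using hle j _ hr
  · have h3 := (h1 0).deriv ▸ hmax.deriv_eq_zero
    change ev z' (dir v (F j)) = 0
    simpa [hev] using h3
  · have h3 := second_deriv_nonpos h1 h2 hmax
    change ev z' (dir v (dx k (F j))) ≤ 0
    simpa [hev] using h3

/-- The maximum principle for finitely many strict subsolutions of parabolic operators. -/
theorem neg_of_parOp {ι : Type*} [Finite ι] (F : ι → Sm n) (P : Sm n) (b : ι → Fin n → Sm n)
    {K : Set (EuclideanSpace ℝ (Fin n))} (hK : IsCompact K) {t₀ t₁ : ℝ} (ht₀ : 0 < t₀)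
    (hP : ∀ z : SpaceTime n, t₀ ≤ z.1.1 → z.1.1 ≤ t₁ → z.1.2 ∈ interior K → 0 ≤ ev z P)
    (hinit : ∀ i (z : SpaceTime n), z.1.1 = t₀ → z.1.2 ∈ K → ev z (F i) < 0)
    (hbdry : ∀ i (z : SpaceTime n), t₀ ≤ z.1.1 → z.1.1 ≤ t₁ → z.1.2 ∈ K → z.1.2 ∉ interior K →
      ev z (F i) < 0)
    (htouch : ∀ i (z : SpaceTime n), t₀ ≤ z.1.1 → z.1.1 ≤ t₁ → z.1.2 ∈ interior K →
      ev z (F i) = 0 → (∀ j, ev z (F j) ≤ 0) → ev z (parOp dx dt P (b i) (F i)) < 0)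
    (i : ι) (z : SpaceTime n) (hz₀ : t₀ ≤ z.1.1) (hz₁ : z.1.1 ≤ t₁) (hzK : z.1.2 ∈ K) :
    ev z (F i) < 0 := by
  refine neg_of_no_touching F hK ht₀ hinit hbdry ?_ i z hz₀ hz₁ hzK
  intro i z h₀ h₁ hz he hle hdt hdx hdd
  have h1 := htouch i z h₀ h₁ hz he hle
  have h2 : ev z (lapD dx (F i)) ≤ 0 := by
    rw [lapD, map_sum]; exact Finset.sum_nonpos fun k _ => hdd k
  simp only [parOp, map_add, map_sub, map_mul, map_sum, hdx, mul_zero,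
    Finset.sum_const_zero, add_zero] at h1
  nlinarith [mul_nonneg (hP z h₀ h₁ hz) (neg_nonneg.2 h2)]

end Sm

namespace Sm

variable {n : ℕ}

/-- The stationary pressure `B + |x|²`. -/
def statP (n : ℕ) (B : ℝ) : Sm n := algebraMap ℝ (Sm n) B + ∑ i, X i ^ 2

theorem ev_algebraMap (z : SpaceTime n) (c : ℝ) : ev z (algebraMap ℝ (Sm n) c) = c := by
  simp

@[simp] theorem ev_two (z : SpaceTime n) : ev z 2 = 2 := map_ofNat (ev z) 2

@[simp] theorem ev_four (z : SpaceTime n) : ev z 4 = 4 := map_ofNat (ev z) 4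

@[simp] theorem ev_six (z : SpaceTime n) : ev z 6 = 6 := map_ofNat (ev z) 6

theorem ev_statP (B : ℝ) (z : SpaceTime n) : ev z (statP n B) = B + ∑ i, z.1.2 i ^ 2 := by
  simp [statP]

theorem ev_statP_eq_norm (B : ℝ) (z : SpaceTime n) : ev z (statP n B) = B + ‖z.1.2‖ ^ 2 := by
  rw [ev_statP, EuclideanSpace.norm_sq_eq]; simp

theorem statP_pos {B : ℝ} (hB : 0 < B) (z : SpaceTime n) : 0 < ev z (statP n B) := by
  rw [ev_statP_eq_norm]; positivity

theorem abs_coord_le {B : ℝ} (hB : 0 < B) (z : SpaceTime n) (k : Fin n) :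
    |z.1.2 k| ≤ √(ev z (statP n B)) := by
  refine Real.abs_le_sqrt ?_
  rw [ev_statP]
  have := Finset.single_le_sum (f := fun i => z.1.2 i ^ 2) (fun i _ => sq_nonneg _)
    (Finset.mem_univ k)
  simp only at this
  linarith

/-- `h` is a deviation from the stationary pressure whose sum with it solves the rescaled
pressure equation. -/
def IsFlow (q B : ℝ) (h : Sm n) : Prop :=
  dt h = (statP n B + h) * lapD dx h - 2 * algebraMap ℝ (Sm n) q * ∑ k, X k * dx k h
    - algebraMap ℝ (Sm n) q * ∑ k, dx k h ^ 2

theorem dx_statP (B : ℝ) (i : Fin n) : dx i (statP n B) = 2 * X i := by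
  simp [statP, Derivation.leibniz_pow, dx_X]

theorem dt_statP (B : ℝ) : dt (statP n B) = 0 := by
  simp [statP, Derivation.leibniz_pow, dt_X]

theorem IsFlow.pressureFlow {q B : ℝ} {h : Sm n} (hh : IsFlow q B h) :
    PressureFlow dx dt X (algebraMap ℝ (Sm n) q) (statP n B) h where
  comm i j f := dx_comm i j f
  comm_time i f := dt_dx_comm i f
  d_x := dx_X
  d_q i := by simp
  d_W := dx_statP B
  t_W := dt_statP B
  pde := hh

/-- The parabolic operator linearising the pressure equation. -/
def linOp (q B : ℝ) (h : Sm n) (f : Sm n) : Sm n :=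
  parOp dx dt (statP n B + h) (drift dx X (algebraMap ℝ (Sm n) q) h) f

theorem ev_drift (q : ℝ) (h : Sm n) (k : Fin n) (z : SpaceTime n) :
    ev z (drift dx X (algebraMap ℝ (Sm n) q) h k) = 2 * q * (z.1.2 k + ev z (dx k h)) := by
  simp [drift]

theorem abs_sum_le_card_mul {ι : Type*} [Fintype ι] {f : ι → ℝ} {c : ℝ} (h : ∀ i, |f i| ≤ c) :
    |∑ i, f i| ≤ Fintype.card ι * c := by
  refine (Finset.abs_sum_le_sum_abs _ _).trans ?_
  refine (Finset.sum_le_sum fun i _ => h i).trans ?_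
  simp

/-- Bound for the parabolic operator applied to the weight. -/
theorem abs_linOp_statP_le {q B : ℝ} (hq : 0 ≤ q) (hB : 0 < B) {h : Sm n} (hh : IsFlow q B h)
    {z : SpaceTime n} (hz : |ev z h| ≤ ev z (statP n B) / 8) {a : ℝ}
    (ha : ∀ k, |ev z (dx k h)| ≤ a) (ha0 : 0 ≤ a) :
    |ev z (linOp q B h (statP n B))| ≤
      4 * n * (q + 1) * (ev z (statP n B) * (1 + a / √(ev z (statP n B)))) := by
  have hw := statP_pos hB z
  set w := ev z (statP n B) with hwdef
  have hr : 0 < √w := Real.sqrt_pos.2 hw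
  have hrw : √w * √w = w := Real.mul_self_sqrt hw.le
  have h1 : ev z (linOp q B h (statP n B)) =
      2 * ∑ k, 2 * q * (z.1.2 k + ev z (dx k h)) * z.1.2 k - 2 * n * (w + ev z h) := by
    rw [linOp, hh.pressureFlow.parOp_W]
    simp [ev_drift, hwdef]
  have h2 : |∑ k, 2 * q * (z.1.2 k + ev z (dx k h)) * z.1.2 k| ≤ n * (2 * q * (w + √w * a)) := by
    have := abs_sum_le_card_mul (f := fun k => 2 * q * (z.1.2 k + ev z (dx k h)) * z.1.2 k)
      (c := 2 * q * (w + √w * a)) (fun k => by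
        rw [abs_mul, abs_mul, abs_of_nonneg (by positivity : 0 ≤ 2 * q), mul_assoc]
        refine mul_le_mul_of_nonneg_left ?_ (by positivity)
        have h3 := abs_coord_le hB z k
        have h4 := (abs_add_le (z.1.2 k) (ev z (dx k h))).trans (add_le_add h3 (ha k))
        calc _ ≤ (√w + a) * √w := mul_le_mul h4 h3 (abs_nonneg _) (by positivity)
          _ = _ := by rw [add_mul, hrw]; ring)
    simpa using this
  have h5 : w * (1 + a / √w) = w + √w * a := by
    have h8 : a / √w * (√w * √w) = √w * a := by field_simp
    rw [hrw] at h8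
    linarith
  rw [h1, h5]
  have h6 : |2 * (n : ℝ) * (w + ev z h)| ≤ 2 * n * (2 * w) := by
    rw [abs_mul, abs_of_nonneg (by positivity : 0 ≤ 2 * (n : ℝ))]
    refine mul_le_mul_of_nonneg_left ?_ (by positivity)
    exact (abs_add_le _ _).trans (by rw [abs_of_pos hw]; linarith)
  refine (abs_sub _ _).trans ?_
  rw [abs_mul, abs_two]
  have h7 : 0 ≤ 4 * (n : ℝ) * (√w * a) := by positivity
  nlinarith

theorem sqrt_mul_abs_dx_pow_le {B : ℝ} (hB : 0 < B) (z : SpaceTime n) (j : ℕ) (k : Fin n) :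
    √(ev z (statP n B)) * |ev z (dx k (statP n B ^ j))| ≤ 2 * j * ev z (statP n B) ^ j := by
  have hw := statP_pos hB z
  set w := ev z (statP n B) with hwdef
  have hrw : √w * √w = w := Real.mul_self_sqrt hw.le
  induction j with
  | zero => simp
  | succ j ih =>
    have h1 : ev z (dx k (statP n B ^ (j + 1))) =
        w * ev z (dx k (statP n B ^ j)) + w ^ j * (2 * z.1.2 k) := by
      rw [pow_succ', Derivation.leibniz, dx_statP]; simp [hwdef, -Derivation.leibniz_pow]
    rw [h1]
    have h3 := abs_coord_le hB z k
    have h2 : |w * ev z (dx k (statP n B ^ j)) + w ^ j * (2 * z.1.2 k)| ≤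
        w * |ev z (dx k (statP n B ^ j))| + w ^ j * (2 * √w) := by
      refine (abs_add_le _ _).trans ?_
      rw [abs_mul, abs_mul, abs_mul, abs_of_pos hw, abs_of_pos (pow_pos hw j), abs_two]
      gcongr
    calc _ ≤ √w * (w * |ev z (dx k (statP n B ^ j))| + w ^ j * (2 * √w)) := by gcongr
      _ = w * (√w * |ev z (dx k (statP n B ^ j))|) + 2 * w ^ j * (√w * √w) := by ring
      _ ≤ w * (2 * j * w ^ j) + 2 * w ^ j * w := by rw [hrw]; gcongr
      _ = _ := by push_cast; ring

theorem linOp_mul (q B : ℝ) (h f g : Sm n) : linOp q B h (f * g) =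
    f * linOp q B h g + g * linOp q B h f - 2 * (statP n B + h) * ∑ k, dx k f * dx k g :=
  parOp_mul f g

theorem exists_abs_linOp_pow_le {q B : ℝ} (hq : 0 ≤ q) (hB : 0 < B) (n j : ℕ) :
    ∃ C : ℝ, 0 ≤ C ∧ ∀ (h : Sm n), IsFlow q B h → ∀ (z : SpaceTime n),
      |ev z h| ≤ ev z (statP n B) / 8 → ∀ a, 0 ≤ a → (∀ k, |ev z (dx k h)| ≤ a) →
      |ev z (linOp q B h (statP n B ^ j))| ≤
        C * (ev z (statP n B) ^ j * (1 + a / √(ev z (statP n B)))) := by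
  induction j with
  | zero =>
    refine ⟨0, le_rfl, fun h _ z _ a _ _ => ?_⟩
    simp [linOp, parOp, lapD]
  | succ j ih =>
    obtain ⟨C, hC, ih⟩ := ih
    refine ⟨C + 4 * n * (q + 1) + 16 * n * j, by positivity, fun h hh z hz a ha0 ha => ?_⟩
    have h1 := ih h hh z hz a ha0 ha
    have h2 := abs_linOp_statP_le hq hB hh hz ha ha0
    have hw := statP_pos hB z
    set w := ev z (statP n B) with hwdef
    have hr : 0 < √w := Real.sqrt_pos.2 hw
    have hrw : √w * √w = w := Real.mul_self_sqrt hw.le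
    have h3 : ev z (linOp q B h (statP n B ^ (j + 1))) =
        w * ev z (linOp q B h (statP n B ^ j)) + w ^ j * ev z (linOp q B h (statP n B))
        - 2 * (w + ev z h) * ∑ k, 2 * z.1.2 k * ev z (dx k (statP n B ^ j)) := by
      rw [pow_succ', linOp_mul]; simp [dx_statP, hwdef, -Derivation.leibniz_pow]
    have h4 : |∑ k, 2 * z.1.2 k * ev z (dx k (statP n B ^ j))| ≤ n * (4 * j * w ^ j) := by
      have := abs_sum_le_card_mul (f := fun k => 2 * z.1.2 k * ev z (dx k (statP n B ^ j)))
        (c := 4 * j * w ^ j) (fun k => by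
          rw [abs_mul, abs_mul, abs_two]
          have h5 := abs_coord_le hB z k
          have h6 := sqrt_mul_abs_dx_pow_le hB z j k
          calc _ ≤ 2 * √w * |ev z (dx k (statP n B ^ j))| := by gcongr
            _ ≤ _ := by linarith)
      simpa using this
    have h7 : |w + ev z h| ≤ 2 * w := by
      exact (abs_add_le _ _).trans (by rw [abs_of_pos hw]; linarith)
    have hθ : 1 ≤ 1 + a / √w := by
      have : 0 ≤ a / √w := by positivity
      linarith
    set θ := 1 + a / √w with hθdef
    rw [h3]
    calc _ ≤ |w * ev z (linOp q B h (statP n B ^ j))| + |w ^ j * ev z (linOp q B h (statP n B))|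
        + |2 * (w + ev z h) * ∑ k, 2 * z.1.2 k * ev z (dx k (statP n B ^ j))| :=
          (abs_sub _ _).trans (add_le_add_left (abs_add_le _ _) _)
      _ ≤ w * (C * (w ^ j * θ)) + w ^ j * (4 * n * (q + 1) * (w * θ))
        + 2 * (2 * w) * (n * (4 * j * w ^ j)) := by
          simp only [abs_mul _ (_ : ℝ), abs_of_pos hw, abs_of_pos (pow_pos hw j), abs_two]
          gcongr
      _ = (C + 4 * n * (q + 1)) * (w ^ (j + 1) * θ) + 16 * n * j * (w ^ (j + 1) * 1) := by ring
      _ ≤ (C + 4 * n * (q + 1)) * (w ^ (j + 1) * θ) + 16 * n * j * (w ^ (j + 1) * θ) := by gcongr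
      _ = _ := by ring

end Sm

namespace Sm

variable {n : ℕ}

/-- Sum of squares of a finite family. -/
def sqSum {ι : Type*} [Fintype ι] (f : ι → Sm n) : Sm n := ∑ α, f α ^ 2

/-- Sum of squares of the gradients of a finite family. -/
def gradSqSum {ι : Type*} [Fintype ι] (f : ι → Sm n) : Sm n := ∑ α, ∑ k, dx k (f α) ^ 2

section Family

variable {ι : Type*} [Fintype ι] (f : ι → Sm n) (z : SpaceTime n)

theorem ev_sqSum : ev z (sqSum f) = ∑ α, ev z (f α) ^ 2 := by simp [sqSum]

theorem ev_gradSqSum : ev z (gradSqSum f) = ∑ α, ∑ k, ev z (dx k (f α)) ^ 2 := by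
  simp [gradSqSum]

theorem sqSum_nonneg : 0 ≤ ev z (sqSum f) := by
  rw [ev_sqSum]; positivity

theorem gradSqSum_nonneg : 0 ≤ ev z (gradSqSum f) := by
  rw [ev_gradSqSum]; positivity

theorem abs_ev_le_sqSum (α : ι) : |ev z (f α)| ≤ √(ev z (sqSum f)) := by
  refine Real.abs_le_sqrt ?_
  rw [ev_sqSum]
  exact Finset.single_le_sum (f := fun α => ev z (f α) ^ 2) (fun i _ => sq_nonneg _)
    (Finset.mem_univ α)

theorem abs_ev_dx_le_gradSqSum (α : ι) (k : Fin n) :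
    |ev z (dx k (f α))| ≤ √(ev z (gradSqSum f)) := by
  refine Real.abs_le_sqrt ?_
  rw [ev_gradSqSum]
  refine (Finset.single_le_sum (f := fun k => ev z (dx k (f α)) ^ 2) (fun i _ => sq_nonneg _)
    (Finset.mem_univ k)).trans ?_
  exact Finset.single_le_sum (f := fun α => ∑ k, ev z (dx k (f α)) ^ 2)
    (fun i _ => Finset.sum_nonneg fun _ _ => sq_nonneg _) (Finset.mem_univ α)

theorem ev_dx_sqSum (k : Fin n) :
    ev z (dx k (sqSum f)) = 2 * ∑ α, ev z (f α) * ev z (dx k (f α)) := by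
  simp only [sqSum, map_sum, sq, Derivation.leibniz, smul_eq_mul, map_add, map_mul,
    Finset.mul_sum]
  exact Finset.sum_congr rfl fun α _ => by ring

theorem abs_ev_dx_sqSum_le (k : Fin n) : |ev z (dx k (sqSum f))| ≤
    2 * (Fintype.card ι * (√(ev z (sqSum f)) * √(ev z (gradSqSum f)))) := by
  rw [ev_dx_sqSum, abs_mul, abs_two]
  gcongr
  refine abs_sum_le_card_mul fun α => ?_
  rw [abs_mul]
  gcongr
  · exact abs_ev_le_sqSum f z α
  · exact abs_ev_dx_le_gradSqSum f z α k

theorem ev_linOp_sqSum (q B : ℝ) (h : Sm n) : ev z (linOp q B h (sqSum f)) =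
    2 * ∑ α, ev z (f α) * ev z (linOp q B h (f α))
      - 2 * (ev z (statP n B) + ev z h) * ev z (gradSqSum f) := by
  rw [linOp, sqSum, parOp_sum_sq]
  simp [gradSqSum, linOp]

end Family

theorem family_real_bound {w r P A a a' ζ θ S T L M N K C₁ Cj : ℝ} {j : ℕ}
    (hw : 0 < w) (hrr : r * r = w) (hr : 0 < r) (hP : 7 / 8 * w ≤ P)
    (hζ : 0 ≤ ζ) (hζ1 : ζ ≤ 1) (ha : 0 ≤ a) (ha' : 0 ≤ a')
    (hS : ζ * S ≤ K * a * (r * a') + M * a * a)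
    (hT : |T| ≤ N * w ^ j * (r * (a * a'))) (hN : 0 ≤ N) (hM : 0 ≤ M)
    (hL : |L| ≤ Cj * (w ^ j * θ)) (hζθ : ζ * θ ≤ 1 + C₁) (hCj : 0 ≤ Cj) (hC₁ : 0 ≤ C₁)
    (hA : A = w ^ j * (2 * S - 2 * P * (a' * a')) + a * a * L - T) :
    ζ ^ 2 * A ≤ -(ζ ^ 2 * (w ^ (j + 1) * (a' * a'))) +
      (2 * M + Cj * (1 + C₁) + (2 * K + N) ^ 2) * (w ^ j * (a * a)) := by
  have hwj : 0 < w ^ j := pow_pos hw j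
  set y := ζ * (r * a') with hy
  have hy0 : 0 ≤ y := by positivity
  have e1 : ζ ^ 2 * (w ^ j * (2 * S)) ≤ w ^ j * (2 * (K * a * y + M * a * a)) := by
    have : ζ ^ 2 * (w ^ j * (2 * S)) = w ^ j * (2 * (ζ * (ζ * S))) := by ring
    rw [this]
    have h1 : ζ * (ζ * S) ≤ ζ * (K * a * (r * a') + M * a * a) :=
      mul_le_mul_of_nonneg_left hS hζ
    have h2 : ζ * (M * a * a) ≤ M * a * a := mul_le_of_le_one_left (by positivity) hζ1
    gcongr
    calc _ ≤ _ := h1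
      _ = K * a * y + ζ * (M * a * a) := by rw [hy]; ring
      _ ≤ _ := by linarith
  have e2 : ζ ^ 2 * (w ^ j * (2 * P * (a' * a'))) ≥ 7 / 4 * (w ^ j * y ^ 2) := by
    have : w ^ j * y ^ 2 = ζ ^ 2 * (w ^ j * (w * (a' * a'))) := by rw [hy, ← hrr]; ring
    rw [this]
    have h1 : 7 / 4 * w * (a' * a') ≤ 2 * P * (a' * a') := by
      have : 0 ≤ a' * a' := by positivity
      nlinarith
    have h2 : ζ ^ 2 * (w ^ j * (7 / 4 * w * (a' * a'))) ≤ ζ ^ 2 * (w ^ j * (2 * P * (a' * a'))) := by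
      gcongr
    linarith
  have e3 : ζ ^ 2 * (a * a * L) ≤ w ^ j * (Cj * (1 + C₁) * (a * a)) := by
    have h1 : L ≤ Cj * (w ^ j * θ) := (le_abs_self _).trans hL
    have h2 : ζ ^ 2 * (a * a * L) ≤ ζ ^ 2 * (a * a * (Cj * (w ^ j * θ))) := by gcongr
    have hθ : ζ * (ζ * θ) ≤ 1 + C₁ := by
      by_cases h : 0 ≤ ζ * θ
      · exact (mul_le_of_le_one_left h hζ1).trans hζθ
      · exact (mul_nonpos_of_nonneg_of_nonpos hζ (not_le.1 h).le).trans (by positivity)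
    calc _ ≤ _ := h2
      _ = w ^ j * Cj * (a * a) * (ζ * (ζ * θ)) := by ring
      _ ≤ w ^ j * Cj * (a * a) * (1 + C₁) := by gcongr
      _ = _ := by ring
  have e4 : ζ ^ 2 * (-T) ≤ w ^ j * (N * a * y) := by
    have h1 : -T ≤ N * w ^ j * (r * (a * a')) := (neg_le_abs _).trans hT
    calc ζ ^ 2 * (-T) ≤ ζ ^ 2 * (N * w ^ j * (r * (a * a'))) := by gcongr
      _ = ζ * (w ^ j * (N * a * y)) := by rw [hy]; ring
      _ ≤ _ := mul_le_of_le_one_left (by positivity) hζ1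
  have e5 : (2 * K + N) * a * y ≤ y ^ 2 / 4 + (2 * K + N) ^ 2 * (a * a) := by
    nlinarith [sq_nonneg (y / 2 - (2 * K + N) * a)]
  have e6 : w ^ j * ((2 * K + N) * a * y) ≤ w ^ j * (y ^ 2 / 4 + (2 * K + N) ^ 2 * (a * a)) := by
    gcongr
  have e7 : ζ ^ 2 * (w ^ (j + 1) * (a' * a')) = w ^ j * y ^ 2 := by
    rw [hy, pow_succ, ← hrr]; ring
  have e8 : 0 ≤ w ^ j * y ^ 2 := by positivity
  rw [hA, e7]
  nlinarith

/-- Evolution of weighted sums of squares, in the presence of a cutoff factor. -/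
theorem exists_linOp_family_le {q B : ℝ} (hq : 0 ≤ q) (hB : 0 < B) (n j : ℕ) {ι : Type*}
    [Fintype ι] {C₀ C₁ : ℝ} (hC₀ : 0 ≤ C₀) (hC₁ : 0 ≤ C₁) :
    ∃ C : ℝ, 0 ≤ C ∧ ∀ (h : Sm n), IsFlow q B h → ∀ (f : ι → Sm n) (z : SpaceTime n),
      |ev z h| ≤ ev z (statP n B) / 8 → ∀ ζ a μ : ℝ, 0 ≤ ζ → ζ ≤ 1 → 0 ≤ a →
      (∀ k, |ev z (dx k h)| ≤ a) → ζ * a ≤ C₁ * √(ev z (statP n B)) → ζ * μ ≤ C₁ →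
      (∀ α, |ev z (linOp q B h (f α))| ≤ C₀ * ((√(ev z (statP n B)) + a) *
        √(ev z (gradSqSum f)) + μ * √(ev z (sqSum f)))) →
      ζ ^ 2 * ev z (linOp q B h (statP n B ^ j * sqSum f)) ≤
        -(ζ ^ 2 * ev z (statP n B ^ (j + 1) * gradSqSum f)) +
          C * ev z (statP n B ^ j * sqSum f) := by
  obtain ⟨Cj, hCj, hj⟩ := exists_abs_linOp_pow_le hq hB n j
  set N : ℝ := (Fintype.card ι : ℝ) with hN
  have hN0 : 0 ≤ N := by positivity
  refine ⟨2 * (N * C₀ * C₁) + Cj * (1 + C₁) +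
    (2 * (N * C₀ * (1 + C₁)) + 16 * n * j * N) ^ 2, by positivity, ?_⟩
  intro h hh f z hz ζ a μ hζ hζ1 ha hga hζa hζμ hf
  have hw := statP_pos hB z
  have hL := hj h hh z hz a ha hga
  have hdW := sqrt_mul_abs_dx_pow_le hB z j
  have hexp : ev z (linOp q B h (statP n B ^ j * sqSum f)) =
      ev z (statP n B) ^ j * (2 * ∑ α, ev z (f α) * ev z (linOp q B h (f α))
        - 2 * (ev z (statP n B) + ev z h) *
          (√(ev z (gradSqSum f)) * √(ev z (gradSqSum f))))
      + √(ev z (sqSum f)) * √(ev z (sqSum f)) * ev z (linOp q B h (statP n B ^ j))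
      - 2 * (ev z (statP n B) + ev z h) *
        ∑ k, ev z (dx k (statP n B ^ j)) * ev z (dx k (sqSum f)) := by
    rw [Real.mul_self_sqrt (sqSum_nonneg f z), Real.mul_self_sqrt (gradSqSum_nonneg f z),
      ← ev_linOp_sqSum, linOp_mul]
    simp [-Derivation.leibniz_pow]
  have hD := abs_ev_dx_sqSum_le f z
  have hfa := abs_ev_le_sqSum f z
  simp only [map_mul, map_pow]
  rw [← Real.mul_self_sqrt (gradSqSum_nonneg f z)]
  rw [← Real.mul_self_sqrt (sqSum_nonneg f z)]
  set w := ev z (statP n B) with hwdef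
  set D := √(ev z (sqSum f))
  set D' := √(ev z (gradSqSum f))
  have hD0 : 0 ≤ D := Real.sqrt_nonneg _
  have hD'0 : 0 ≤ D' := Real.sqrt_nonneg _
  have hr : 0 < √w := Real.sqrt_pos.2 hw
  have hrw : √w * √w = w := Real.mul_self_sqrt hw.le
  have hz' := abs_le.1 hz
  refine family_real_bound (K := N * C₀ * (1 + C₁)) (M := N * C₀ * C₁) (N := 16 * n * j * N)
    (θ := 1 + a / √w) (C₁ := C₁)
    hw hrw hr (P := w + ev z h) (by linarith [hz'.1]) hζ hζ1 hD0 hD'0 ?_ ?_ (by positivity)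
    (by positivity) hL ?_ hCj hC₁ hexp
  · have h1 : |∑ α, ev z (f α) * ev z (linOp q B h (f α))| ≤
        N * (D * (C₀ * ((√w + a) * D' + μ * D))) :=
      abs_sum_le_card_mul fun α => by
        rw [abs_mul]
        exact mul_le_mul (hfa α) (hf α) (abs_nonneg _) hD0
    have h2 : ζ * (√w + a) ≤ (1 + C₁) * √w := by nlinarith
    calc ζ * ∑ α, ev z (f α) * ev z (linOp q B h (f α))
        ≤ ζ * (N * (D * (C₀ * ((√w + a) * D' + μ * D)))) := by
          gcongr; exact (le_abs_self _).trans h1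
      _ = N * C₀ * D * D' * (ζ * (√w + a)) + N * C₀ * D * D * (ζ * μ) := by ring
      _ ≤ N * C₀ * D * D' * ((1 + C₁) * √w) + N * C₀ * D * D * C₁ := by gcongr
      _ = _ := by ring
  · rw [abs_mul, abs_mul, abs_two]
    have h7 : |w + ev z h| ≤ 2 * w :=
      (abs_add_le _ _).trans (by rw [abs_of_pos hw]; linarith)
    have h3 : ∀ k, |ev z (dx k (statP n B ^ j)) * ev z (dx k (sqSum f))| ≤
        2 * j * w ^ j / √w * (2 * (N * (D * D'))) := by
      intro k
      rw [abs_mul]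
      refine mul_le_mul ?_ (hD k) (abs_nonneg _) (by positivity)
      rw [le_div_iff₀ hr, mul_comm]
      exact hdW k
    have h4 := abs_sum_le_card_mul h3
    rw [Fintype.card_fin] at h4
    calc _ ≤ 2 * (2 * w) * (n * (2 * j * w ^ j / √w * (2 * (N * (D * D'))))) := by gcongr
      _ = 16 * n * j * N * w ^ j * (w / √w * (D * D')) := by ring
      _ = _ := by rw [Real.div_sqrt]
  · have : ζ * (1 + a / √w) = ζ + ζ * a / √w := by ring
    rw [this]
    have h5 : ζ * a / √w ≤ C₁ := by rw [div_le_iff₀ hr]; exact hζa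
    linarith


/-- Gradient bound for weighted sums of squares. -/
theorem statP_mul_dx_sq_le {B : ℝ} (hB : 0 < B) (j : ℕ) {ι : Type*} [Fintype ι] (f : ι → Sm n)
    (z : SpaceTime n) (k : Fin n) :
    ev z (statP n B) * ev z (dx k (statP n B ^ j * sqSum f)) ^ 2 ≤
      (8 * j ^ 2 + 8 * (Fintype.card ι : ℝ) ^ 2) * (ev z (statP n B ^ j * sqSum f) ^ 2 +
        ev z (statP n B ^ j * sqSum f) * ev z (statP n B ^ (j + 1) * gradSqSum f)) := by
  have hw := statP_pos hB z
  have h1 := sqrt_mul_abs_dx_pow_le hB z j k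
  have h2 := abs_ev_dx_sqSum_le f z k
  have e1 : ev z (dx k (statP n B ^ j * sqSum f)) =
      ev z (statP n B) ^ j * ev z (dx k (sqSum f)) +
        √(ev z (sqSum f)) ^ 2 * ev z (dx k (statP n B ^ j)) := by
    rw [Real.sq_sqrt (sqSum_nonneg f z), Derivation.leibniz]; simp [-Derivation.leibniz_pow]
  rw [e1]
  simp only [map_mul, map_pow]
  rw [← Real.sq_sqrt (gradSqSum_nonneg f z)]
  nth_rewrite 2 3 [← Real.sq_sqrt (sqSum_nonneg f z)]
  set w := ev z (statP n B) with hwdef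
  set D := √(ev z (sqSum f))
  set D' := √(ev z (gradSqSum f))
  set N := (Fintype.card ι : ℝ)
  have hr : 0 < √w := Real.sqrt_pos.2 hw
  have hrw : √w ^ 2 = w := Real.sq_sqrt hw.le
  have hD0 : 0 ≤ D := Real.sqrt_nonneg _
  have hD'0 : 0 ≤ D' := Real.sqrt_nonneg _
  have hN : 0 ≤ N := by positivity
  set Q := ev z (dx k (sqSum f))
  set T := ev z (dx k (statP n B ^ j))
  have h3 : |√w * (w ^ j * Q + D ^ 2 * T)| ≤
      2 * N * (w ^ j * √w * D * D') + 2 * j * (w ^ j * D ^ 2) := by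
    have : √w * (w ^ j * Q + D ^ 2 * T) = √w * w ^ j * Q + D ^ 2 * (√w * T) := by ring
    rw [this]
    refine (abs_add_le _ _).trans ?_
    rw [abs_mul _ Q, abs_mul (D ^ 2), abs_of_nonneg (by positivity : 0 ≤ √w * w ^ j),
      abs_of_nonneg (by positivity : 0 ≤ D ^ 2), abs_mul, abs_of_pos hr]
    calc _ ≤ √w * w ^ j * (2 * (N * (D * D'))) + D ^ 2 * (2 * j * w ^ j) := by gcongr
      _ = _ := by ring
  have h4 := sq_le_sq' (by linarith [neg_abs_le (√w * (w ^ j * Q + D ^ 2 * T))])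
    ((le_abs_self _).trans h3)
  rw [mul_pow, hrw] at h4
  refine h4.trans ?_
  set u := w ^ j * √w * D * D'
  set v := w ^ j * D ^ 2
  have e2 : w ^ j * D ^ 2 * (w ^ (j + 1) * D' ^ 2) = u ^ 2 := by
    have : u ^ 2 = (w ^ j) ^ 2 * √w ^ 2 * D ^ 2 * D' ^ 2 := by simp only [u]; ring
    rw [this, hrw, pow_succ]; ring
  rw [e2]
  nlinarith [sq_nonneg (2 * N * u - 2 * j * v), sq_nonneg (N * v), sq_nonneg (j * u)]

end Sm

namespace Sm

variable {n : ℕ}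

theorem linOp_add (q B : ℝ) (h f g : Sm n) :
    linOp q B h (f + g) = linOp q B h f + linOp q B h g := parOp_add f g

theorem linOp_sub (q B : ℝ) (h f g : Sm n) :
    linOp q B h (f - g) = linOp q B h f - linOp q B h g := parOp_sub f g

theorem linOp_sq (q B : ℝ) (h f : Sm n) : linOp q B h (f ^ 2) =
    2 * f * linOp q B h f - 2 * (statP n B + h) * ∑ k, dx k f ^ 2 := parOp_sq f

theorem ev_linOp_time_mul (q B : ℝ) (h f : Sm n) (g : ℝ → ℝ) (hg : ContDiff ℝ (⊤ : ℕ∞) g)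
    (z : SpaceTime n) : ev z (linOp q B h (time g hg * f)) =
      g z.1.1 * ev z (linOp q B h f) + deriv g z.1.1 * ev z f := by
  rw [linOp, parOp_mul_time _ _ fun k => dx_time k g hg]
  simp [ev_dt_time, linOp, mul_comm]

theorem ev_linOp_const_mul (q B : ℝ) (h f : Sm n) (c : ℝ) (z : SpaceTime n) :
    ev z (linOp q B h (algebraMap ℝ _ c * f)) = c * ev z (linOp q B h f) := by
  rw [linOp, parOp_mul_time _ _ fun k => by simp]
  simp [linOp]

theorem ev_linOp_sq_mul (q B : ℝ) (h f g : Sm n) (z : SpaceTime n) :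
    ev z (linOp q B h (f ^ 2 * g)) = ev z f ^ 2 * ev z (linOp q B h g) +
      ev z g * (2 * ev z f * ev z (linOp q B h f) -
        2 * (ev z (statP n B) + ev z h) * ∑ k, ev z (dx k f) ^ 2) -
      2 * (ev z (statP n B) + ev z h) *
        (2 * ev z f * ∑ k, ev z (dx k f) * ev z (dx k g)) := by
  rw [linOp_mul, linOp_sq]
  have : ∀ k, dx k (f ^ 2) * dx k g = 2 * f * (dx k f * dx k g) := fun k => by
    rw [sq, Derivation.leibniz]; simp only [smul_eq_mul]; ring
  simp only [this, ← Finset.mul_sum]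
  simp

/-- Sublevel sets of the stationary pressure. -/
def weightBall (n : ℕ) (B R : ℝ) : Set (EuclideanSpace ℝ (Fin n)) := {x | B + ‖x‖ ^ 2 ≤ R}

theorem isCompact_weightBall (n : ℕ) {B R : ℝ} (hB : 0 < B) : IsCompact (weightBall n B R) := by
  refine Metric.isCompact_of_isClosed_isBounded
    (isClosed_le (by fun_prop) continuous_const) ?_
  refine (Metric.isBounded_closedBall (x := 0) (r := √R)).subset fun x hx => ?_
  rw [mem_closedBall_zero_iff]
  refine Real.le_sqrt_of_sq_le ?_
  have : B + ‖x‖ ^ 2 ≤ R := hx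
  linarith

theorem mem_weightBall {B R : ℝ} {z : SpaceTime n} :
    z.1.2 ∈ weightBall n B R ↔ ev z (statP n B) ≤ R := by
  rw [ev_statP_eq_norm]; rfl

theorem ev_statP_eq_of_notMem_interior {B R : ℝ} {z : SpaceTime n}
    (h : z.1.2 ∈ weightBall n B R) (h' : z.1.2 ∉ interior (weightBall n B R)) :
    ev z (statP n B) = R := by
  refine le_antisymm (mem_weightBall.1 h) ?_
  by_contra! hlt
  refine h' ?_
  have ho : IsOpen {x : EuclideanSpace ℝ (Fin n) | B + ‖x‖ ^ 2 < R} :=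
    isOpen_lt (by fun_prop) continuous_const
  rw [ev_statP_eq_norm] at hlt
  exact mem_interior.2 ⟨{x | B + ‖x‖ ^ 2 < R}, fun x hx => le_of_lt (show _ < R from hx), ho, hlt⟩

/-- Pointwise differential inequalities allowing one step of interior regularity. -/
structure StepData (q B C₀ δ : ℝ) (h U V G : Sm n) (z : SpaceTime n) : Prop where
  abs_h : |ev z h| ≤ ev z (statP n B) / 8
  U_nonneg : 0 ≤ ev z U
  U_le : ev z U ≤ C₀ * δ ^ 2 * ev z (statP n B) ^ 2
  V_nonneg : 0 ≤ ev z V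
  G_nonneg : 0 ≤ ev z G
  opU : ev z (linOp q B h U) ≤ -ev z V + C₀ * δ ^ 2 * ev z (statP n B) ^ 2
  opV : ∀ ζ, 0 ≤ ζ → ζ ≤ 1 → ζ ^ 2 * ev z V ≤ ev z (statP n B) ^ 2 →
    ζ ^ 2 * ev z (linOp q B h V) ≤ -(ζ ^ 2 * ev z G) + C₀ * ev z V
  grad_h : ev z (statP n B) * ev z (sqSum fun k => dx k h) ≤
    ev z V + C₀ * ev z (statP n B) ^ 2
  grad_V : ∀ k, ev z (statP n B) * ev z (dx k V) ^ 2 ≤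
    C₀ * (ev z V ^ 2 + ev z V * ev z G)

theorem step_touch_neg {w P ζ Oζ S Sc V G Y K A C₀ δ OU OV OW y N Cz Cw : ℝ}
    (hw : 0 < w) (hP0 : 0 ≤ P) (hP : P ≤ 9 / 8 * w) (hζ : 0 ≤ ζ) (hζ1 : ζ ≤ 1) (hS : 0 ≤ S)
    (hN : 0 ≤ N) (hy0 : 0 ≤ y) (hSc : |Sc| ≤ 2 * N * y / w)
    (hy : y ^ 2 = C₀ * (V ^ 2 + V * G)) (hV : 0 ≤ V) (hG : 0 ≤ G)
    (hC₀ : 1 ≤ C₀) (hY0 : 0 < Y) (hA0 : 0 ≤ A) (hAY : A * C₀ * δ ^ 2 ≤ Y)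
    (hOU : OU ≤ -V + C₀ * δ ^ 2 * w ^ 2) (hOV : ζ ^ 2 * OV ≤ -(ζ ^ 2 * G) + C₀ * V)
    (hOζ : ζ * Oζ ≤ Cz) (hOW : Y * |OW| ≤ Cw * (Y * w ^ 2 + V))
    (hA : A = C₀ + 2 * Cz + 1 + 81 * N ^ 2 * C₀ / 2 + Cw) (hK : K = 2 + Cw) :
    ζ ^ 2 * OV + V * (2 * ζ * Oζ - 2 * P * S) - 2 * P * (2 * ζ * Sc) + A * OU
      - (Y * OW + K * Y * w ^ 2) < 0 := by
  have e1 : V * (2 * ζ * Oζ - 2 * P * S) ≤ 2 * Cz * V := by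
    have : 0 ≤ V * (2 * P * S) := by positivity
    nlinarith
  have e2 : -(2 * P * (2 * ζ * Sc)) ≤ 9 * N * ζ * y := by
    have h1 : -Sc ≤ 2 * N * y / w := (neg_le_abs _).trans hSc
    have h0 : 0 ≤ 2 * N * y / w := by positivity
    calc -(2 * P * (2 * ζ * Sc)) = 4 * P * ζ * (-Sc) := by ring
      _ ≤ 4 * P * ζ * (2 * N * y / w) := by gcongr
      _ ≤ 4 * (9 / 8 * w) * ζ * (2 * N * y / w) := by gcongr
      _ = _ := by field_simp; ring
  have e3 : 9 * N * ζ * y ≤ ζ ^ 2 * (V + G) / 2 + 81 * N ^ 2 * C₀ / 2 * V := by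
    refine abs_le_of_sq_le_sq' ?_ (by positivity) |>.2
    have : (9 * N * ζ * y) ^ 2 = 4 * (ζ ^ 2 * (V + G) / 2) * (81 * N ^ 2 * C₀ / 2 * V) := by
      rw [mul_pow, hy]; ring
    rw [this]
    nlinarith [sq_nonneg (ζ ^ 2 * (V + G) / 2 - 81 * N ^ 2 * C₀ / 2 * V)]
  have e4 : A * OU ≤ -(A * V) + A * C₀ * δ ^ 2 * w ^ 2 := by nlinarith
  have e5 : A * C₀ * δ ^ 2 * w ^ 2 ≤ Y * w ^ 2 := by gcongr
  have e6 : -(Y * OW) ≤ Cw * (Y * w ^ 2 + V) := by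
    refine le_trans ?_ hOW
    rw [← mul_neg]
    exact mul_le_mul_of_nonneg_left (neg_le_abs _) hY0.le
  have e7 : ζ ^ 2 * V ≤ V := mul_le_of_le_one_left hV (pow_le_one₀ hζ hζ1)
  have e8 : 0 < Y * w ^ 2 := by positivity
  have e9 : 0 ≤ ζ ^ 2 * G := by positivity
  have e10 : A * V = C₀ * V + 2 * Cz * V + V + 81 * N ^ 2 * C₀ / 2 * V + Cw * V := by
    rw [hA]; ring
  have e11 : K * Y * w ^ 2 = 2 * (Y * w ^ 2) + Cw * (Y * w ^ 2) := by rw [hK]; ring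
  nlinarith

theorem mul_le_of_cutoff {w r c a V C₀ : ℝ} (hw : 0 < w) (hr : 0 < r) (hrw : r ^ 2 = w)
    (hc : 0 ≤ c) (hc1 : c ≤ 1) (hC₀ : 1 ≤ C₀) (hcV : c ^ 2 * V ≤ w ^ 2)
    (ha : w * a ^ 2 ≤ V + C₀ * w ^ 2) : c * a ≤ (1 + C₀) * r := by
  refine abs_le_of_sq_le_sq' ?_ (by positivity) |>.2
  have h1 : c ^ 2 * (w * a ^ 2) ≤ c ^ 2 * (V + C₀ * w ^ 2) := by gcongr
  have h3 : c ^ 2 * (C₀ * w ^ 2) ≤ C₀ * w ^ 2 :=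
    mul_le_of_le_one_left (by positivity) (pow_le_one₀ hc hc1)
  have h4 : w * (c ^ 2 * a ^ 2) ≤ w * ((1 + C₀) * w) := by linarith
  have h5 := le_of_mul_le_mul_left h4 hw
  rw [mul_pow, mul_pow, hrw]
  refine h5.trans (mul_le_mul_of_nonneg_right ?_ hw.le)
  exact le_self_pow₀ (by linarith) two_ne_zero

theorem sq_mul_div_le {w r a : ℝ} (hr : 0 < r) (hrw : r ^ 2 = w) :
    w ^ 2 * (a / r) ≤ w ^ 2 + w * a ^ 2 := by
  have h : a = a / r * r := (div_mul_cancel₀ a hr.ne').symm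
  have h2 : w * a ^ 2 = w ^ 2 * (a / r) ^ 2 := by
    rw [h, ← hrw]; field_simp
  rw [h2, ← mul_one_add]
  gcongr
  nlinarith [sq_nonneg (a / r - 1)]

set_option maxHeartbeats 1600000 in
/-- One step of interior regularity, by a Bernstein type argument. -/
theorem exists_step_bound {q B C₀ : ℝ} (hq : 0 ≤ q) (hB : 0 < B) (n : ℕ) (hC₀ : 1 ≤ C₀) :
    ∃ C δ₁ : ℝ, 0 < C ∧ 0 < δ₁ ∧ ∀ h : Sm n, IsFlow q B h → ∀ t₀ : ℝ, 0 < t₀ →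
      ∀ δ : ℝ, 0 < δ → δ ≤ δ₁ → ∀ U V G : Sm n,
      (∀ z : SpaceTime n, t₀ ≤ z.1.1 → z.1.1 ≤ t₀ + 1 → StepData q B C₀ δ h U V G z) →
      ∀ z : SpaceTime n, z.1.1 = t₀ + 1 → ev z V ≤ C * δ ^ 2 * ev z (statP n B) ^ 2 := by
  obtain ⟨C₂, hC₂, hop2⟩ := exists_abs_linOp_pow_le hq hB n 2
  set Cz : ℝ := 1 + 4 * n * (q + 1) * (2 + C₀) with hCz
  set Cw : ℝ := C₂ * (2 + C₀) with hCw
  have hC₀0 : 0 ≤ C₀ := zero_le_one.trans hC₀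
  have hCz0 : 0 ≤ Cz := by positivity
  have hCw0 : 0 ≤ Cw := by positivity
  set A : ℝ := C₀ + 2 * Cz + 1 + 81 * (n : ℝ) ^ 2 * C₀ / 2 + Cw with hA
  set K : ℝ := 2 + Cw with hK
  have hA1 : 1 ≤ A := by
    have : 0 ≤ 2 * Cz + 81 * (n : ℝ) ^ 2 * C₀ / 2 + Cw := by positivity
    linarith
  have hA0 : 0 < A := by linarith
  have hE : 1 ≤ Real.exp K := Real.one_le_exp (by positivity)
  set M : ℝ := 2 * A * C₀ * Real.exp K with hM
  have hM1 : 1 ≤ M := by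
    have : 1 ≤ A * C₀ := one_le_mul_of_one_le_of_one_le hA1 hC₀
    nlinarith
  refine ⟨4 * M, 1 / M, by positivity, by positivity, ?_⟩
  intro h hh t₀ ht₀ δ hδ hδ1 U V G hD z₁ hz₁
  have hδM : M * δ ^ 2 ≤ 1 := by
    have h1 : δ ≤ 1 := hδ1.trans (by rw [div_le_one (by positivity)]; exact hM1)
    rw [le_div_iff₀ (by positivity)] at hδ1
    nlinarith
  set Y₀ : ℝ := 2 * A * C₀ * δ ^ 2 with hY₀
  have hY₀p : 0 < Y₀ := by positivity
  set R : ℝ := 2 * ev z₁ (statP n B) with hR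
  have hR0 : 0 < R := by have := statP_pos hB z₁; positivity
  set g : ℝ → ℝ := fun t => Y₀ * Real.exp (K * (t - t₀)) with hg
  have hgs : ContDiff ℝ (⊤ : ℕ∞) g := by fun_prop
  have hg' : ∀ t, deriv g t = K * g t := fun t => by
    have : HasDerivAt g (Y₀ * (Real.exp (K * (t - t₀)) * (K * 1))) t :=
      ((((hasDerivAt_id t).sub_const t₀).const_mul K).exp).const_mul Y₀
    rw [this.deriv, hg]; ring
  have hg1 : ∀ t, t ≤ t₀ + 1 → g t ≤ M * δ ^ 2 := fun t ht => by
    have : Real.exp (K * (t - t₀)) ≤ Real.exp K :=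
      Real.exp_le_exp.2 (mul_le_of_le_one_right (by positivity) (by linarith))
    calc g t ≤ Y₀ * Real.exp K := by simp only [hg]; gcongr
      _ = _ := by rw [hY₀, hM]; ring
  have hg0 : ∀ t, t₀ ≤ t → Y₀ ≤ g t := fun t ht => by
    have : 1 ≤ Real.exp (K * (t - t₀)) :=
      Real.one_le_exp (mul_nonneg (by positivity) (by linarith))
    exact le_mul_of_one_le_right hY₀p.le this
  have hsub : ContDiff ℝ (⊤ : ℕ∞) (fun t : ℝ => t - t₀) := by fun_prop
  set Z : Sm n := 1 - algebraMap ℝ _ R⁻¹ * statP n B with hZ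
  set ζ : Sm n := time _ hsub * Z with hζdef
  have hZev : ∀ z : SpaceTime n, ev z Z = 1 - R⁻¹ * ev z (statP n B) := fun z => by simp [hZ]
  have hζev : ∀ z : SpaceTime n, ev z ζ = (z.1.1 - t₀) * (1 - R⁻¹ * ev z (statP n B)) :=
    fun z => by simp [hζdef, hZev]
  have hζdx : ∀ (z : SpaceTime n) k, ev z (dx k ζ) = -((z.1.1 - t₀) * (R⁻¹ * (2 * z.1.2 k))) :=
    fun z k => by simp [hζdef, hZ, Derivation.leibniz, dx_time, dx_statP]
  have hζop : ∀ z : SpaceTime n, ev z (linOp q B h ζ) =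
      (1 - R⁻¹ * ev z (statP n B)) -
        (z.1.1 - t₀) * R⁻¹ * ev z (linOp q B h (statP n B)) := fun z => by
    have h1 : linOp q B h (1 : Sm n) = 0 := by simp [linOp, parOp, lapD]
    have h2 : deriv (fun t : ℝ => t - t₀) z.1.1 = 1 := by simp
    rw [hζdef, ev_linOp_time_mul, h2, hZ, linOp_sub, map_sub, ev_linOp_const_mul, h1]
    simp only [map_sub, map_zero, map_one, map_mul, ev_algebraMap]
    ring
  set F : Sm n := ζ ^ 2 * V + algebraMap ℝ _ A * U - time g hgs * statP n B ^ 2 with hF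
  have hFev : ∀ z : SpaceTime n, ev z F =
      ev z ζ ^ 2 * ev z V + A * ev z U - g z.1.1 * ev z (statP n B) ^ 2 := fun z => by
    simp [hF]
  have hFneg : ∀ z : SpaceTime n, t₀ ≤ z.1.1 → z.1.1 ≤ t₀ + 1 → ev z ζ = 0 → ev z F < 0 := by
    intro z h0 h1 hz
    have hd := hD z h0 h1
    have hw := statP_pos hB z
    rw [hFev, hz]
    have h2 := hg0 _ h0
    have h3 : A * ev z U ≤ Y₀ / 2 * ev z (statP n B) ^ 2 := by
      calc A * ev z U ≤ A * (C₀ * δ ^ 2 * ev z (statP n B) ^ 2) := by gcongr; exact hd.U_le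
        _ = _ := by rw [hY₀]; ring
    have h4 : Y₀ * ev z (statP n B) ^ 2 ≤ g z.1.1 * ev z (statP n B) ^ 2 := by gcongr
    have h5 : 0 < Y₀ * ev z (statP n B) ^ 2 := by positivity
    linarith
  have hmain : ev z₁ F < 0 := by
    refine neg_of_parOp (ι := Unit) (fun _ => F) (statP n B + h)
      (fun _ => drift dx X (algebraMap ℝ (Sm n) q) h) (isCompact_weightBall n (R := R) hB) ht₀
      (t₁ := t₀ + 1) ?_ ?_ ?_ ?_ () z₁ (by linarith) hz₁.le ?_
    · intro z h0 h1 _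
      have hd := abs_le.1 (hD z h0 h1).abs_h
      have hw := statP_pos hB z
      rw [map_add]; linarith [hd.1]
    · intro _ z h0 _
      exact hFneg z h0.ge (by linarith) (by rw [hζev, h0]; ring)
    · intro _ z h0 h1 hz hz'
      refine hFneg z h0 h1 ?_
      rw [hζev, ev_statP_eq_of_notMem_interior hz hz', inv_mul_cancel₀ hR0.ne']; ring
    · intro _ z h0 h1 hz he _
      have hd := hD z h0 h1
      change ev z (linOp q B h F) < 0
      have hw := statP_pos hB z
      have hwR : ev z (statP n B) ≤ R := mem_weightBall.1 (interior_subset hz)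
      have hlin : ev z (linOp q B h F) = ev z ζ ^ 2 * ev z (linOp q B h V) +
          ev z V * (2 * ev z ζ * ev z (linOp q B h ζ) -
            2 * (ev z (statP n B) + ev z h) * ∑ k, ev z (dx k ζ) ^ 2) -
          2 * (ev z (statP n B) + ev z h) *
            (2 * ev z ζ * ∑ k, ev z (dx k ζ) * ev z (dx k V)) + A * ev z (linOp q B h U) -
          (g z.1.1 * ev z (linOp q B h (statP n B ^ 2)) +
            K * g z.1.1 * ev z (statP n B) ^ 2) := by
        rw [hF, linOp_sub, linOp_add, map_sub, map_add, ev_linOp_sq_mul, ev_linOp_const_mul,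
          ev_linOp_time_mul q B h _ g hgs z, hg', map_pow]
      rw [hlin]
      have hOW0 := hop2 h hh z hd.abs_h _ (Real.sqrt_nonneg _)
        (abs_ev_le_sqSum (fun k => dx k h) z)
      have hOW1 := abs_linOp_statP_le hq hB hh hd.abs_h
        (abs_ev_le_sqSum (fun k => dx k h) z) (Real.sqrt_nonneg _)
      have hζ0 : 0 ≤ ev z ζ := by
        rw [hζev]
        refine mul_nonneg (by linarith) ?_
        rw [sub_nonneg, inv_mul_le_iff₀ hR0]; linarith
      have hζ1 : ev z ζ ≤ 1 := by
        rw [hζev]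
        have : 0 ≤ R⁻¹ * ev z (statP n B) := by positivity
        exact mul_le_one₀ (by linarith) (by rw [sub_nonneg, inv_mul_le_iff₀ hR0]; linarith)
          (by linarith)
      have hζop' := hζop z
      have hζdx' := hζdx z
      have hxk := abs_coord_le hB z
      have he' := hFev z
      rw [he] at he'
      have hgY := hg0 _ h0
      have hgM := (hg1 _ h1).trans hδM
      have hopV := hd.opV _ hζ0 hζ1
      have hgV := hd.grad_V
      have hgh := hd.grad_h
      have hUn := hd.U_nonneg
      have hVn := hd.V_nonneg
      have hGn := hd.G_nonneg
      have habs := abs_le.1 hd.abs_h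
      have hDn := sqSum_nonneg (fun k => dx k h) z
      have hDs := Real.sq_sqrt hDn
      have hζle : 0 ≤ 1 - R⁻¹ * ev z (statP n B) := by
        rw [sub_nonneg, inv_mul_le_iff₀ hR0]; linarith
      set w := ev z (statP n B) with hwdef
      set a := √(ev z (sqSum fun k => dx k h))
      have ha : 0 ≤ a := Real.sqrt_nonneg _
      have hr : 0 < √w := Real.sqrt_pos.2 hw
      have hrw : √w ^ 2 = w := Real.sq_sqrt hw.le
      set c := ev z ζ
      rw [← hDs] at hgh
      have hcV : c ^ 2 * ev z V ≤ w ^ 2 := by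
        have : 0 ≤ A * ev z U := by positivity
        have : g z.1.1 * w ^ 2 ≤ w ^ 2 := mul_le_of_le_one_left (by positivity) hgM
        linarith
      have hca : c * a ≤ (1 + C₀) * √w :=
        mul_le_of_cutoff hw hr hrw hζ0 hζ1 hC₀ hcV hgh
      have hY : 0 < g z.1.1 := hY₀p.trans_le hgY
      set Y := g z.1.1
      refine step_touch_neg (C₀ := C₀) (δ := δ) (Cz := Cz) (Cw := Cw) (N := n) (G := ev z G)
        (y := √(C₀ * (ev z V ^ 2 + ev z V * ev z G))) hw (by linarith [habs.1])
        (by linarith [habs.2]) hζ0 hζ1 (by positivity) (by positivity) (Real.sqrt_nonneg _)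
        ?_ (Real.sq_sqrt (by positivity)) hVn hGn hC₀ hY hA0.le ?_ hd.opU (hopV hcV) ?_ ?_ hA hK
      · set y := √(C₀ * (ev z V ^ 2 + ev z V * ev z G))
        have h1 : ∀ k, |ev z (dx k ζ) * ev z (dx k V)| ≤ 2 * y / w := by
          intro k
          have h2 : |ev z (dx k ζ)| ≤ 2 / √w := by
            rw [hζdx', abs_neg, abs_mul, abs_mul, abs_mul, abs_two,
              abs_of_nonneg (by linarith : 0 ≤ z.1.1 - t₀), abs_of_pos (inv_pos.2 hR0)]
            calc (z.1.1 - t₀) * (R⁻¹ * (2 * |z.1.2 k|)) ≤ 1 * (w⁻¹ * (2 * √w)) := by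
                  gcongr
                  · linarith
                  · exact hxk k
              _ = 2 / √w := by
                  rw [← hrw]; field_simp
                  rw [Real.sqrt_sq hr.le]
          have h3 : |ev z (dx k V)| ≤ y / √w := by
            rw [le_div_iff₀ hr]
            refine Real.le_sqrt_of_sq_le ?_
            rw [mul_pow, hrw, sq_abs, mul_comm]
            exact hgV k
          rw [abs_mul]
          calc _ ≤ 2 / √w * (y / √w) := by gcongr
            _ = 2 * y / w := by rw [div_mul_div_comm, ← sq, hrw]
        have h4 := abs_sum_le_card_mul h1
        rw [Fintype.card_fin] at h4
        refine h4.trans (le_of_eq ?_)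
        ring
      · have : 0 ≤ A * C₀ * δ ^ 2 := by positivity
        linarith
      · have h1 : c * -((z.1.1 - t₀) * R⁻¹ * ev z (linOp q B h (statP n B))) ≤
            4 * n * (q + 1) * (2 + C₀) := by
          have h3 : (z.1.1 - t₀) * R⁻¹ ≤ w⁻¹ := by
            calc (z.1.1 - t₀) * R⁻¹ ≤ 1 * w⁻¹ := by
                  gcongr
                  linarith
              _ = w⁻¹ := one_mul _
          have h4 : 0 ≤ (z.1.1 - t₀) * R⁻¹ := mul_nonneg (by linarith) (by positivity)
          have h5 : c * (1 + a / √w) ≤ 2 + C₀ := by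
            have : c * a / √w ≤ 1 + C₀ := by rw [div_le_iff₀ hr]; exact hca
            have e : c * (1 + a / √w) = c + c * a / √w := by ring
            linarith
          calc c * -((z.1.1 - t₀) * R⁻¹ * ev z (linOp q B h (statP n B)))
              = c * ((z.1.1 - t₀) * R⁻¹ * -ev z (linOp q B h (statP n B))) := by ring
            _ ≤ c * (w⁻¹ * (4 * n * (q + 1) * (w * (1 + a / √w)))) := by
                refine mul_le_mul_of_nonneg_left ?_ hζ0
                refine (mul_le_mul_of_nonneg_left ((neg_le_abs _).trans hOW1) h4).trans ?_
                gcongr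
            _ = 4 * n * (q + 1) * (c * (1 + a / √w)) := by field_simp
            _ ≤ _ := by gcongr
        rw [hζop', hCz, sub_eq_add_neg, mul_add]
        have h2 : 1 - R⁻¹ * w ≤ 1 := by
          have : 0 ≤ R⁻¹ * w := by positivity
          linarith
        have h3 := mul_le_one₀ hζ1 hζle h2
        linarith
      · have h1 : w ^ 2 * (a / √w) ≤ w ^ 2 + w * a ^ 2 := sq_mul_div_le hr hrw
        calc Y * |ev z (linOp q B h (statP n B ^ 2))|
            ≤ Y * (C₂ * (w ^ 2 * (1 + a / √w))) := by gcongr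
          _ = C₂ * (Y * (w ^ 2 + w ^ 2 * (a / √w))) := by ring
          _ ≤ C₂ * (Y * (w ^ 2 + (w ^ 2 + (ev z V + C₀ * w ^ 2)))) := by
              gcongr
              linarith
          _ = C₂ * ((2 + C₀) * (Y * w ^ 2) + Y * ev z V) := by ring
          _ ≤ C₂ * ((2 + C₀) * (Y * w ^ 2) + (2 + C₀) * ev z V) := by
              gcongr
              linarith
          _ = _ := by rw [hCw]; ring
    · rw [mem_weightBall, hR]; linarith [statP_pos hB z₁]
  rw [hFev, hζev, hz₁, hR] at hmain
  have hw := statP_pos hB z₁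
  have hd := hD z₁ (by linarith) hz₁.le
  have h1 : (t₀ + 1 - t₀) * (1 - (2 * ev z₁ (statP n B))⁻¹ * ev z₁ (statP n B)) = 1 / 2 := by
    field_simp; ring
  rw [h1] at hmain
  have h2 := hg1 (t₀ + 1) le_rfl
  have h3 : 0 ≤ A * ev z₁ U := mul_nonneg hA0.le hd.U_nonneg
  have h4 : g (t₀ + 1) * ev z₁ (statP n B) ^ 2 ≤ M * δ ^ 2 * ev z₁ (statP n B) ^ 2 := by gcongr
  linarith

end Sm

namespace Sm

variable {n : ℕ}

/-- The family of all first derivatives of a family. -/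
def grads {ι : Type*} (f : ι → Sm n) (α : ι × Fin n) : Sm n := dx α.2 (f α.1)

theorem sqSum_grads {ι : Type*} [Fintype ι] (f : ι → Sm n) : sqSum (grads f) = gradSqSum f := by
  simp only [sqSum, gradSqSum, grads, Fintype.sum_prod_type]

/-- First derivatives. -/
def grad1 (h : Sm n) (i : Fin n) : Sm n := dx i h

/-- Second derivatives. -/
def grad2 (h : Sm n) : Fin n × Fin n → Sm n := grads (grad1 h)

/-- Third derivatives. -/
def grad3 (h : Sm n) : (Fin n × Fin n) × Fin n → Sm n := grads (grad2 h)

/-- Size of the first derivatives. -/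
def size1 (h : Sm n) (z : SpaceTime n) : ℝ := √(ev z (sqSum (grad1 h)))

/-- Size of the second derivatives. -/
def size2 (h : Sm n) (z : SpaceTime n) : ℝ := √(ev z (sqSum (grad2 h)))

/-- Size of the third derivatives. -/
def size3 (h : Sm n) (z : SpaceTime n) : ℝ := √(ev z (sqSum (grad3 h)))

/-- Size of the fourth derivatives. -/
def size4 (h : Sm n) (z : SpaceTime n) : ℝ := √(ev z (gradSqSum (grad3 h)))

theorem sqrt_gradSqSum_grad1 (h : Sm n) (z : SpaceTime n) :
    √(ev z (gradSqSum (grad1 h))) = size2 h z := by rw [size2, grad2, sqSum_grads]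

theorem sqrt_gradSqSum_grad2 (h : Sm n) (z : SpaceTime n) :
    √(ev z (gradSqSum (grad2 h))) = size3 h z := by rw [size3, grad3, sqSum_grads]

theorem size1_nonneg (h : Sm n) (z : SpaceTime n) : 0 ≤ size1 h z := Real.sqrt_nonneg _
theorem size2_nonneg (h : Sm n) (z : SpaceTime n) : 0 ≤ size2 h z := Real.sqrt_nonneg _
theorem size3_nonneg (h : Sm n) (z : SpaceTime n) : 0 ≤ size3 h z := Real.sqrt_nonneg _
theorem size4_nonneg (h : Sm n) (z : SpaceTime n) : 0 ≤ size4 h z := Real.sqrt_nonneg _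

theorem size1_sq (h : Sm n) (z : SpaceTime n) : size1 h z ^ 2 = ev z (sqSum (grad1 h)) :=
  Real.sq_sqrt (sqSum_nonneg _ _)
theorem size2_sq (h : Sm n) (z : SpaceTime n) : size2 h z ^ 2 = ev z (sqSum (grad2 h)) :=
  Real.sq_sqrt (sqSum_nonneg _ _)
theorem size3_sq (h : Sm n) (z : SpaceTime n) : size3 h z ^ 2 = ev z (sqSum (grad3 h)) :=
  Real.sq_sqrt (sqSum_nonneg _ _)

theorem abs_dx_le (h : Sm n) (z : SpaceTime n) (i : Fin n) : |ev z (dx i h)| ≤ size1 h z :=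
  abs_ev_le_sqSum (grad1 h) z i

theorem abs_ddx_le (h : Sm n) (z : SpaceTime n) (i j : Fin n) :
    |ev z (dx j (dx i h))| ≤ size2 h z :=
  abs_ev_le_sqSum (grad2 h) z (i, j)

theorem abs_dddx_le (h : Sm n) (z : SpaceTime n) (i j k : Fin n) :
    |ev z (dx k (dx j (dx i h)))| ≤ size3 h z :=
  abs_ev_le_sqSum (grad3 h) z ((i, j), k)

theorem abs_ddddx_le (h : Sm n) (z : SpaceTime n) (i j k l : Fin n) :
    |ev z (dx l (dx k (dx j (dx i h))))| ≤ size4 h z :=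
  abs_ev_dx_le_gradSqSum (grad3 h) z ((i, j), k) l

theorem abs_lapD_le (h : Sm n) (z : SpaceTime n) : |ev z (lapD dx h)| ≤ n * size2 h z := by
  rw [lapD, map_sum]
  simpa using abs_sum_le_card_mul fun i => abs_ddx_le h z i i

theorem abs_dx_lapD_le (h : Sm n) (z : SpaceTime n) (j : Fin n) :
    |ev z (dx j (lapD dx h))| ≤ n * size3 h z := by
  rw [lapD, map_sum, map_sum]
  simpa using abs_sum_le_card_mul fun i => abs_dddx_le h z i i j

theorem abs_ddx_lapD_le (h : Sm n) (z : SpaceTime n) (j k : Fin n) :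
    |ev z (dx k (dx j (lapD dx h)))| ≤ n * size4 h z := by
  rw [lapD, map_sum, map_sum, map_sum]
  simpa using abs_sum_le_card_mul fun i => abs_ddddx_le h z i i j k

theorem abs_mul_le_mul {x y a b : ℝ} (hx : |x| ≤ a) (hy : |y| ≤ b) : |x * y| ≤ a * b := by
  rw [abs_mul]
  exact mul_le_mul hx hy (abs_nonneg _) ((abs_nonneg _).trans hx)

section Remainder

variable {q B : ℝ} {h : Sm n} {z : SpaceTime n}

theorem abs_gradP_le (hB : 0 < B) (i : Fin n) :
    |2 * z.1.2 i + ev z (dx i h)| ≤ 2 * (√(ev z (statP n B)) + size1 h z) := by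
  have h1 := abs_coord_le hB z i
  have h2 := abs_dx_le h z i
  have h3 := size1_nonneg h z
  rw [abs_le] at *
  constructor <;> linarith

theorem abs_hessP_le (i j : Fin n) (h : Sm n) (z : SpaceTime n) :
    |ev z (2 * (if j = i then 1 else 0) + dx j (dx i h))| ≤ 2 * (1 + size2 h z) := by
  have h2 := abs_ddx_le h z i j
  have h3 := size2_nonneg h z
  split_ifs <;> simp <;> rw [abs_le] at * <;> constructor <;> linarith

theorem abs_linOp_grad1_le (hq : 0 ≤ q) (hB : 0 < B) (hh : IsFlow q B h) (i : Fin n) :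
    |ev z (linOp q B h (grad1 h i))| ≤ (2 * n + 2 * q) *
      ((√(ev z (statP n B)) + size1 h z) * size2 h z + 1 * size1 h z) := by
  have h1 := abs_mul_le_mul (abs_gradP_le (h := h) (z := z) hB i) (abs_lapD_le h z)
  have h2 := abs_dx_le h z i
  have h3 : ev z (linOp q B h (grad1 h i)) =
      (2 * z.1.2 i + ev z (dx i h)) * ev z (lapD dx h) - 2 * q * ev z (dx i h) := by
    rw [grad1, linOp, hh.pressureFlow.parOp_dh]; simp
  rw [h3]
  refine (abs_sub _ _).trans ?_
  rw [abs_mul (2 * q), abs_of_nonneg (by positivity : 0 ≤ 2 * q)]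
  have e1 := size1_nonneg h z
  have e2 := size2_nonneg h z
  have e3 := Real.sqrt_nonneg (ev z (statP n B))
  set r := √(ev z (statP n B))
  calc _ ≤ 2 * (r + size1 h z) * (n * size2 h z) + 2 * q * size1 h z := by gcongr
    _ ≤ 2 * (r + size1 h z) * (n * size2 h z) + 2 * q * size1 h z +
        (2 * q * ((r + size1 h z) * size2 h z) + 2 * n * size1 h z) :=
        le_add_of_nonneg_right (by positivity)
    _ = _ := by ring

theorem abs_linOp_grad2_le (hq : 0 ≤ q) (hB : 0 < B) (hh : IsFlow q B h) (α : Fin n × Fin n) :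
    |ev z (linOp q B h (grad2 h α))| ≤ (6 * n + 4 * q + 2 * q * n) *
      ((√(ev z (statP n B)) + size1 h z) * size3 h z + (1 + size2 h z) * size2 h z) := by
  obtain ⟨i, j⟩ := α
  have x1 := abs_mul_le_mul (abs_gradP_le (h := h) (z := z) hB i) (abs_dx_lapD_le h z j)
  have x2 := abs_mul_le_mul (abs_gradP_le (h := h) (z := z) hB j) (abs_dx_lapD_le h z i)
  have x3 := abs_mul_le_mul (abs_hessP_le i j h z) (abs_lapD_le h z)
  have x4 := abs_mul_le_mul (le_of_eq (abs_of_nonneg (by positivity : 0 ≤ 4 * q)))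
    (abs_ddx_le h z i j)
  have x5 := abs_mul_le_mul (le_of_eq (abs_of_nonneg (by positivity : 0 ≤ 2 * q)))
    (abs_sum_le_card_mul fun k => abs_mul_le_mul (abs_ddx_le h z k j) (abs_ddx_le h z i k))
  rw [Fintype.card_fin] at x5
  have h3 : ev z (linOp q B h (grad2 h (i, j))) =
      (2 * z.1.2 i + ev z (dx i h)) * ev z (dx j (lapD dx h))
      + (2 * z.1.2 j + ev z (dx j h)) * ev z (dx i (lapD dx h))
      + ev z (2 * (if j = i then 1 else 0) + dx j (dx i h)) * ev z (lapD dx h)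
      - 4 * q * ev z (dx j (dx i h))
      - 2 * q * ∑ k, ev z (dx j (dx k h)) * ev z (dx k (dx i h)) := by
    rw [grad2, grads, grad1, linOp, hh.pressureFlow.parOp_ddh]; simp
  rw [h3]
  have e1 := size1_nonneg h z
  have e2 := size2_nonneg h z
  have e3 := size3_nonneg h z
  have e4 := Real.sqrt_nonneg (ev z (statP n B))
  set r := √(ev z (statP n B))
  set a₁ := size1 h z
  set a₂ := size2 h z
  set a₃ := size3 h z
  calc _ ≤ 2 * (r + a₁) * (n * a₃) + 2 * (r + a₁) * (n * a₃) + 2 * (1 + a₂) * (n * a₂)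
        + 4 * q * a₂ + 2 * q * (n * (a₂ * a₂)) := by
        rw [abs_le] at *; constructor <;> linarith
    _ ≤ 2 * (r + a₁) * (n * a₃) + 2 * (r + a₁) * (n * a₃) + 2 * (1 + a₂) * (n * a₂)
        + 4 * q * a₂ + 2 * q * (n * (a₂ * a₂)) +
        ((2 * n + 4 * q + 2 * q * n) * ((r + a₁) * a₃) + 4 * n * ((1 + a₂) * a₂) +
        4 * q * (a₂ * a₂) + 2 * q * n * a₂) := le_add_of_nonneg_right (by positivity)
    _ = _ := by ring

theorem abs_linOp_grad3_le (hq : 0 ≤ q) (hB : 0 < B) (hh : IsFlow q B h)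
    (α : (Fin n × Fin n) × Fin n) :
    |ev z (linOp q B h (grad3 h α))| ≤ (13 * n + 6 * q + 6 * q * n) *
      ((√(ev z (statP n B)) + size1 h z) * √(ev z (gradSqSum (grad3 h))) +
        (1 + size2 h z) * size3 h z) := by
  change _ ≤ _ * ((_ + _) * size4 h z + _)
  obtain ⟨⟨i, j⟩, k⟩ := α
  have x1 := abs_mul_le_mul (abs_gradP_le (h := h) (z := z) hB i) (abs_ddx_lapD_le h z j k)
  have x2 := abs_mul_le_mul (abs_gradP_le (h := h) (z := z) hB j) (abs_ddx_lapD_le h z i k)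
  have x3 := abs_mul_le_mul (abs_gradP_le (h := h) (z := z) hB k) (abs_ddx_lapD_le h z i j)
  have y1 := abs_mul_le_mul (abs_hessP_le i k h z) (abs_dx_lapD_le h z j)
  have y2 := abs_mul_le_mul (abs_hessP_le j k h z) (abs_dx_lapD_le h z i)
  have y3 := abs_mul_le_mul (abs_hessP_le i j h z) (abs_dx_lapD_le h z k)
  have u1 := abs_mul_le_mul (abs_dddx_le h z i j k) (abs_lapD_le h z)
  have u2 := abs_mul_le_mul (le_of_eq (abs_of_nonneg (by positivity : 0 ≤ 6 * q)))
    (abs_dddx_le h z i j k)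
  have v1 := abs_sum_le_card_mul fun l =>
    abs_mul_le_mul (abs_ddx_le h z l j) (abs_dddx_le h z i l k)
  have v2 := abs_sum_le_card_mul fun l =>
    abs_mul_le_mul (abs_ddx_le h z i l) (abs_dddx_le h z l j k)
  have v3 := abs_sum_le_card_mul fun l =>
    abs_mul_le_mul (abs_ddx_le h z l k) (abs_dddx_le h z i j l)
  rw [Fintype.card_fin] at v1 v2 v3
  have v := abs_mul_le_mul (le_of_eq (abs_of_nonneg (by positivity : 0 ≤ 2 * q)))
    (((abs_add_le _ _).trans (add_le_add_left (abs_add_le _ _) _)).trans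
      (add_le_add (add_le_add v1 v2) v3))
  have h3 : ev z (linOp q B h (grad3 h ((i, j), k))) =
      (2 * z.1.2 i + ev z (dx i h)) * ev z (dx k (dx j (lapD dx h)))
      + (2 * z.1.2 j + ev z (dx j h)) * ev z (dx k (dx i (lapD dx h)))
      + (2 * z.1.2 k + ev z (dx k h)) * ev z (dx j (dx i (lapD dx h)))
      + ev z (2 * (if k = i then 1 else 0) + dx k (dx i h)) * ev z (dx j (lapD dx h))
      + ev z (2 * (if k = j then 1 else 0) + dx k (dx j h)) * ev z (dx i (lapD dx h))
      + ev z (2 * (if j = i then 1 else 0) + dx j (dx i h)) * ev z (dx k (lapD dx h))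
      + ev z (dx k (dx j (dx i h))) * ev z (lapD dx h)
      - 6 * q * ev z (dx k (dx j (dx i h)))
      - 2 * q * (∑ l, ev z (dx j (dx l h)) * ev z (dx k (dx l (dx i h)))
        + ∑ l, ev z (dx l (dx i h)) * ev z (dx k (dx j (dx l h)))
        + ∑ l, ev z (dx k (dx l h)) * ev z (dx l (dx j (dx i h)))) := by
    rw [grad3, grads, grad2, grads, grad1, linOp, hh.pressureFlow.parOp_dddh]; simp
  rw [h3]
  have e1 := size1_nonneg h z
  have e2 := size2_nonneg h z
  have e3 := size3_nonneg h z
  have e4 := size4_nonneg h z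
  have e5 := Real.sqrt_nonneg (ev z (statP n B))
  clear v1 v2 v3
  set r := √(ev z (statP n B))
  set a₁ := size1 h z
  set a₂ := size2 h z
  set a₃ := size3 h z
  set a₄ := size4 h z
  calc _ ≤ 3 * (2 * (r + a₁) * (n * a₄)) + 3 * (2 * (1 + a₂) * (n * a₃)) + a₃ * (n * a₂)
        + 6 * q * a₃ + 2 * q * (n * (a₂ * a₃) + n * (a₂ * a₃) + n * (a₂ * a₃)) := by
        rw [abs_le] at *; constructor <;> linarith
    _ ≤ 3 * (2 * (r + a₁) * (n * a₄)) + 3 * (2 * (1 + a₂) * (n * a₃)) + a₃ * (n * a₂)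
        + 6 * q * a₃ + 2 * q * (n * (a₂ * a₃) + n * (a₂ * a₃) + n * (a₂ * a₃)) +
        ((7 * n + 6 * q + 6 * q * n) * ((r + a₁) * a₄) + (7 * n + 6 * q * n) * a₃ +
        (6 * n + 6 * q) * (a₂ * a₃)) := le_add_of_nonneg_right (by positivity)
    _ = _ := by ring

end Remainder

end Sm

namespace Sm

variable {n : ℕ}

theorem statP_pow_mul_sqSum_nonneg {B : ℝ} (hB : 0 < B) (j : ℕ) {ι : Type*} [Fintype ι]
    (f : ι → Sm n) (z : SpaceTime n) : 0 ≤ ev z (statP n B ^ j * sqSum f) := by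
  rw [map_mul, map_pow]
  exact mul_nonneg (pow_nonneg (statP_pos hB z).le _) (sqSum_nonneg f z)

theorem statP_pow_mul_gradSqSum_nonneg {B : ℝ} (hB : 0 < B) (j : ℕ) {ι : Type*} [Fintype ι]
    (f : ι → Sm n) (z : SpaceTime n) : 0 ≤ ev z (statP n B ^ j * gradSqSum f) := by
  rw [map_mul, map_pow]
  exact mul_nonneg (pow_nonneg (statP_pos hB z).le _) (gradSqSum_nonneg f z)

theorem linOp_sq_le {q B δ : ℝ} (hq : 0 ≤ q) (hB : 0 < B) {h : Sm n} (hh : IsFlow q B h)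
    {z : SpaceTime n} (hδ : δ ≤ 1 / 8) (hδq : q * δ ≤ 1 / 4)
    (hz : |ev z h| ≤ δ * ev z (statP n B)) :
    ev z (linOp q B h (h ^ 2)) ≤ -ev z (statP n B ^ 1 * sqSum (grad1 h)) := by
  have hw := statP_pos hB z
  have h1 : ev z (linOp q B h (h ^ 2)) = 2 * ev z h * (q * ev z (sqSum (grad1 h))) -
      2 * (ev z (statP n B) + ev z h) * ev z (sqSum (grad1 h)) := by
    rw [linOp_sq]
    have : linOp q B h h = algebraMap ℝ _ q * ∑ k, dx k h ^ 2 := hh.pressureFlow.parOp_h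
    rw [this]
    simp [sqSum, grad1]
  rw [h1, pow_one, map_mul]
  have hD := sqSum_nonneg (grad1 h) z
  set w := ev z (statP n B)
  set D := ev z (sqSum (grad1 h))
  have h2 := abs_le.1 hz
  have h3 : ev z h * q ≤ w / 4 := by
    calc ev z h * q ≤ δ * w * q := by gcongr; exact h2.2
      _ = q * δ * w := by ring
      _ ≤ 1 / 4 * w := by gcongr
      _ = _ := by ring
  have h4 : δ * w ≤ 1 / 8 * w := by gcongr
  have h5 : 2 * (ev z h * q) - 2 * (w + ev z h) ≤ -w := by linarith [h2.1]
  nlinarith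

theorem mul_sqrt_le_of_sq_le {c a w D C : ℝ} (hw : 0 < w) (hC : 1 ≤ C) (hD : a ^ 2 = D)
    (h : c ^ 2 * (w * D) ≤ C * w ^ 2) : c * a ≤ C * √w := by
  refine abs_le_of_sq_le_sq' ?_ (by positivity) |>.2
  rw [mul_pow, mul_pow, Real.sq_sqrt hw.le, hD]
  have : w * (c ^ 2 * D) ≤ w * (C * w) := by linarith
  refine (le_of_mul_le_mul_left this hw).trans ?_
  gcongr
  exact le_self_pow₀ hC two_ne_zero

/-- First interior estimate: gradients. -/
theorem exists_grad1_bound {q B : ℝ} (hq : 0 ≤ q) (hB : 0 < B) (n : ℕ) :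
    ∃ C δ₁ : ℝ, 0 < C ∧ 0 < δ₁ ∧ ∀ h : Sm n, IsFlow q B h → ∀ t₀ : ℝ, 0 < t₀ →
      ∀ δ : ℝ, 0 < δ → δ ≤ δ₁ →
      (∀ z : SpaceTime n, t₀ ≤ z.1.1 → z.1.1 ≤ t₀ + 1 → |ev z h| ≤ δ * ev z (statP n B)) →
      ∀ z : SpaceTime n, z.1.1 = t₀ + 1 →
        ev z (statP n B ^ 1 * sqSum (grad1 h)) ≤ C * δ ^ 2 * ev z (statP n B) ^ 2 := by
  obtain ⟨C₁, hC₁, hfam⟩ := exists_linOp_family_le hq hB n 1 (ι := Fin n)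
    (C₀ := 2 * n + 2 * q) (C₁ := 1) (by positivity) zero_le_one
  set C₀ : ℝ := 1 + C₁ + (8 * (1 : ℕ) ^ 2 + 8 * (Fintype.card (Fin n) : ℝ) ^ 2) with hC₀
  have hC₀1 : 1 ≤ C₀ := by
    have : 0 ≤ C₁ + (8 * (1 : ℕ) ^ 2 + 8 * (Fintype.card (Fin n) : ℝ) ^ 2) := by positivity
    linarith
  obtain ⟨C, δ₁, hC, hδ₁, H⟩ := exists_step_bound hq hB n hC₀1
  refine ⟨C, min δ₁ (min (1 / 8) (1 / (4 * (q + 1)))), hC, by positivity, ?_⟩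
  intro h hh t₀ ht₀ δ hδ hδ1 hb
  have hδ8 : δ ≤ 1 / 8 := hδ1.trans ((min_le_right _ _).trans (min_le_left _ _))
  have hδq : q * δ ≤ 1 / 4 := by
    have : δ ≤ 1 / (4 * (q + 1)) := hδ1.trans ((min_le_right _ _).trans (min_le_right _ _))
    rw [le_div_iff₀ (by positivity)] at this
    linarith
  refine H h hh t₀ ht₀ δ hδ (hδ1.trans (min_le_left _ _)) (h ^ 2)
    (statP n B ^ 1 * sqSum (grad1 h)) (statP n B ^ 2 * gradSqSum (grad1 h)) ?_
  intro z h0 h1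
  have hw := statP_pos hB z
  have hbz := hb z h0 h1
  have hbz8 : |ev z h| ≤ ev z (statP n B) / 8 := by
    refine hbz.trans ?_
    rw [div_eq_inv_mul]; gcongr; linarith
  have hV := statP_pow_mul_sqSum_nonneg hB 1 (grad1 h) z
  have hG := statP_pow_mul_gradSqSum_nonneg hB 2 (grad1 h) z
  have hVw : ev z (statP n B ^ 1 * sqSum (grad1 h)) =
    ev z (statP n B) * ev z (sqSum (grad1 h)) := by rw [pow_one, map_mul]
  refine ⟨hbz8, by rw [map_pow]; positivity, ?_, hV, hG, ?_, ?_, ?_, ?_⟩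
  · rw [map_pow]
    have h2 : ev z h ^ 2 ≤ (δ * ev z (statP n B)) ^ 2 := sq_le_sq.2 (by
      rwa [abs_of_pos (by positivity : 0 < δ * ev z (statP n B))])
    calc _ ≤ _ := h2
      _ = 1 * δ ^ 2 * ev z (statP n B) ^ 2 := by ring
      _ ≤ _ := by gcongr
  · have := linOp_sq_le hq hB hh hδ8 hδq hbz
    have h3 : 0 ≤ C₀ * δ ^ 2 * ev z (statP n B) ^ 2 := by positivity
    linarith
  · intro ζ hζ hζ1 hζV
    have := hfam h hh (grad1 h) z hbz8 ζ (size1 h z) 1 hζ hζ1 (size1_nonneg h z)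
      (abs_dx_le h z)
      (mul_sqrt_le_of_sq_le hw le_rfl (size1_sq h z) (by rw [← hVw, one_mul]; exact hζV))
      (by linarith) (fun i => by
        rw [sqrt_gradSqSum_grad1]; exact abs_linOp_grad1_le hq hB hh i)
    refine this.trans ?_
    gcongr
    have : 0 ≤ (8 * (1 : ℕ) ^ 2 + 8 * (Fintype.card (Fin n) : ℝ) ^ 2) := by positivity
    linarith
  · change ev z (statP n B) * ev z (sqSum (grad1 h)) ≤ _
    rw [← hVw]
    exact le_add_of_nonneg_right (by positivity)
  · intro k
    refine (statP_mul_dx_sq_le hB 1 (grad1 h) z k).trans ?_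
    gcongr
    linarith

/-- Second interior estimate: Hessians. -/
theorem exists_grad2_bound {q B K₁ : ℝ} (hq : 0 ≤ q) (hB : 0 < B) (n : ℕ) (hK₁ : 0 ≤ K₁) :
    ∃ C δ₁ : ℝ, 0 < C ∧ 0 < δ₁ ∧ ∀ h : Sm n, IsFlow q B h → ∀ t₀ : ℝ, 0 < t₀ →
      ∀ δ : ℝ, 0 < δ → δ ≤ δ₁ →
      (∀ z : SpaceTime n, t₀ ≤ z.1.1 → z.1.1 ≤ t₀ + 1 → |ev z h| ≤ δ * ev z (statP n B) ∧
        ev z (statP n B ^ 1 * sqSum (grad1 h)) ≤ K₁ * δ ^ 2 * ev z (statP n B) ^ 2) →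
      ∀ z : SpaceTime n, z.1.1 = t₀ + 1 →
        ev z (statP n B ^ 2 * sqSum (grad2 h)) ≤ C * δ ^ 2 * ev z (statP n B) ^ 2 := by
  obtain ⟨C₁, hC₁, hfam1⟩ := exists_linOp_family_le hq hB n 1 (ι := Fin n)
    (C₀ := 2 * n + 2 * q) (C₁ := 1 + K₁) (by positivity) (by positivity)
  obtain ⟨C₂, hC₂, hfam2⟩ := exists_linOp_family_le hq hB n 2 (ι := Fin n × Fin n)
    (C₀ := 6 * n + 4 * q + 2 * q * n) (C₁ := 2 + K₁) (by positivity) (by positivity)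
  set L : ℝ := 8 * (2 : ℕ) ^ 2 + 8 * (Fintype.card (Fin n × Fin n) : ℝ) ^ 2
  have hL : 0 ≤ L := by positivity
  set C₀ : ℝ := 1 + K₁ + C₁ * K₁ + C₂ + L with hC₀
  have hCK : 0 ≤ C₁ * K₁ := by positivity
  have hC₀1 : 1 ≤ C₀ := by linarith
  obtain ⟨C, δ₁, hC, hδ₁, H⟩ := exists_step_bound hq hB n hC₀1
  refine ⟨C, min δ₁ (1 / 8), hC, by positivity, ?_⟩
  intro h hh t₀ ht₀ δ hδ hδ1 hb
  have hδ8 : δ ≤ 1 / 8 := hδ1.trans (min_le_right _ _)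
  have hδ2 : δ ^ 2 ≤ 1 := by nlinarith
  refine H h hh t₀ ht₀ δ hδ (hδ1.trans (min_le_left _ _)) (statP n B ^ 1 * sqSum (grad1 h))
    (statP n B ^ 2 * sqSum (grad2 h)) (statP n B ^ 3 * gradSqSum (grad2 h)) ?_
  intro z h0 h1
  have hw := statP_pos hB z
  obtain ⟨hbz, hb1⟩ := hb z h0 h1
  have hbz8 : |ev z h| ≤ ev z (statP n B) / 8 := by
    refine hbz.trans ?_
    rw [div_eq_inv_mul]; gcongr; linarith
  have hU := statP_pow_mul_sqSum_nonneg hB 1 (grad1 h) z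
  have hV := statP_pow_mul_sqSum_nonneg hB 2 (grad2 h) z
  have hG := statP_pow_mul_gradSqSum_nonneg hB 3 (grad2 h) z
  have hUw : ev z (statP n B ^ 1 * sqSum (grad1 h)) =
    ev z (statP n B) * ev z (sqSum (grad1 h)) := by rw [pow_one, map_mul]
  have hb1' : ev z (statP n B ^ 1 * sqSum (grad1 h)) ≤ K₁ * ev z (statP n B) ^ 2 := by
    refine hb1.trans ?_
    rw [mul_right_comm]
    exact mul_le_of_le_one_right (by positivity) hδ2
  have ha : ∀ ζ : ℝ, 0 ≤ ζ → ζ ≤ 1 → ζ * size1 h z ≤ (1 + K₁) * √(ev z (statP n B)) := by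
    intro ζ hζ hζ1
    refine mul_sqrt_le_of_sq_le hw (by linarith) (size1_sq h z) ?_
    rw [← hUw]
    refine (mul_le_of_le_one_left hU (pow_le_one₀ hζ hζ1)).trans (hb1'.trans ?_)
    gcongr; linarith
  refine ⟨hbz8, hU, ?_, hV, hG, ?_, ?_, ?_, ?_⟩
  · refine hb1.trans ?_
    gcongr; linarith
  · have := hfam1 h hh (grad1 h) z hbz8 1 (size1 h z) 1 zero_le_one le_rfl (size1_nonneg h z)
      (abs_dx_le h z) (ha 1 zero_le_one le_rfl) (by linarith) (fun i => by
        rw [sqrt_gradSqSum_grad1]; exact abs_linOp_grad1_le hq hB hh i)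
    rw [← sqSum_grads, one_pow, one_mul, one_mul] at this
    refine this.trans ?_
    change -ev z (statP n B ^ 2 * sqSum (grad2 h)) + _ ≤ _
    have h3 : C₁ * ev z (statP n B ^ 1 * sqSum (grad1 h)) ≤
        C₁ * (K₁ * δ ^ 2 * ev z (statP n B) ^ 2) := by gcongr
    have h4 : C₁ * K₁ * (δ ^ 2 * ev z (statP n B) ^ 2) ≤ C₀ * (δ ^ 2 * ev z (statP n B) ^ 2) := by
      gcongr; linarith
    linarith
  · intro ζ hζ hζ1 hζV
    have hζ2 : ζ * size2 h z ≤ 1 := by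
      refine abs_le_of_sq_le_sq' ?_ zero_le_one |>.2
      rw [mul_pow, size2_sq, one_pow]
      rw [map_mul, map_pow] at hζV
      have h2 : 0 < ev z (statP n B) ^ 2 := by positivity
      refine le_of_mul_le_mul_left ?_ h2
      linarith
    have := hfam2 h hh (grad2 h) z hbz8 ζ (size1 h z) (1 + size2 h z) hζ hζ1 (size1_nonneg h z)
      (abs_dx_le h z)
      ((ha ζ hζ hζ1).trans (by gcongr; linarith))
      (by linarith) (fun i => by
        rw [sqrt_gradSqSum_grad2]; exact abs_linOp_grad2_le hq hB hh i)
    refine this.trans ?_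
    gcongr
    linarith
  · change ev z (statP n B) * ev z (sqSum (grad1 h)) ≤ _
    rw [← hUw]
    refine hb1'.trans ?_
    have : K₁ * ev z (statP n B) ^ 2 ≤ C₀ * ev z (statP n B) ^ 2 := by gcongr; linarith
    linarith
  · intro k
    refine (statP_mul_dx_sq_le hB 2 (grad2 h) z k).trans ?_
    gcongr
    change L ≤ C₀
    linarith

/-- Third interior estimate: third derivatives. -/
theorem exists_grad3_bound {q B K₁ K₂ : ℝ} (hq : 0 ≤ q) (hB : 0 < B) (n : ℕ) (hK₁ : 0 ≤ K₁)
    (hK₂ : 0 ≤ K₂) :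
    ∃ C δ₁ : ℝ, 0 < C ∧ 0 < δ₁ ∧ ∀ h : Sm n, IsFlow q B h → ∀ t₀ : ℝ, 0 < t₀ →
      ∀ δ : ℝ, 0 < δ → δ ≤ δ₁ →
      (∀ z : SpaceTime n, t₀ ≤ z.1.1 → z.1.1 ≤ t₀ + 1 → |ev z h| ≤ δ * ev z (statP n B) ∧
        ev z (statP n B ^ 1 * sqSum (grad1 h)) ≤ K₁ * δ ^ 2 * ev z (statP n B) ^ 2 ∧
        ev z (statP n B ^ 2 * sqSum (grad2 h)) ≤ K₂ * δ ^ 2 * ev z (statP n B) ^ 2) →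
      ∀ z : SpaceTime n, z.1.1 = t₀ + 1 →
        ev z (statP n B ^ 3 * sqSum (grad3 h)) ≤ C * δ ^ 2 * ev z (statP n B) ^ 2 := by
  obtain ⟨C₁, hC₁, hfam1⟩ := exists_linOp_family_le hq hB n 2 (ι := Fin n × Fin n)
    (C₀ := 6 * n + 4 * q + 2 * q * n) (C₁ := 2 + K₁ + K₂) (by positivity) (by positivity)
  obtain ⟨C₂, hC₂, hfam2⟩ := exists_linOp_family_le hq hB n 3 (ι := (Fin n × Fin n) × Fin n)
    (C₀ := 13 * n + 6 * q + 6 * q * n) (C₁ := 2 + K₁ + K₂) (by positivity) (by positivity)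
  set L : ℝ := 8 * (3 : ℕ) ^ 2 + 8 * (Fintype.card ((Fin n × Fin n) × Fin n) : ℝ) ^ 2
  have hL : 0 ≤ L := by positivity
  set C₀ : ℝ := 1 + K₁ + K₂ + C₁ * K₂ + C₂ + L with hC₀
  have hCK : 0 ≤ C₁ * K₂ := by positivity
  have hC₀1 : 1 ≤ C₀ := by linarith
  obtain ⟨C, δ₁, hC, hδ₁, H⟩ := exists_step_bound hq hB n hC₀1
  refine ⟨C, min δ₁ (1 / 8), hC, by positivity, ?_⟩
  intro h hh t₀ ht₀ δ hδ hδ1 hb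
  have hδ8 : δ ≤ 1 / 8 := hδ1.trans (min_le_right _ _)
  have hδ2 : δ ^ 2 ≤ 1 := by nlinarith
  refine H h hh t₀ ht₀ δ hδ (hδ1.trans (min_le_left _ _)) (statP n B ^ 2 * sqSum (grad2 h))
    (statP n B ^ 3 * sqSum (grad3 h)) (statP n B ^ 4 * gradSqSum (grad3 h)) ?_
  intro z h0 h1
  have hw := statP_pos hB z
  obtain ⟨hbz, hb1, hb2⟩ := hb z h0 h1
  have hbz8 : |ev z h| ≤ ev z (statP n B) / 8 := by
    refine hbz.trans ?_
    rw [div_eq_inv_mul]; gcongr; linarith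
  have hS := statP_pow_mul_sqSum_nonneg hB 1 (grad1 h) z
  have hU := statP_pow_mul_sqSum_nonneg hB 2 (grad2 h) z
  have hV := statP_pow_mul_sqSum_nonneg hB 3 (grad3 h) z
  have hG := statP_pow_mul_gradSqSum_nonneg hB 4 (grad3 h) z
  have hSw : ev z (statP n B ^ 1 * sqSum (grad1 h)) =
    ev z (statP n B) * ev z (sqSum (grad1 h)) := by rw [pow_one, map_mul]
  have hb1' : ev z (statP n B ^ 1 * sqSum (grad1 h)) ≤ K₁ * ev z (statP n B) ^ 2 := by
    refine hb1.trans ?_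
    rw [mul_right_comm]
    exact mul_le_of_le_one_right (by positivity) hδ2
  have ha : ∀ ζ : ℝ, 0 ≤ ζ → ζ ≤ 1 → ζ * size1 h z ≤ (2 + K₁ + K₂) * √(ev z (statP n B)) := by
    intro ζ hζ hζ1
    refine mul_sqrt_le_of_sq_le hw (by linarith) (size1_sq h z) ?_
    rw [← hSw]
    refine (mul_le_of_le_one_left hS (pow_le_one₀ hζ hζ1)).trans (hb1'.trans ?_)
    gcongr; linarith
  have ha2 : size2 h z ≤ 1 + K₂ := by
    refine abs_le_of_sq_le_sq' ?_ (by positivity) |>.2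
    rw [size2_sq]
    rw [map_mul, map_pow] at hb2
    have h2 : 0 < ev z (statP n B) ^ 2 := by positivity
    refine le_of_mul_le_mul_left ?_ h2
    calc _ ≤ _ := hb2
      _ = ev z (statP n B) ^ 2 * (K₂ * δ ^ 2) := by ring
      _ ≤ ev z (statP n B) ^ 2 * (1 + K₂) ^ 2 := by
        gcongr
        nlinarith
  have hμ : ∀ ζ : ℝ, 0 ≤ ζ → ζ ≤ 1 → ζ * (1 + size2 h z) ≤ 2 + K₁ + K₂ := by
    intro ζ hζ hζ1
    have : ζ * (1 + size2 h z) ≤ 1 + size2 h z :=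
      mul_le_of_le_one_left (by linarith [size2_nonneg h z]) hζ1
    linarith
  refine ⟨hbz8, hU, ?_, hV, hG, ?_, ?_, ?_, ?_⟩
  · refine hb2.trans ?_
    gcongr; linarith
  · have := hfam1 h hh (grad2 h) z hbz8 1 (size1 h z) (1 + size2 h z) zero_le_one le_rfl
      (size1_nonneg h z) (abs_dx_le h z) (ha 1 zero_le_one le_rfl) (hμ 1 zero_le_one le_rfl)
      (fun i => by rw [sqrt_gradSqSum_grad2]; exact abs_linOp_grad2_le hq hB hh i)
    rw [← sqSum_grads, one_pow, one_mul, one_mul] at this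
    refine this.trans ?_
    change -ev z (statP n B ^ 3 * sqSum (grad3 h)) + _ ≤ _
    have h3 : C₁ * ev z (statP n B ^ 2 * sqSum (grad2 h)) ≤
        C₁ * (K₂ * δ ^ 2 * ev z (statP n B) ^ 2) := by gcongr
    have h4 : C₁ * K₂ * (δ ^ 2 * ev z (statP n B) ^ 2) ≤ C₀ * (δ ^ 2 * ev z (statP n B) ^ 2) := by
      gcongr; linarith
    linarith
  · intro ζ hζ hζ1 _
    have := hfam2 h hh (grad3 h) z hbz8 ζ (size1 h z) (1 + size2 h z) hζ hζ1 (size1_nonneg h z)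
      (abs_dx_le h z) (ha ζ hζ hζ1) (hμ ζ hζ hζ1)
      (fun i => abs_linOp_grad3_le hq hB hh i)
    refine this.trans ?_
    gcongr
    linarith
  · change ev z (statP n B) * ev z (sqSum (grad1 h)) ≤ _
    rw [← hSw]
    refine hb1'.trans ?_
    have : K₁ * ev z (statP n B) ^ 2 ≤ C₀ * ev z (statP n B) ^ 2 := by gcongr; linarith
    linarith
  · intro k
    refine (statP_mul_dx_sq_le hB 3 (grad3 h) z k).trans ?_
    gcongr
    change L ≤ C₀
    linarith

/-- Smallness of the deviation on a time interval implies smallness of its derivatives at the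
end of this interval. -/
theorem exists_regularity {q B : ℝ} (hq : 0 ≤ q) (hB : 0 < B) (n : ℕ) :
    ∃ C δ₁ : ℝ, 1 ≤ C ∧ 0 < δ₁ ∧ ∀ h : Sm n, IsFlow q B h → ∀ t₀ : ℝ, 0 < t₀ →
      ∀ δ : ℝ, 0 < δ → δ ≤ δ₁ →
      (∀ z : SpaceTime n, t₀ ≤ z.1.1 → z.1.1 ≤ t₀ + 3 → |ev z h| ≤ δ * ev z (statP n B)) →
      ∀ z : SpaceTime n, z.1.1 = t₀ + 3 →
        size1 h z ≤ C * δ * √(ev z (statP n B)) ∧ size2 h z ≤ C * δ ∧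
        √(ev z (statP n B)) * size3 h z ≤ C * δ := by
  obtain ⟨K₁, δ₁, hK₁, hδ₁, H₁⟩ := exists_grad1_bound hq hB n
  obtain ⟨K₂, δ₂, hK₂, hδ₂, H₂⟩ := exists_grad2_bound hq hB n hK₁.le
  obtain ⟨K₃, δ₃, hK₃, hδ₃, H₃⟩ := exists_grad3_bound hq hB n hK₁.le hK₂.le
  set C : ℝ := 1 + K₁ + K₂ + K₃ with hC
  refine ⟨C, min δ₁ (min δ₂ δ₃), by linarith, by positivity, ?_⟩
  intro h hh t₀ ht₀ δ hδ hδ1 hb z hz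
  have R₁ : ∀ z : SpaceTime n, t₀ + 1 ≤ z.1.1 → z.1.1 ≤ t₀ + 3 →
      ev z (statP n B ^ 1 * sqSum (grad1 h)) ≤ K₁ * δ ^ 2 * ev z (statP n B) ^ 2 :=
    fun z h0 h1 => H₁ h hh (z.1.1 - 1) (by linarith) δ hδ (hδ1.trans (min_le_left _ _))
      (fun z' h0' h1' => hb z' (by linarith) (by linarith)) z (by ring)
  have R₂ : ∀ z : SpaceTime n, t₀ + 2 ≤ z.1.1 → z.1.1 ≤ t₀ + 3 →
      ev z (statP n B ^ 2 * sqSum (grad2 h)) ≤ K₂ * δ ^ 2 * ev z (statP n B) ^ 2 :=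
    fun z h0 h1 => H₂ h hh (z.1.1 - 1) (by linarith) δ hδ
      (hδ1.trans ((min_le_right _ _).trans (min_le_left _ _)))
      (fun z' h0' h1' => ⟨hb z' (by linarith) (by linarith),
        R₁ z' (by linarith) (by linarith)⟩) z (by ring)
  have R₃ : ev z (statP n B ^ 3 * sqSum (grad3 h)) ≤ K₃ * δ ^ 2 * ev z (statP n B) ^ 2 :=
    H₃ h hh (z.1.1 - 1) (by linarith) δ hδ
      (hδ1.trans ((min_le_right _ _).trans (min_le_right _ _)))
      (fun z' h0' h1' => ⟨hb z' (by linarith) (by linarith),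
        R₁ z' (by linarith) (by linarith), R₂ z' (by linarith) (by linarith)⟩) z (by ring)
  have hw := statP_pos hB z
  have r₁ := R₁ z (by linarith) hz.le
  have r₂ := R₂ z (by linarith) hz.le
  simp only [map_mul, map_pow, ← size1_sq, ← size2_sq, ← size3_sq] at r₁ r₂ R₃
  set w := ev z (statP n B)
  have hrw : √w ^ 2 = w := Real.sq_sqrt hw.le
  have hC1 : 1 ≤ C := by linarith
  have hC2 : C ≤ C ^ 2 := le_self_pow₀ hC1 two_ne_zero
  have hw2 : 0 < w ^ 2 := by positivity
  refine ⟨abs_le_of_sq_le_sq' ?_ (by positivity) |>.2,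
    abs_le_of_sq_le_sq' ?_ (by positivity) |>.2, abs_le_of_sq_le_sq' ?_ (by positivity) |>.2⟩
  · refine le_of_mul_le_mul_left ?_ hw
    rw [mul_pow, mul_pow, hrw]
    calc w * size1 h z ^ 2 = w ^ 1 * size1 h z ^ 2 := by rw [pow_one]
      _ ≤ _ := r₁
      _ ≤ C ^ 2 * δ ^ 2 * w ^ 2 := by gcongr; linarith
      _ = _ := by ring
  · refine le_of_mul_le_mul_left ?_ hw2
    calc _ ≤ _ := r₂
      _ ≤ C ^ 2 * δ ^ 2 * w ^ 2 := by gcongr; linarith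
      _ = _ := by ring
  · refine le_of_mul_le_mul_left ?_ hw2
    rw [mul_pow, hrw]
    calc w ^ 2 * (w * size3 h z ^ 2) = w ^ 3 * size3 h z ^ 2 := by ring
      _ ≤ _ := R₃
      _ ≤ C ^ 2 * δ ^ 2 * w ^ 2 := by gcongr; linarith
      _ = _ := by ring

end Sm

namespace Sm

variable {n : ℕ}

/-- The deviation and its first three derivatives are small at a point. -/
structure SmallAt (B : ℝ) (h : Sm n) (z : SpaceTime n) (ε : ℝ) : Prop where
  zero : |ev z h| ≤ ε * ev z (statP n B)
  one : size1 h z ≤ ε * √(ev z (statP n B))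
  two : size2 h z ≤ ε
  three : √(ev z (statP n B)) * size3 h z ≤ ε

/-- The parabolic operator adapted to the Laplacian of the deviation. -/
def linOp' (q B : ℝ) (h : Sm n) (f : Sm n) : Sm n :=
  parOp dx dt (statP n B + h) (drift' dx X (algebraMap ℝ (Sm n) q) h) f

/-- The gradient of the Laplacian. -/
def gradLap (h : Sm n) (i : Fin n) : Sm n := dx i (lapD dx h)

theorem abs_sum_fin_le {f : Fin n → ℝ} {c : ℝ} (h : ∀ i, |f i| ≤ c) : |∑ i, f i| ≤ n * c := by
  simpa using abs_sum_le_card_mul h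

section

variable {q B : ℝ} {h : Sm n} {z : SpaceTime n}

theorem sum_ddx_sq (h : Sm n) (z : SpaceTime n) :
    ∑ i, ∑ k, ev z (dx i (dx k h)) ^ 2 = size2 h z ^ 2 := by
  rw [size2_sq, ev_sqSum, Fintype.sum_prod_type]
  exact Finset.sum_congr rfl fun i _ => Finset.sum_congr rfl fun k _ => by
    rw [dx_comm]; rfl

theorem ev_linOp'_lap_sq (hh : IsFlow q B h) (z : SpaceTime n) :
    ev z (linOp' q B h (lapD dx h ^ 2)) =
      2 * ev z (lapD dx h) * ((2 * n - 4 * q) * ev z (lapD dx h) + ev z (lapD dx h) ^ 2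
        - 2 * q * size2 h z ^ 2)
      - 2 * (ev z (statP n B) + ev z h) * ev z (sqSum (gradLap h)) := by
  rw [linOp', parOp_sq, hh.pressureFlow.parOp_lap, ← sum_ddx_sq]
  simp [ev_sqSum, gradLap]

theorem abs_linOp'_gradLap_le (hq : 0 ≤ q) (hB : 0 < B) (hh : IsFlow q B h) {ε : ℝ}
    (hε : ε ≤ 1) (hs : SmallAt B h z ε) (i : Fin n) :
    |ev z (linOp' q B h (gradLap h i))| ≤ (8 * n + 6 * q + 4 + 4 * q * n ^ 2 + (2 * q + 2) * n) *
      (√(ev z (statP n B)) * √(ev z (gradSqSum (gradLap h))) + √(ev z (sqSum (gradLap h)))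
        + size2 h z * size3 h z) := by
  have hr : 0 < √(ev z (statP n B)) := Real.sqrt_pos.2 (statP_pos hB z)
  have h1 : ev z (linOp' q B h (gradLap h i)) =
      (2 * z.1.2 i + ev z (dx i h)) * ev z (lapD dx (lapD dx h))
      + (2 * n - 6 * q + 4) * ev z (gradLap h i)
      + 2 * (ev z (lapD dx h) * ev z (gradLap h i))
      - 4 * q * ∑ j, ∑ k, ev z (dx j (dx k h)) * ev z (dx i (dx j (dx k h)))
      - (2 * q - 2) * ∑ k, ev z (dx i (dx k h)) * ev z (gradLap h k) := by
    rw [linOp', gradLap, hh.pressureFlow.parOp_dlap]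
    simp [gradLap, mul_assoc]
  set r := √(ev z (statP n B))
  set M := √(ev z (gradSqSum (gradLap h)))
  set g := √(ev z (sqSum (gradLap h)))
  have hM0 : 0 ≤ M := Real.sqrt_nonneg _
  have hg0 : 0 ≤ g := Real.sqrt_nonneg _
  have h20 := size2_nonneg h z
  have h30 := size3_nonneg h z
  have hg : ∀ k, |ev z (gradLap h k)| ≤ g := abs_ev_le_sqSum (gradLap h) z
  have hx : |2 * z.1.2 i + ev z (dx i h)| ≤ 4 * r := by
    refine (abs_gradP_le hB i).trans ?_
    have := hs.one.trans (mul_le_of_le_one_left hr.le hε)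
    linarith
  have hL : |ev z (lapD dx (lapD dx h))| ≤ n * M := by
    rw [lapD, map_sum]
    exact abs_sum_fin_le fun k => abs_ev_dx_le_gradSqSum (gradLap h) z k k
  have hs1 : |ev z (lapD dx h)| ≤ n * 1 :=
    (abs_lapD_le h z).trans (by have := hs.two.trans hε; gcongr)
  have a1 := abs_mul_le_mul hx hL
  have a2 := abs_mul_le_mul hs1 (hg i)
  have a3 : |∑ j, ∑ k, ev z (dx j (dx k h)) * ev z (dx i (dx j (dx k h)))| ≤
      n * (n * (size2 h z * size3 h z)) := by
    exact abs_sum_fin_le fun j => abs_sum_fin_le fun k =>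
      abs_mul_le_mul (abs_ddx_le h z k j) (abs_dddx_le h z k j i)
  have a4 : |∑ k, ev z (dx i (dx k h)) * ev z (gradLap h k)| ≤ n * (1 * g) := by
    exact abs_sum_fin_le fun k =>
      abs_mul_le_mul ((abs_ddx_le h z k i).trans (hs.two.trans hε)) (hg k)
  have b1 : |(2 * n - 6 * q + 4) * ev z (gradLap h i)| ≤ (2 * n + 6 * q + 4) * g := by
    refine abs_mul_le_mul ?_ (hg i)
    have : (0 : ℝ) ≤ n := n.cast_nonneg
    rw [abs_le]; constructor <;> linarith
  have b4 : |(2 * q - 2) * ∑ k, ev z (dx i (dx k h)) * ev z (gradLap h k)| ≤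
      (2 * q + 2) * (n * (1 * g)) := by
    refine abs_mul_le_mul ?_ a4
    rw [abs_le]; constructor <;> linarith
  have b3 : |4 * q * ∑ j, ∑ k, ev z (dx j (dx k h)) * ev z (dx i (dx j (dx k h)))| ≤
      4 * q * (n * (n * (size2 h z * size3 h z))) :=
    abs_mul_le_mul (by rw [abs_of_nonneg (by positivity)]) a3
  rw [h1]
  have key : (8 * n + 6 * q + 4 + 4 * q * n ^ 2 + (2 * q + 2) * n) *
      (r * M + g + size2 h z * size3 h z) = 4 * r * (n * M) + (2 * n + 6 * q + 4) * g
      + 2 * (n * 1 * g) + 4 * q * (n * (n * (size2 h z * size3 h z))) + (2 * q + 2) * (n * (1 * g))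
      + ((4 * n + 6 * q + 4 + 4 * q * n ^ 2 + (2 * q + 2) * n) * (r * M)
        + (4 * n + 4 * q * n ^ 2) * g
        + (8 * n + 6 * q + 4 + (2 * q + 2) * n) * (size2 h z * size3 h z)) := by ring
  rw [key]
  have hrest : 0 ≤ (4 * n + 6 * q + 4 + 4 * q * n ^ 2 + (2 * q + 2) * n) * (r * M)
        + (4 * n + 4 * q * n ^ 2) * g
        + (8 * n + 6 * q + 4 + (2 * q + 2) * n) * (size2 h z * size3 h z) := by positivity
  rw [abs_le] at *
  constructor <;> linarith

theorem ev_linOp'_sqSum {ι : Type*} [Fintype ι] (f : ι → Sm n) (q B : ℝ) (h : Sm n)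
    (z : SpaceTime n) : ev z (linOp' q B h (sqSum f)) =
    2 * ∑ α, ev z (f α) * ev z (linOp' q B h (f α))
      - 2 * (ev z (statP n B) + ev z h) * ev z (gradSqSum f) := by
  rw [linOp', sqSum, parOp_sum_sq]
  simp [gradSqSum, linOp']

theorem abs_linOp'_statP_le (hq : 0 ≤ q) (hB : 0 < B) (hh : IsFlow q B h) {ε : ℝ}
    (hε : ε ≤ 1 / 8) (hs : SmallAt B h z ε) :
    |ev z (linOp' q B h (statP n B))| ≤
      (8 * n * (q + 1) + 12 * n) * ev z (statP n B) := by
  have hw := statP_pos hB z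
  have hr : 0 < √(ev z (statP n B)) := Real.sqrt_pos.2 hw
  have hrw : √(ev z (statP n B)) * √(ev z (statP n B)) = ev z (statP n B) :=
    Real.mul_self_sqrt hw.le
  have hh8 : |ev z h| ≤ ev z (statP n B) / 8 :=
    hs.zero.trans (by nlinarith)
  have ha : ∀ k, |ev z (dx k h)| ≤ √(ev z (statP n B)) := fun k =>
    (abs_dx_le h z k).trans (hs.one.trans (by nlinarith))
  have h1 := abs_linOp_statP_le hq hB hh hh8 ha hr.le
  have h2 : ev z (linOp' q B h (statP n B)) = ev z (linOp q B h (statP n B)) +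
      ∑ k, -2 * (2 * z.1.2 k + ev z (dx k h)) * (2 * z.1.2 k) := by
    unfold linOp' drift'
    rw [parOp_drift, linOp]
    simp [dx_statP]
  have h3 : |∑ k, -2 * (2 * z.1.2 k + ev z (dx k h)) * (2 * z.1.2 k)| ≤
      n * (2 * (3 * √(ev z (statP n B))) * (2 * √(ev z (statP n B)))) := by
    refine abs_sum_fin_le fun k => ?_
    have a1 := abs_coord_le hB z k
    have a2 := ha k
    refine abs_mul_le_mul (abs_mul_le_mul (by norm_num) ?_) ?_
    · rw [abs_le] at *; constructor <;> linarith
    · rw [abs_le] at *; constructor <;> linarith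
  rw [div_self hr.ne'] at h1
  rw [h2]
  refine (abs_add_le _ _).trans ((add_le_add h1 h3).trans (le_of_eq ?_))
  linear_combination 12 * n * hrw

/-- The real inequality behind the bound for the weighted gradient of the Laplacian. -/
theorem gradLap_real_bound {w r P g M d T N C₀ C₂ S L X ε A : ℝ} (hrw : r * r = w) (hr : 0 < r)
    (hP : w / 2 ≤ P) (hg : 0 ≤ g) (hd : 0 ≤ d) (hN : 0 ≤ N) (hC₀ : 0 ≤ C₀)
    (hT : r * T ≤ ε) (hε0 : 0 ≤ ε) (hε : ε ≤ 1)
    (hS : S ≤ N * (g * (C₀ * (r * M + g + d * T)))) (hL : L ≤ C₂ * w)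
    (hX : X ≤ 16 * N ^ 2 * (r * w * g * M))
    (hA : A = w * (2 * S - 2 * P * (M * M)) + g * g * L + X) :
    A ≤ (3 * N * C₀ + C₂ + (2 * N * C₀ + 16 * N ^ 2) ^ 2) * (w * (g * g))
      + N * C₀ * (ε * (d * d)) := by
  have hw : 0 < w := hrw ▸ mul_pos hr hr
  have h1 : w * (2 * S) ≤ 2 * N * C₀ * (r * w * g * M) + 2 * N * C₀ * (w * (g * g))
      + 2 * N * C₀ * (r * g * d * ε) := by
    calc w * (2 * S) ≤ w * (2 * (N * (g * (C₀ * (r * M + g + d * T))))) := by gcongr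
      _ = 2 * N * C₀ * (r * w * g * M) + 2 * N * C₀ * (w * (g * g))
        + 2 * N * C₀ * (r * g * d * (r * T)) := by rw [← hrw]; ring
      _ ≤ _ := by gcongr
  have h2 : w * w * (M * M) ≤ w * (2 * P * (M * M)) := by
    have : 0 ≤ w * (M * M) := by have := mul_self_nonneg M; positivity
    nlinarith
  have h3 : g * g * L ≤ C₂ * (w * (g * g)) := by
    have := mul_le_mul_of_nonneg_left hL (mul_self_nonneg g)
    linarith
  have h4 : 2 * (r * g * d * ε) ≤ w * (g * g) + ε * (d * d) := by
    have e1 : 2 * (r * g * d * ε) ≤ (r * g) ^ 2 + (d * ε) ^ 2 := by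
      linarith [sq_nonneg (r * g - d * ε)]
    have e2 : (d * ε) ^ 2 ≤ ε * (d * d) := by
      have : ε * (ε * (d * d)) ≤ 1 * (ε * (d * d)) := by
        apply mul_le_mul_of_nonneg_right hε; positivity
      linarith
    have e3 : (r * g) ^ 2 = w * (g * g) := by rw [← hrw]; ring
    linarith
  have h5 : (2 * N * C₀ + 16 * N ^ 2) * (r * w * g * M) ≤
      (2 * N * C₀ + 16 * N ^ 2) ^ 2 * (w * (g * g)) + w * w * (M * M) := by
    have e3 : (r * g) ^ 2 = w * (g * g) := by rw [← hrw]; ring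
    have := sq_nonneg ((2 * N * C₀ + 16 * N ^ 2) * (r * g) - w * M)
    have e4 : 0 ≤ ((2 * N * C₀ + 16 * N ^ 2) * (r * g)) ^ 2 + (w * M) ^ 2 := by positivity
    rw [mul_pow, e3] at e4
    have e5 : ((2 * N * C₀ + 16 * N ^ 2) * (r * g) - w * M) ^ 2 =
      (2 * N * C₀ + 16 * N ^ 2) ^ 2 * (r * g) ^ 2
        - 2 * ((2 * N * C₀ + 16 * N ^ 2) * (r * w * g * M)) + w * w * (M * M) := by ring
    rw [e5, e3] at this
    linarith
  have h6 := mul_le_mul_of_nonneg_left h4 (mul_nonneg hN hC₀)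
  rw [hA]
  linarith

theorem exists_linOp'_mul_sqSum_gradLap_le (hq : 0 ≤ q) (hB : 0 < B) (n : ℕ) :
    ∃ C : ℝ, 0 ≤ C ∧ ∀ (h : Sm n), IsFlow q B h → ∀ (z : SpaceTime n) (ε : ℝ), 0 ≤ ε → ε ≤ 1 / 8 →
      SmallAt B h z ε → ev z (linOp' q B h (statP n B * sqSum (gradLap h))) ≤
        C * (ev z (statP n B) * ev z (sqSum (gradLap h)) + ε * size2 h z ^ 2) := by
  set C₀ : ℝ := 8 * n + 6 * q + 4 + 4 * q * n ^ 2 + (2 * q + 2) * n with hC₀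
  set C₂ : ℝ := 8 * n * (q + 1) + 12 * n with hC₂
  have hC₀0 : 0 ≤ C₀ := by positivity
  have hC₂0 : 0 ≤ C₂ := by positivity
  set C₁ : ℝ := 3 * n * C₀ + C₂ + (2 * n * C₀ + 16 * (n : ℝ) ^ 2) ^ 2 with hC₁
  have hC₁0 : 0 ≤ C₁ := by positivity
  refine ⟨C₁ + n * C₀, by positivity, fun h hh z ε hε0 hε hs => ?_⟩
  have hw := statP_pos hB z
  have hr : 0 < √(ev z (statP n B)) := Real.sqrt_pos.2 hw
  have hrw : √(ev z (statP n B)) * √(ev z (statP n B)) = ev z (statP n B) :=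
    Real.mul_self_sqrt hw.le
  have hexp : ev z (linOp' q B h (statP n B * sqSum (gradLap h))) =
      ev z (statP n B) * (2 * ∑ i, ev z (gradLap h i) * ev z (linOp' q B h (gradLap h i))
        - 2 * (ev z (statP n B) + ev z h) * ev z (gradSqSum (gradLap h)))
      + ev z (sqSum (gradLap h)) * ev z (linOp' q B h (statP n B))
      + -(2 * (ev z (statP n B) + ev z h)) * ∑ k, 2 * z.1.2 k * ev z (dx k (sqSum (gradLap h))) := by
    rw [← ev_linOp'_sqSum]
    simp only [linOp', parOp_mul]
    simp [dx_statP]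
    ring
  have hgi := abs_ev_le_sqSum (gradLap h) z
  have hdg := abs_ev_dx_sqSum_le (gradLap h) z
  have hOp := abs_linOp'_gradLap_le hq hB hh (hε.trans (by norm_num)) hs
  have hx := abs_coord_le hB z
  have hz := hs.zero
  have hL := abs_linOp'_statP_le hq hB hh hε hs
  rw [← Real.mul_self_sqrt (gradSqSum_nonneg (gradLap h) z),
    ← Real.mul_self_sqrt (sqSum_nonneg (gradLap h) z)] at hexp
  rw [← Real.mul_self_sqrt (sqSum_nonneg (gradLap h) z)]
  have hg0 : 0 ≤ √(ev z (sqSum (gradLap h))) := Real.sqrt_nonneg _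
  have hM0 : 0 ≤ √(ev z (gradSqSum (gradLap h))) := Real.sqrt_nonneg _
  have hP1 : |ev z h| ≤ ev z (statP n B) / 8 := hz.trans (by nlinarith)
  have hP2 := abs_le.1 hP1
  have main := gradLap_real_bound (P := ev z (statP n B) + ev z h) (N := n) (C₀ := C₀) (C₂ := C₂)
    (d := size2 h z) hrw hr (by linarith) hg0 (size2_nonneg h z) n.cast_nonneg
    hC₀0 hs.three hε0 (hε.trans (by norm_num)) ?_ (le_of_abs_le hL) ?_ hexp
  · have e1 : 0 ≤ C₁ * (ε * (size2 h z * size2 h z)) := by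
      have := mul_self_nonneg (size2 h z); positivity
    have e2 : 0 ≤ n * C₀ * (ev z (statP n B) *
      (√(ev z (sqSum (gradLap h))) * √(ev z (sqSum (gradLap h))))) := by positivity
    rw [sq (size2 h z)]
    linarith
  · exact le_of_abs_le (abs_sum_fin_le fun i => abs_mul_le_mul (hgi i) (hOp i))
  · refine (le_of_abs_le (abs_mul_le_mul (b := n * (2 * √(ev z (statP n B)) * (2 * (n *
      (√(ev z (sqSum (gradLap h))) * √(ev z (gradSqSum (gradLap h))))))))
      (a := 4 * ev z (statP n B)) ?_ ?_)).trans (le_of_eq (by ring))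
    · rw [abs_le]; constructor <;> linarith
    · refine abs_sum_fin_le fun k => abs_mul_le_mul ?_ (by simpa using hdg k)
      rw [abs_mul, abs_two]
      have := hx k
      gcongr

end
end Sm

namespace Sm

variable {n : ℕ} {q B : ℝ} {h : Sm n} {z : SpaceTime n}

/-- The quadratic form in the Laplacian and its weighted gradient that decays at the optimal
rate. -/
def lapForm (K B : ℝ) (h : Sm n) : Sm n :=
  algebraMap ℝ (Sm n) K * lapD dx h ^ 2 + statP n B * sqSum (gradLap h)

theorem ev_lapForm (K B : ℝ) (h : Sm n) (z : SpaceTime n) : ev z (lapForm K B h) =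
    K * ev z (lapD dx h) ^ 2 + ev z (statP n B) * ev z (sqSum (gradLap h)) := by
  simp [lapForm]

theorem lapForm_real_bound {p n q K C₁ ε s d w P G R : ℝ} (hn : 0 ≤ n)
    (hq : 0 ≤ q) (hK : K = 1 + C₁ + 4 * p) (hK0 : 0 ≤ K) (hC₁ : 0 ≤ C₁) (hε : 0 ≤ ε)
    (hs : |s| ≤ n * ε) (hP : w / 2 ≤ P) (hw : 0 ≤ w) (hG : 0 ≤ G)
    (hR : R ≤ C₁ * (w * G + ε * d ^ 2)) :
    K * (2 * s * (-2 * p * s + s ^ 2 - 2 * q * d ^ 2) - 2 * P * G) + R ≤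
      -(4 * p) * (K * s ^ 2 + w * G) +
        (2 * n + 4 * q * n * K + C₁) * ε * ((K * s ^ 2 + w * G) + d ^ 2) := by
  have h1 : s * s ^ 2 ≤ n * ε * s ^ 2 := mul_le_mul_of_nonneg_right (le_of_abs_le hs) (sq_nonneg _)
  have h2 : -s * d ^ 2 ≤ n * ε * d ^ 2 :=
    mul_le_mul_of_nonneg_right ((neg_le_abs s).trans hs) (sq_nonneg _)
  have h3 : w * G ≤ 2 * P * G := by nlinarith
  have e1 := mul_le_mul_of_nonneg_left h1 hK0
  have e2 := mul_le_mul_of_nonneg_left h2 (mul_nonneg hq hK0)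
  have e3 := mul_le_mul_of_nonneg_left h3 hK0
  have f1 : 0 ≤ (2 * n + 4 * q * n * K + C₁) * ε * (w * G) := by positivity
  have f2 : 0 ≤ (4 * q * n * K + C₁) * ε * (K * s ^ 2) := by positivity
  have f3 : 0 ≤ 2 * n * ε * d ^ 2 := by positivity
  have f4 : 0 ≤ w * G := by positivity
  subst hK
  linarith

theorem exists_linOp'_lapForm_le {p : ℝ} (hp : 0 < p) (hpq : 2 * q = p + n) (hB : 0 < B) :
    ∃ K C : ℝ, 1 ≤ K ∧ 0 ≤ C ∧ ∀ (h : Sm n), IsFlow q B h → ∀ (z : SpaceTime n) (ε : ℝ), 0 ≤ ε →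
      ε ≤ 1 / 8 → SmallAt B h z ε → ev z (linOp' q B h (lapForm K B h)) ≤
        -(4 * p) * ev z (lapForm K B h) + C * ε * (ev z (lapForm K B h) + size2 h z ^ 2) := by
  have hn0 : (0 : ℝ) ≤ n := n.cast_nonneg
  have hq : 0 ≤ q := by linarith
  obtain ⟨C₁, hC₁, H⟩ := exists_linOp'_mul_sqSum_gradLap_le hq hB n
  have hK : 0 ≤ 1 + C₁ + 4 * p := by positivity
  refine ⟨1 + C₁ + 4 * p, 2 * n + 4 * q * n * (1 + C₁ + 4 * p) + C₁, by linarith, by positivity,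
    fun h hh z ε hε0 hε hs => ?_⟩
  have h1 := H h hh z ε hε0 hε hs
  have hw := statP_pos hB z
  have hP := abs_le.1 (hs.zero.trans (by nlinarith : _ ≤ ev z (statP n B) / 8))
  have hexp : ev z (linOp' q B h (lapForm (1 + C₁ + 4 * p) B h)) =
      (1 + C₁ + 4 * p) * ev z (linOp' q B h (lapD dx h ^ 2)) +
        ev z (linOp' q B h (statP n B * sqSum (gradLap h))) := by
    simp only [lapForm, linOp', parOp_add]
    rw [parOp_mul_time _ _ (fun k => by simp)]
    simp
  rw [hexp, ev_linOp'_lap_sq hh, ev_lapForm, show (2 * n - 4 * q : ℝ) = -2 * p by linarith]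
  exact lapForm_real_bound (P := ev z (statP n B) + ev z h) hn0 hq rfl hK hC₁ hε0
    ((abs_lapD_le h z).trans (mul_le_mul_of_nonneg_left hs.two hn0)) (by linarith) hw.le
    (sqSum_nonneg _ _) h1

theorem ev_linOp_grad2 (hh : IsFlow q B h) (z : SpaceTime n) (α : Fin n × Fin n) :
    ev z (linOp q B h (grad2 h α)) = -(4 * q) * ev z (grad2 h α) +
      ((2 * z.1.2 α.1 + ev z (dx α.1 h)) * ev z (dx α.2 (lapD dx h))
      + (2 * z.1.2 α.2 + ev z (dx α.2 h)) * ev z (dx α.1 (lapD dx h))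
      + ev z (2 * (if α.2 = α.1 then 1 else 0)) * ev z (lapD dx h)
      + ev z (dx α.2 (dx α.1 h)) * ev z (lapD dx h)
      - 2 * q * ∑ k, ev z (dx α.2 (dx k h)) * ev z (dx k (dx α.1 h))) := by
  have := hh.pressureFlow.parOp_ddh α.1 α.2
  change ev z (linOp q B h (dx α.2 (dx α.1 h))) = -(4 * q) * ev z (dx α.2 (dx α.1 h)) + _
  rw [linOp, this]
  simp
  ring

theorem hess_real_bound {p n q ε d r g s S P T w : ℝ} (hn : 1 ≤ n)
    (hpq : 2 * q = p + n)
    (hS : S ≤ -(4 * q) * d ^ 2 + n * n * (d * (8 * r * g + 2 * |s| + n * ε * d + 2 * q * n * ε * d)))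
    (hPT : 0 ≤ P * T) (hrw : r * r = w)
    (hε : 2 * n ^ 3 * (1 + 2 * q) * ε ≤ 1) :
    2 * S - 2 * P * T ≤ -(4 * p + 2) * d ^ 2 + 128 * n ^ 4 * (s ^ 2 + w * g ^ 2) := by
  have h1 : 16 * n ^ 2 * (d * (r * g)) ≤ d ^ 2 / 2 + 128 * n ^ 4 * (w * g ^ 2) := by
    have := sq_nonneg (d - 16 * n ^ 2 * (r * g))
    have e : (16 * n ^ 2 * (r * g)) ^ 2 = 256 * n ^ 4 * (w * g ^ 2) := by rw [← hrw]; ring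
    linarith
  have h2 : 4 * n ^ 2 * (d * |s|) ≤ d ^ 2 / 2 + 128 * n ^ 4 * s ^ 2 := by
    have := sq_nonneg (d - 4 * n ^ 2 * |s|)
    have e : (4 * n ^ 2 * |s|) ^ 2 = 16 * n ^ 4 * s ^ 2 := by rw [mul_pow, sq_abs]; ring
    have : 0 ≤ n ^ 4 * s ^ 2 := by positivity
    linarith
  have h3 := mul_le_mul_of_nonneg_right hε (sq_nonneg d)
  have h4 := mul_le_mul_of_nonneg_right hn (sq_nonneg d)
  have h5 : 2 * q * d ^ 2 = (p + n) * d ^ 2 := by rw [hpq]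
  linarith

theorem linOp_sqSum_grad2_le {p : ℝ} (hn : 1 ≤ n) (hp : 0 < p) (hpq : 2 * q = p + n) (hB : 0 < B)
    (hh : IsFlow q B h) {ε : ℝ} (hε1 : ε ≤ 1 / 8)
    (hε : 2 * (n : ℝ) ^ 3 * (1 + 2 * q) * ε ≤ 1) (hs : SmallAt B h z ε) :
    ev z (linOp q B h (sqSum (grad2 h))) ≤ -(4 * p + 2) * size2 h z ^ 2 +
      128 * (n : ℝ) ^ 4 * (ev z (lapD dx h) ^ 2 +
        ev z (statP n B) * ev z (sqSum (gradLap h))) := by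
  have hn1 : (1 : ℝ) ≤ n := by exact_mod_cast hn
  have hq : 0 ≤ q := by linarith
  have hw := statP_pos hB z
  have hr : 0 < √(ev z (statP n B)) := Real.sqrt_pos.2 hw
  have hP := abs_le.1 (hs.zero.trans (by nlinarith : _ ≤ ev z (statP n B) / 8))
  rw [ev_linOp_sqSum]
  rw [← Real.sq_sqrt (sqSum_nonneg (gradLap h) z)]
  have hgi := abs_ev_le_sqSum (gradLap h) z
  have hg0 : 0 ≤ √(ev z (sqSum (gradLap h))) := Real.sqrt_nonneg _
  refine hess_real_bound (ε := ε) (q := q) (r := √(ev z (statP n B))) hn1 hpq ?_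
    (mul_nonneg (by linarith) (gradSqSum_nonneg _ _)) (Real.mul_self_sqrt hw.le) hε
  set r := √(ev z (statP n B))
  set g := √(ev z (sqSum (gradLap h)))
  have hsplit : ∑ α, ev z (grad2 h α) * ev z (linOp q B h (grad2 h α)) =
      -(4 * q) * size2 h z ^ 2 + ∑ α, ev z (grad2 h α) *
        (ev z (linOp q B h (grad2 h α)) + 4 * q * ev z (grad2 h α)) := by
    rw [size2_sq, ev_sqSum, Finset.mul_sum, ← Finset.sum_add_distrib]
    exact Finset.sum_congr rfl fun α _ => by ring
  have hx : ∀ i, |2 * z.1.2 i + ev z (dx i h)| ≤ 4 * r := fun i => by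
    refine (abs_gradP_le hB i).trans ?_
    have := hs.one.trans (mul_le_of_le_one_left hr.le (by linarith : ε ≤ 1))
    linarith
  have hd := hs.two
  have hd0 := size2_nonneg h z
  have hL : |ev z (lapD dx h)| ≤ n * ε :=
    (abs_lapD_le h z).trans (by gcongr)
  rw [hsplit]
  gcongr
  have hcard : ((Fintype.card (Fin n × Fin n) : ℕ) : ℝ) = n * n := by simp
  rw [← hcard]
  refine le_of_abs_le (abs_sum_le_card_mul fun α => abs_mul_le_mul (abs_ev_le_sqSum _ z α) ?_)
  rw [ev_linOp_grad2 hh]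
  have a1 := abs_mul_le_mul (hx α.1) (hgi α.2)
  have a2 := abs_mul_le_mul (hx α.2) (hgi α.1)
  have a3 : |ev z (2 * (if α.2 = α.1 then 1 else 0)) * ev z (lapD dx h)| ≤
      2 * |ev z (lapD dx h)| := by
    rw [abs_mul]; gcongr
    split_ifs <;> simp
  have a4 := abs_mul_le_mul (abs_ddx_le h z α.1 α.2) hL
  have a5 : |∑ k, ev z (dx α.2 (dx k h)) * ev z (dx k (dx α.1 h))| ≤ n * (size2 h z * ε) :=
    abs_sum_fin_le fun k =>
      abs_mul_le_mul (abs_ddx_le h z k α.2) ((abs_ddx_le h z α.1 k).trans hd)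
  have a6 : |2 * q * ∑ k, ev z (dx α.2 (dx k h)) * ev z (dx k (dx α.1 h))| ≤
      2 * q * (n * (size2 h z * ε)) :=
    abs_mul_le_mul (by rw [abs_of_nonneg (by positivity)]) a5
  simp only [gradLap] at a1 a2
  rw [abs_le] at a1 a2 a3 a4 a6 ⊢
  constructor <;> linarith

end Sm

namespace Sm

variable {n : ℕ}

/-- The barrier `y(t) + g(t) W`. -/
def barrier (B : ℝ) (y g : ℝ → ℝ) (hy : ContDiff ℝ (⊤ : ℕ∞) y) (hg : ContDiff ℝ (⊤ : ℕ∞) g) :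
    Sm n := time y hy + time g hg * statP n B

theorem ev_barrier (B : ℝ) (y g : ℝ → ℝ) (hy : ContDiff ℝ (⊤ : ℕ∞) y)
    (hg : ContDiff ℝ (⊤ : ℕ∞) g) (z : SpaceTime n) :
    ev z (barrier B y g hy hg) = y z.1.1 + g z.1.1 * ev z (statP n B) := by
  simp [barrier, ev_time]

theorem ev_parOp_barrier (B : ℝ) (y g : ℝ → ℝ) (hy : ContDiff ℝ (⊤ : ℕ∞) y)
    (hg : ContDiff ℝ (⊤ : ℕ∞) g) (P : Sm n) (b : Fin n → Sm n) (z : SpaceTime n) :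
    ev z (parOp dx dt P b (barrier B y g hy hg)) = deriv y z.1.1 +
      deriv g z.1.1 * ev z (statP n B) + g z.1.1 * ev z (parOp dx dt P b (statP n B)) := by
  have h1 : parOp dx dt P b (time y hy) = dt (time (n := n) y hy) := by
    simp [parOp, lapD, dx_time]
  rw [barrier, parOp_add, parOp_mul_time _ _ (fun k => dx_time k g hg), h1]
  simp [ev_time, ev_dt_time]
  ring

theorem parOp_const_mul (P : Sm n) (b : Fin n → Sm n) (c : ℝ) (f : Sm n) :
    parOp dx dt P b (algebraMap ℝ _ c * f) = algebraMap ℝ _ c * parOp dx dt P b f := by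
  rw [parOp_mul_time _ _ fun k => Derivation.map_algebraMap _ _, Derivation.map_algebraMap]
  simp

theorem deriv_mul_exp (κ M t : ℝ) :
    deriv (fun s => κ * Real.exp (M * s)) t = M * (κ * Real.exp (M * t)) := by
  have h1 : HasDerivAt (fun s => κ * Real.exp (M * s)) (κ * (Real.exp (M * t) * (M * 1))) t :=
    (((hasDerivAt_id t).const_mul M).exp).const_mul κ
  rw [h1.deriv]; ring

theorem contDiff_mul_exp (κ M : ℝ) : ContDiff ℝ (⊤ : ℕ∞) fun s => κ * Real.exp (M * s) := by
  fun_prop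

theorem lapForm_le {B : ℝ} (hB : 0 < B) {K : ℝ} (hK : 0 ≤ K) {h : Sm n} {z : SpaceTime n} {ε : ℝ}
    (hε : 0 ≤ ε) (hs : SmallAt B h z ε) :
    ev z (lapForm K B h) ≤ (K * n ^ 2 + n ^ 3) * ε ^ 2 := by
  have hw := statP_pos hB z
  have hr : 0 < √(ev z (statP n B)) := Real.sqrt_pos.2 hw
  have h1 : ev z (lapD dx h) ^ 2 ≤ (n * ε) ^ 2 :=
    sq_le_sq' (by have := neg_le_of_abs_le ((abs_lapD_le h z).trans
      (mul_le_mul_of_nonneg_left hs.two n.cast_nonneg)); linarith)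
      (le_of_abs_le ((abs_lapD_le h z).trans (mul_le_mul_of_nonneg_left hs.two n.cast_nonneg)))
  have h2 : ev z (statP n B) * ev z (sqSum (gradLap h)) ≤ n * (n * ε) ^ 2 := by
    rw [ev_sqSum, Finset.mul_sum]
    refine (le_abs_self _).trans (abs_sum_fin_le fun i => ?_)
    have e1 : ev z (statP n B) * ev z (gradLap h i) ^ 2 =
        (√(ev z (statP n B)) * ev z (gradLap h i)) ^ 2 := by
      rw [mul_pow, Real.sq_sqrt hw.le]
    rw [e1, abs_of_nonneg (sq_nonneg _)]
    refine sq_le_sq.2 ?_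
    rw [abs_mul, abs_of_pos hr, abs_of_nonneg (by positivity : 0 ≤ n * ε)]
    calc √(ev z (statP n B)) * |ev z (gradLap h i)|
        ≤ √(ev z (statP n B)) * (n * size3 h z) := by gcongr; exact abs_dx_lapD_le h z i
      _ = n * (√(ev z (statP n B)) * size3 h z) := by ring
      _ ≤ n * ε := by gcongr; exact hs.three
  rw [ev_lapForm]
  have h3 := mul_le_mul_of_nonneg_left h1 hK
  linarith

/-- Strict supersolution property of the barrier, in real numbers. -/
theorem barrier_real_bound {p C ε ε₀ y y' E M C₄ w L : ℝ} (hp : 0 < p) (hC : 0 ≤ C)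
    (hε : ε ≤ ε₀) (hε₀ : ε₀ ≤ 1) (hE : 0 < E) (hw : 0 < w) (hL : |L| ≤ C₄ * w)
    (hM : M = C₄ + C + 1) (hy : (-(4 * p) + C * ε) * y ≤ y') :
    (-(4 * p) + C * ε) * (y + E * w) < y' + M * E * w + E * L := by
  have h1 : E * (-(C₄ * w)) ≤ E * L := mul_le_mul_of_nonneg_left (neg_le_of_abs_le hL) hE.le
  have h2 : C * ε ≤ C := by nlinarith
  have h3 : 0 < E * w := mul_pos hE hw
  have h4 := mul_le_mul_of_nonneg_right h2 h3.le
  have h5 : 0 < p * (E * w) := mul_pos hp h3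
  subst hM
  linarith

set_option maxHeartbeats 1600000 in
theorem exists_pair_comparison {p q B : ℝ} (hn : 1 ≤ n) (hp : 0 < p) (hpq : 2 * q = p + n)
    (hB : 0 < B) : ∃ K C ε₀ : ℝ, 1 ≤ K ∧ 1 ≤ C ∧ 0 < ε₀ ∧ ε₀ ≤ 1 / 8 ∧
      ∀ h : Sm n, IsFlow q B h → ∀ (ε y : ℝ → ℝ) (t₀ : ℝ), 0 < t₀ →
      (∀ t, t₀ ≤ t → 0 ≤ ε t ∧ ε t ≤ ε₀) →
      (∀ z : SpaceTime n, t₀ ≤ z.1.1 → SmallAt B h z (ε z.1.1)) →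
      ContDiff ℝ (⊤ : ℕ∞) y → (∀ t, t₀ ≤ t → 0 ≤ y t) →
      (∀ t, t₀ ≤ t → (-(4 * p) + C * ε t) * y t ≤ deriv y t) →
      (∀ z : SpaceTime n, z.1.1 = t₀ → ev z (lapForm K B h) ≤ y t₀ ∧ size2 h z ^ 2 ≤ y t₀) →
      ∀ z : SpaceTime n, t₀ ≤ z.1.1 →
        ev z (lapForm K B h) ≤ y z.1.1 ∧ size2 h z ^ 2 ≤ C * y z.1.1 := by
  have hn1 : (1 : ℝ) ≤ n := by exact_mod_cast hn
  have hq : 0 ≤ q := by linarith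
  obtain ⟨K, CQ, hK, hCQ, HQ⟩ := exists_linOp'_lapForm_le (n := n) hp hpq hB
  set C₃ : ℝ := 128 * (n : ℝ) ^ 4 with hC₃
  have hC₃1 : 1 ≤ C₃ := by
    have : (1 : ℝ) ≤ (n : ℝ) ^ 4 := one_le_pow₀ hn1
    linarith
  set C : ℝ := (CQ + 1) * (1 + 2 * C₃) with hC
  have hC1 : 2 * C₃ ≤ C := by
    have : 0 ≤ CQ * (1 + 2 * C₃) := by positivity
    linarith
  set C₅ : ℝ := 2 * (n : ℝ) ^ 3 * (1 + 2 * q) with hC₅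
  have hC₅0 : 0 ≤ C₅ := by positivity
  set C₄ : ℝ := 8 * n * (q + 1) + 12 * n with hC₄
  have hC₄0 : 0 ≤ C₄ := by positivity
  refine ⟨K, C, 1 / (8 + C₅), hK, by linarith, by positivity, ?_, ?_⟩
  · rw [div_le_div_iff₀ (by positivity) (by norm_num)]; linarith
  intro h hh ε y t₀ ht₀ hε hsm hysm hy0 hy hinit z hz
  have hεb : ∀ t, t₀ ≤ t → ε t ≤ 1 / 8 ∧ C₅ * ε t ≤ 1 := by
    intro t ht
    obtain ⟨h0, h1⟩ := hε t ht
    rw [le_div_iff₀ (by positivity)] at h1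
    have : 0 ≤ ε t * C₅ := by positivity
    constructor <;> linarith
  set M : ℝ := C₄ + C + 1 with hM
  have hM0 : 0 ≤ M := by linarith
  set Mb : ℝ := (K * n ^ 2 + n ^ 3 + 1) * 1 ^ 2 with hMb
  have claim : ∀ κ : ℝ, 0 < κ → ∀ i : Bool,
      ev z (bif i then lapForm K B h - barrier B y _ hysm (contDiff_mul_exp κ M)
        else sqSum (grad2 h) - algebraMap ℝ (Sm n) (2 * C₃) *
          barrier B y _ hysm (contDiff_mul_exp κ M)) < 0 := by
    intro κ hκ i
    set E : ℝ → ℝ := fun s => κ * Real.exp (M * s) with hE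
    have hE0 : ∀ t, 0 < E t := fun t => by simp only [hE]; positivity
    have hE1 : ∀ t, t₀ ≤ t → κ ≤ E t := fun t ht => by
      simp only [hE]
      refine le_mul_of_one_le_right hκ.le (Real.one_le_exp ?_)
      have := ht₀.le.trans ht; positivity
    set Y : Sm n := barrier B y E hysm (contDiff_mul_exp κ M) with hY
    have evY : ∀ z : SpaceTime n, ev z Y = y z.1.1 + E z.1.1 * ev z (statP n B) := fun z =>
      ev_barrier _ _ _ _ _ z
    have hYpos : ∀ z : SpaceTime n, t₀ ≤ z.1.1 → 0 < ev z Y := fun z hz => by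
      rw [evY]; have := hE0 z.1.1; have := statP_pos hB z; have := hy0 _ hz; positivity
    have hQb : ∀ z : SpaceTime n, t₀ ≤ z.1.1 → ev z (lapForm K B h) ≤ Mb ∧
        ev z (sqSum (grad2 h)) ≤ Mb := by
      intro z hz
      have h0 := (hε _ hz).1
      have h1 : ε z.1.1 ^ 2 ≤ 1 ^ 2 := pow_le_pow_left₀ h0 (by linarith [(hεb _ hz).1]) 2
      have h3 : 0 ≤ K * (n : ℝ) ^ 2 + n ^ 3 := by positivity
      constructor
      · refine (lapForm_le hB (by linarith) h0 (hsm z hz)).trans ?_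
        simp only [hMb]
        have := mul_le_mul_of_nonneg_left h1 h3
        linarith
      · rw [← size2_sq]
        have h2 := pow_le_pow_left₀ (size2_nonneg h z) (hsm z hz).two 2
        simp only [hMb]
        linarith
    set R : ℝ := max (ev z (statP n B)) (Mb / κ + 1) with hR
    have hRb : ∀ z : SpaceTime n, t₀ ≤ z.1.1 → ev z (statP n B) = R → Mb < ev z Y := by
      intro z hz hw
      have h1 : Mb < κ * R := by
        have : Mb / κ < R := lt_of_lt_of_le (by linarith) (le_max_right _ _)
        rwa [div_lt_iff₀' hκ] at this
      have h2 : κ * R ≤ E z.1.1 * R :=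
        mul_le_mul_of_nonneg_right (hE1 _ hz) (hw ▸ (statP_pos hB z).le)
      rw [evY, hw]
      linarith [hy0 _ hz]
    have hOpY : ∀ (b : Fin n → Sm n) (z : SpaceTime n), t₀ ≤ z.1.1 →
        |ev z (parOp dx dt (statP n B + h) b (statP n B))| ≤ C₄ * ev z (statP n B) →
        (-(4 * p) + C * ε z.1.1) * ev z Y < ev z (parOp dx dt (statP n B + h) b Y) := by
      intro b z hz hb
      rw [evY, ev_parOp_barrier, deriv_mul_exp]
      exact barrier_real_bound hp (by linarith) (hεb _ hz).1 (by norm_num) (hE0 _)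
        (statP_pos hB z) hb hM (hy _ hz)
    refine neg_of_parOp (F := fun i => bif i then lapForm K B h - Y
        else sqSum (grad2 h) - algebraMap ℝ (Sm n) (2 * C₃) * Y)
      (P := statP n B + h) (b := fun i => bif i then drift' dx X (algebraMap ℝ (Sm n) q) h
        else drift dx X (algebraMap ℝ (Sm n) q) h)
      (K := weightBall n B R) (isCompact_weightBall n hB) (t₀ := t₀) (t₁ := z.1.1) ht₀
      ?_ ?_ ?_ ?_ i z hz le_rfl ((mem_weightBall).2 (le_max_left _ _))
    · intro z hz _ _
      have h1 := abs_le.1 ((hsm z hz).zero)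
      have h2 := mul_le_mul_of_nonneg_right (hεb _ hz).1 (statP_pos hB z).le
      have := statP_pos hB z
      rw [map_add]; linarith
    · intro i z hz _
      have h1 := hinit z hz
      have h2 : y t₀ < ev z Y := by
        rw [evY, hz]; have := hE0 t₀; have := statP_pos hB z
        have : 0 < E t₀ * ev z (statP n B) := by positivity
        linarith
      have h3 := hYpos z hz.ge
      cases i
      · simp [← size2_sq]; nlinarith
      · simp; linarith
    · intro i z hz _ hzK hzi
      have h1 := hRb z hz (ev_statP_eq_of_notMem_interior hzK hzi)
      have h2 := hQb z hz
      have h3 := hYpos z hz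
      cases i
      · simp; nlinarith
      · simp; linarith
    · intro i z hz _ _ heq hle
      have hle1 : ev z (lapForm K B h) ≤ ev z Y := by simpa using hle true
      have hle2 : ev z (sqSum (grad2 h)) ≤ 2 * C₃ * ev z Y := by
        simpa [ev_algebraMap] using hle false
      have h3 := hYpos z hz
      have hw := statP_pos hB z
      obtain ⟨hε1, hε2⟩ := hεb _ hz
      have hε0 := (hε _ hz).1
      have hs := hsm z hz
      cases i
      · have heq' : ev z (sqSum (grad2 h)) = 2 * C₃ * ev z Y := by
          simpa [ev_algebraMap, sub_eq_zero] using heq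
        have h4 := hOpY (drift dx X (algebraMap ℝ (Sm n) q) h) z hz ?_
        · have h5 := linOp_sqSum_grad2_le hn hp hpq hB hh hε1 hε2 hs
          rw [size2_sq, heq', linOp] at h5
          have h6 : ev z (lapD dx h) ^ 2 + ev z (statP n B) * ev z (sqSum (gradLap h)) ≤
              ev z (lapForm K B h) := by
            rw [ev_lapForm]; nlinarith [sq_nonneg (ev z (lapD dx h))]
          have h7 := mul_le_mul_of_nonneg_left (h6.trans hle1) (by linarith : 0 ≤ C₃)
          simp only [cond_false]
          rw [parOp_sub, parOp_const_mul, map_sub, map_mul, ev_algebraMap]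
          have h8 := mul_le_mul_of_nonneg_left h4.le (by linarith : 0 ≤ 2 * C₃)
          have h9 : 0 < C₃ * ev z Y := by positivity
          have h10 : 0 ≤ C * ε z.1.1 * (C₃ * ev z Y) := by positivity
          linarith
        · have := abs_linOp_statP_le hq hB hh (z := z) (a := √(ev z (statP n B)))
            (hs.zero.trans (by nlinarith)) (fun k => (abs_dx_le h z k).trans
              (hs.one.trans (by nlinarith [Real.sqrt_nonneg (ev z (statP n B))])))
            (Real.sqrt_nonneg _)
          rw [div_self (Real.sqrt_pos.2 hw).ne'] at this
          refine this.trans ?_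
          have : 0 ≤ 12 * n * ev z (statP n B) := by positivity
          rw [hC₄]; linarith
      · have heq' : ev z (lapForm K B h) = ev z Y := by simpa [sub_eq_zero] using heq
        have h4 := hOpY (drift' dx X (algebraMap ℝ (Sm n) q) h) z hz
          (abs_linOp'_statP_le hq hB hh hε1 hs)
        have h5 := HQ h hh z _ hε0 hε1 hs
        rw [heq', size2_sq, linOp'] at h5
        simp only [cond_true]
        rw [parOp_sub, map_sub]
        have h6 : CQ * ε z.1.1 * (ev z Y + ev z (sqSum (grad2 h))) ≤ C * ε z.1.1 * ev z Y := by
          calc _ ≤ CQ * ε z.1.1 * (ev z Y + 2 * C₃ * ev z Y) := by gcongr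
            _ = CQ * (1 + 2 * C₃) * (ε z.1.1 * ev z Y) := by ring
            _ ≤ C * (ε z.1.1 * ev z Y) := by rw [hC]; gcongr; linarith
            _ = _ := by ring
        linarith
  have hEw : 0 < Real.exp (M * z.1.1) * ev z (statP n B) := by
    have := statP_pos hB z; positivity
  have hlim : ∀ (a b c : ℝ), 0 < c → (∀ κ : ℝ, 0 < κ → a < b + κ * c) → a ≤ b := by
    intro a b c hc H
    refine le_of_forall_pos_le_add fun e he => ?_
    have := H (e / c) (by positivity)
    rw [div_mul_cancel₀ _ hc.ne'] at this
    exact this.le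
  constructor
  · refine hlim _ _ _ hEw fun κ hκ => ?_
    have := claim κ hκ true
    simp only [cond_true, map_sub, ev_barrier] at this
    linarith
  · have h1 : size2 h z ^ 2 ≤ 2 * C₃ * y z.1.1 := by
      refine hlim _ _ (2 * C₃ * (Real.exp (M * z.1.1) * ev z (statP n B))) (by positivity)
        fun κ hκ => ?_
      have := claim κ hκ false
      simp only [cond_false, map_sub, map_mul, ev_algebraMap, ev_barrier] at this
      rw [size2_sq]
      linarith
    exact h1.trans (mul_le_mul_of_nonneg_right hC1 (hy0 _ hz))

end Sm

section ODE

variable {u u' : ℝ → ℝ} {T c l M : ℝ}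

theorem antitoneOn_Ici_of_hasDerivAt_nonpos {v v' : ℝ → ℝ}
    (hv : ∀ t, T ≤ t → HasDerivAt v (v' t) t) (h : ∀ t, T ≤ t → v' t ≤ 0) :
    AntitoneOn v (Set.Ici T) := by
  refine antitoneOn_of_deriv_nonpos (convex_Ici T)
    (fun t ht => (hv t ht).continuousAt.continuousWithinAt)
    (fun t ht => (hv t (interior_subset ht)).differentiableAt.differentiableWithinAt) ?_
  intro t ht
  rw [(hv t (interior_subset ht)).deriv]
  exact h t (interior_subset ht)

theorem hasDerivAt_exp_mul (a t : ℝ) :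
    HasDerivAt (fun s => Real.exp (a * s)) (a * Real.exp (a * t)) t := by
  have := ((hasDerivAt_id t).const_mul a).exp
  simpa [mul_comm] using this

theorem exists_le_exp_of_damped (hT : 0 ≤ T) (hM : 0 ≤ M) (hcl : c < l)
    (hu : ∀ t, T ≤ t → HasDerivAt u (u' t) t)
    (hb : ∀ t, T ≤ t → u' t + l * u t ≤ M * Real.exp (-c * t)) :
    ∃ C : ℝ, 0 ≤ C ∧ ∀ t, T ≤ t → u t ≤ C * Real.exp (-c * t) := by
  have hlc : 0 < l - c := sub_pos.2 hcl
  set v : ℝ → ℝ := fun t => Real.exp (l * t) * u t - M / (l - c) * Real.exp ((l - c) * t) with hv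
  have hvd : ∀ t, T ≤ t → HasDerivAt v (l * Real.exp (l * t) * u t + Real.exp (l * t) * u' t
      - M / (l - c) * ((l - c) * Real.exp ((l - c) * t))) t := fun t ht =>
    ((hasDerivAt_exp_mul l t).mul (hu t ht)).sub ((hasDerivAt_exp_mul (l - c) t).const_mul _)
  have hanti := antitoneOn_Ici_of_hasDerivAt_nonpos hvd fun t ht => by
    have h1 := mul_le_mul_of_nonneg_left (hb t ht) (Real.exp_pos (l * t)).le
    have h2 : Real.exp ((l - c) * t) = Real.exp (l * t) * Real.exp (-c * t) := by
      rw [← Real.exp_add]; ring_nf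
    have h3 : M / (l - c) * ((l - c) * Real.exp ((l - c) * t)) =
        M * (Real.exp (l * t) * Real.exp (-c * t)) := by
      rw [h2]; field_simp
    rw [h3]
    linarith
  refine ⟨|v T| + M / (l - c), by positivity, fun t ht => ?_⟩
  have h1 : v t ≤ v T := hanti Set.self_mem_Ici ht ht
  have h2 : Real.exp ((l - c) * t) = Real.exp (l * t) * Real.exp (-c * t) := by
    rw [← Real.exp_add]; ring_nf
  have h3 : 1 ≤ Real.exp ((l - c) * t) := Real.one_le_exp (mul_nonneg hlc.le (hT.trans ht))
  have h4 : Real.exp (l * t) * u t ≤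
      Real.exp (l * t) * ((|v T| + M / (l - c)) * Real.exp (-c * t)) := by
    have h5 : |v T| ≤ |v T| * Real.exp ((l - c) * t) := le_mul_of_one_le_right (abs_nonneg _) h3
    have h6 := le_abs_self (v T)
    have h7 : v t = Real.exp (l * t) * u t - M / (l - c) * Real.exp ((l - c) * t) := rfl
    calc Real.exp (l * t) * u t = v t + M / (l - c) * Real.exp ((l - c) * t) := by rw [h7]; ring
      _ ≤ |v T| * Real.exp ((l - c) * t) + M / (l - c) * Real.exp ((l - c) * t) := by linarith
      _ = _ := by rw [h2]; ring
  exact le_of_mul_le_mul_left h4 (Real.exp_pos _)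

theorem exists_abs_le_exp_of_damped (hT : 0 ≤ T) (hM : 0 ≤ M) (hcl : c < l)
    (hu : ∀ t, T ≤ t → HasDerivAt u (u' t) t)
    (hb : ∀ t, T ≤ t → |u' t + l * u t| ≤ M * Real.exp (-c * t)) :
    ∃ C : ℝ, 0 ≤ C ∧ ∀ t, T ≤ t → |u t| ≤ C * Real.exp (-c * t) := by
  obtain ⟨C₁, h1, H1⟩ := exists_le_exp_of_damped hT hM hcl hu fun t ht => le_of_abs_le (hb t ht)
  obtain ⟨C₂, h2, H2⟩ := exists_le_exp_of_damped (u := fun t => -u t) (u' := fun t => -u' t)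
    hT hM hcl (fun t ht => (hu t ht).neg) fun t ht => by
      have := (neg_le_abs _).trans (hb t ht); linarith
  refine ⟨C₁ + C₂, by positivity, fun t ht => ?_⟩
  have e1 := H1 t ht
  have e2 := H2 t ht
  have e3 := Real.exp_pos (-c * t)
  have e4 : 0 ≤ C₁ * Real.exp (-c * t) := by positivity
  have e5 : 0 ≤ C₂ * Real.exp (-c * t) := by positivity
  rw [abs_le]; constructor <;> linarith

theorem le_exp_of_deriv_le_of_tendsto (hc : 0 < c)
    (hu : ∀ t, T ≤ t → HasDerivAt u (u' t) t)
    (hb : ∀ t, T ≤ t → -(M * Real.exp (-c * t)) ≤ u' t) (h0 : Tendsto u atTop (𝓝 0)) :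
    ∀ t, T ≤ t → u t ≤ M / c * Real.exp (-c * t) := by
  set v : ℝ → ℝ := fun t => M / c * Real.exp (-c * t) - u t with hv
  have hvd : ∀ t, T ≤ t → HasDerivAt v (M / c * (-c * Real.exp (-c * t)) - u' t) t := fun t ht =>
    ((hasDerivAt_exp_mul (-c) t).const_mul _).sub (hu t ht)
  have hanti := antitoneOn_Ici_of_hasDerivAt_nonpos hvd fun t ht => by
    have h3 : M / c * (-c * Real.exp (-c * t)) = -(M * Real.exp (-c * t)) := by field_simp
    rw [h3]; linarith [hb t ht]
  have hlim : Tendsto v atTop (𝓝 0) := by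
    have h1 : Tendsto (fun t : ℝ => Real.exp (-c * t)) atTop (𝓝 0) :=
      Real.tendsto_exp_atBot.comp (tendsto_id.const_mul_atTop_of_neg (neg_neg_of_pos hc))
    have h2 := (h1.const_mul (M / c)).sub h0
    rwa [mul_zero, sub_zero] at h2
  intro t ht
  have h1 : 0 ≤ v t := le_of_tendsto hlim (by
    filter_upwards [eventually_ge_atTop t] with s hs
    exact hanti ht (ht.trans hs) hs)
  have h2 : v t = M / c * Real.exp (-c * t) - u t := rfl
  linarith

theorem abs_le_exp_of_deriv_le_of_tendsto (hc : 0 < c)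
    (hu : ∀ t, T ≤ t → HasDerivAt u (u' t) t)
    (hb : ∀ t, T ≤ t → |u' t| ≤ M * Real.exp (-c * t)) (h0 : Tendsto u atTop (𝓝 0)) :
    ∀ t, T ≤ t → |u t| ≤ M / c * Real.exp (-c * t) := by
  intro t ht
  have h1 := le_exp_of_deriv_le_of_tendsto hc hu (fun t ht => neg_le_of_abs_le (hb t ht)) h0 t ht
  have h2 := le_exp_of_deriv_le_of_tendsto (u := fun t => -u t) (u' := fun t => -u' t) hc
    (fun t ht => (hu t ht).neg) (fun t ht => neg_le_neg (le_of_abs_le (hb t ht)))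
    (by simpa using h0.neg) t ht
  rw [abs_le]; constructor <;> linarith

theorem exists_tendsto_of_deriv_le (hc : 0 < c) (hM : 0 ≤ M)
    (hu : ∀ t, T ≤ t → HasDerivAt u (u' t) t)
    (hb : ∀ t, T ≤ t → |u' t| ≤ M * Real.exp (-c * t)) : ∃ L, Tendsto u atTop (𝓝 L) := by
  have hd : ∀ (s : ℝ) t, T ≤ t → HasDerivAt (fun t => u t + s * (M / c * Real.exp (-c * t)))
      (u' t + s * (M / c * (-c * Real.exp (-c * t)))) t := fun s t ht =>
    (hu t ht).add (((hasDerivAt_exp_mul (-c) t).const_mul _).const_mul s)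
  have h3 : ∀ t, M / c * (-c * Real.exp (-c * t)) = -(M * Real.exp (-c * t)) := fun t => by
    field_simp
  have hanti := antitoneOn_Ici_of_hasDerivAt_nonpos (hd 1) fun t ht => by
    rw [h3]; linarith [le_of_abs_le (hb t ht)]
  have hanti' := antitoneOn_Ici_of_hasDerivAt_nonpos (fun t ht => (hd (-1) t ht).neg)
    fun t ht => by rw [h3]; linarith [neg_le_of_abs_le (hb t ht)]
  set v : ℝ → ℝ := fun t => u t + 1 * (M / c * Real.exp (-c * t)) with hv
  have h1 : Tendsto (fun t : ℝ => Real.exp (-c * t)) atTop (𝓝 0) :=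
    Real.tendsto_exp_atBot.comp (tendsto_id.const_mul_atTop_of_neg (neg_neg_of_pos hc))
  have hw : Antitone fun t => v (max t T) := fun a b hab => by
    have := hanti (Set.mem_Ici.2 (le_max_right a T)) (Set.mem_Ici.2 (le_max_right b T))
      (max_le_max_right T hab)
    exact this
  have hbdd : BddBelow (Set.range fun t => v (max t T)) := by
    refine ⟨u T + -1 * (M / c * Real.exp (-c * T)), ?_⟩
    rintro _ ⟨t, rfl⟩
    have e1 := neg_le_neg (hanti' Set.self_mem_Ici (Set.mem_Ici.2 (le_max_right t T))
      (le_max_right t T))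
    simp only [Pi.neg_apply, neg_neg] at e1
    have e2 : 0 ≤ M / c * Real.exp (-c * max t T) := by positivity
    simp only [hv]
    linarith
  have hlim := tendsto_atTop_ciInf hw hbdd
  have hlim' : Tendsto v atTop (𝓝 (⨅ t, v (max t T))) := hlim.congr' (by
    filter_upwards [eventually_ge_atTop T] with t ht
    rw [max_eq_left ht])
  refine ⟨_, (hlim'.sub (h1.const_mul (M / c))).congr fun t => ?_⟩
  simp only [hv]; ring

theorem exists_asymptotic_of_damped (hM : 0 ≤ M) (hcl : l < c)
    (hu : ∀ t, T ≤ t → HasDerivAt u (u' t) t)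
    (hb : ∀ t, T ≤ t → |u' t + l * u t| ≤ M * Real.exp (-c * t)) :
    ∃ L C : ℝ, ∀ t, T ≤ t → |u t - L * Real.exp (-l * t)| ≤ C * Real.exp (-c * t) := by
  set v : ℝ → ℝ := fun t => Real.exp (l * t) * u t with hv
  have hvd : ∀ t, T ≤ t → HasDerivAt v (l * Real.exp (l * t) * u t + Real.exp (l * t) * u' t) t :=
    fun t ht => (hasDerivAt_exp_mul l t).mul (hu t ht)
  have hvb : ∀ t, T ≤ t → |l * Real.exp (l * t) * u t + Real.exp (l * t) * u' t| ≤
      M * Real.exp (-(c - l) * t) := fun t ht => by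
    have h1 : l * Real.exp (l * t) * u t + Real.exp (l * t) * u' t =
        Real.exp (l * t) * (u' t + l * u t) := by ring
    have h2 : Real.exp (-(c - l) * t) = Real.exp (l * t) * Real.exp (-c * t) := by
      rw [← Real.exp_add]; ring_nf
    rw [h1, abs_mul, abs_of_pos (Real.exp_pos _), h2]
    calc _ ≤ Real.exp (l * t) * (M * Real.exp (-c * t)) := by gcongr; exact hb t ht
      _ = _ := by ring
  obtain ⟨L, hL⟩ := exists_tendsto_of_deriv_le (sub_pos.2 hcl) hM hvd hvb
  refine ⟨L, M / (c - l), fun t ht => ?_⟩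
  have h1 := abs_le_exp_of_deriv_le_of_tendsto (u := fun t => v t - L) (sub_pos.2 hcl)
    (fun t ht => (hvd t ht).sub_const L) hvb (by simpa using hL.sub_const L) t ht
  have h2 : u t - L * Real.exp (-l * t) = Real.exp (-l * t) * (v t - L) := by
    have : Real.exp (-l * t) * Real.exp (l * t) = 1 := by rw [← Real.exp_add]; simp
    simp only [hv]
    linear_combination (-u t) * this
  have h3 : Real.exp (-c * t) = Real.exp (-l * t) * Real.exp (-(c - l) * t) := by
    rw [← Real.exp_add]; ring_nf
  rw [h2, abs_mul, abs_of_pos (Real.exp_pos _), h3]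
  calc _ ≤ Real.exp (-l * t) * (M / (c - l) * Real.exp (-(c - l) * t)) := by gcongr
    _ = _ := by ring

end ODE

namespace Sm

variable {n : ℕ}

/-- The space-time point with given positive time. -/
def pt (t : ℝ) (ht : 0 < t) (x : EuclideanSpace ℝ (Fin n)) : SpaceTime n := ⟨(t, x), ht⟩

@[simp] theorem pt_time {t : ℝ} (ht : 0 < t) (x : EuclideanSpace ℝ (Fin n)) :
    (pt t ht x).1.1 = t := rfl

@[simp] theorem pt_space {t : ℝ} (ht : 0 < t) (x : EuclideanSpace ℝ (Fin n)) :
    (pt t ht x).1.2 = x := rfl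

theorem toFun_eq_ev {t : ℝ} (ht : 0 < t) (f : Sm n) (x : EuclideanSpace ℝ (Fin n)) :
    toFun f (t, x) = ev (pt t ht x) f := toFun_apply f (pt t ht x)

theorem hasDerivAt_time (f : Sm n) {t : ℝ} (ht : 0 < t) (x : EuclideanSpace ℝ (Fin n)) :
    HasDerivAt (fun s : ℝ => toFun f (s, x)) (toFun (dt f) (t, x)) t := by
  have h1 := hasDerivAt_line f (0, x) (1, 0) t (by simpa using ht)
  simpa [dt] using h1

theorem hasDerivAt_ray (f : Sm n) {t : ℝ} (ht : 0 < t) (y x : EuclideanSpace ℝ (Fin n)) (s : ℝ) :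
    HasDerivAt (fun s : ℝ => toFun f (t, y + s • x)) (toFun (dir (0, x) f) (t, y + s • x)) s := by
  have h1 := hasDerivAt_line f (t, y) (0, x) s (by simpa using ht)
  simpa using h1

theorem eq_sum_stdBasis (x : EuclideanSpace ℝ (Fin n)) : x = ∑ i, x i • stdBasis n i := by
  ext j
  simp [stdBasis, Finset.sum_apply, Pi.single_apply]

theorem ev_dir_space (f : Sm n) (x : EuclideanSpace ℝ (Fin n)) (z : SpaceTime n) :
    ev z (dir (0, x) f) = ∑ i, x i * ev z (dx i f) := by
  have h1 : ((0, x) : ℝ × EuclideanSpace ℝ (Fin n)) = ∑ i, x i • (0, stdBasis n i) := by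
    refine Prod.ext ?_ ?_
    · simp [Prod.fst_sum]
    · simpa [Prod.snd_sum] using eq_sum_stdBasis x
  rw [ev_dir, h1, map_sum]
  simp only [map_smul, smul_eq_mul]
  rfl

theorem dir_space (f : Sm n) (x : EuclideanSpace ℝ (Fin n)) :
    dir (0, x) f = ∑ i, algebraMap ℝ (Sm n) (x i) * dx i f :=
  ext_ev fun z => by rw [ev_dir_space]; simp

theorem abs_coord_le_norm (x : EuclideanSpace ℝ (Fin n)) (i : Fin n) : |x i| ≤ ‖x‖ := by
  simpa using PiLp.norm_apply_le x i

theorem abs_dir_dir_le (h : Sm n) (x : EuclideanSpace ℝ (Fin n)) (z : SpaceTime n) :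
    |ev z (dir (0, x) (dir (0, x) h))| ≤ n ^ 2 * size2 h z * ‖x‖ ^ 2 := by
  rw [ev_dir_space, dir_space]
  have h1 : ∀ i, |x i * ev z (dx i (∑ j, algebraMap ℝ (Sm n) (x j) * dx j h))| ≤
      ‖x‖ * (n * (‖x‖ * size2 h z)) := by
    intro i
    refine abs_mul_le_mul (abs_coord_le_norm x i) ?_
    have h2 : ev z (dx i (∑ j, algebraMap ℝ (Sm n) (x j) * dx j h)) =
        ∑ j, x j * ev z (dx i (dx j h)) := by simp
    rw [h2]
    exact abs_sum_fin_le fun j => abs_mul_le_mul (abs_coord_le_norm x j) (abs_ddx_le h z j i)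
  refine (abs_sum_fin_le h1).trans (le_of_eq (by ring))

theorem abs_dx_sub_le {h : Sm n} {t M : ℝ} (ht : 0 < t)
    (hM : ∀ z : SpaceTime n, z.1.1 = t → size2 h z ≤ M) (x : EuclideanSpace ℝ (Fin n)) (i : Fin n) :
    |toFun (dx i h) (t, x) - toFun (dx i h) (t, 0)| ≤ n * M * ‖x‖ := by
  have h1 := norm_image_sub_le_of_norm_deriv_le_segment_01'
    (f := fun s : ℝ => toFun (dx i h) (t, 0 + s • x))
    (f' := fun s => toFun (dir (0, x) (dx i h)) (t, 0 + s • x)) (C := n * M * ‖x‖)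
    (fun s _ => (hasDerivAt_ray (dx i h) ht 0 x s).hasDerivWithinAt) (fun s _ => by
      rw [toFun_eq_ev ht, ev_dir_space, Real.norm_eq_abs]
      refine (abs_sum_fin_le fun j => abs_mul_le_mul (abs_coord_le_norm x j)
        ((abs_ddx_le h _ i j).trans (hM _ rfl))).trans (le_of_eq (by ring)))
  simpa using h1

theorem abs_taylor_le {h : Sm n} {t M : ℝ} (ht : 0 < t)
    (hM : ∀ z : SpaceTime n, z.1.1 = t → size2 h z ≤ M) (y x : EuclideanSpace ℝ (Fin n)) :
    |toFun h (t, y + x) - toFun h (t, y) - ∑ i, x i * toFun (dx i h) (t, y)| ≤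
      n ^ 2 * M * ‖x‖ ^ 2 := by
  have hM0 : 0 ≤ M := (size2_nonneg h _).trans (hM (pt t ht 0) rfl)
  have hb : ∀ s : ℝ, |toFun (dir (0, x) (dir (0, x) h)) (t, y + s • x)| ≤ n ^ 2 * M * ‖x‖ ^ 2 := by
    intro s
    rw [toFun_eq_ev ht]
    refine (abs_dir_dir_le h x _).trans ?_
    have := hM (pt t ht (y + s • x)) rfl
    gcongr
  have h1 : ∀ s ∈ Set.Icc (0 : ℝ) 1, |toFun (dir (0, x) h) (t, y + s • x) -
      toFun (dir (0, x) h) (t, y)| ≤ n ^ 2 * M * ‖x‖ ^ 2 * s := by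
    intro s hs
    have := norm_image_sub_le_of_norm_deriv_le_segment'
      (f := fun s : ℝ => toFun (dir (0, x) h) (t, y + s • x)) (a := 0) (b := 1)
      (C := n ^ 2 * M * ‖x‖ ^ 2)
      (fun s _ => (hasDerivAt_ray (dir (0, x) h) ht y x s).hasDerivWithinAt)
      (fun s _ => hb s) s hs
    simpa using this
  have h2 := norm_image_sub_le_of_norm_deriv_le_segment_01'
    (f := fun s : ℝ => toFun h (t, y + s • x) - s * toFun (dir (0, x) h) (t, y))
    (C := n ^ 2 * M * ‖x‖ ^ 2)
    (fun s _ => ((hasDerivAt_ray h ht y x s).sub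
      ((hasDerivAt_id s).mul_const _)).hasDerivWithinAt) (fun s hs => by
      rw [Real.norm_eq_abs, one_mul]
      refine (h1 s ⟨hs.1, hs.2.le⟩).trans (mul_le_of_le_one_right (by positivity) hs.2.le))
  have h3 : toFun (dir (0, x) h) (t, y) = ∑ i, x i * toFun (dx i h) (t, y) := by
    rw [toFun_eq_ev ht, ev_dir_space]
    simp only [toFun_eq_ev ht]
  rw [← h3]
  simp only [one_smul, one_mul, zero_smul, add_zero, zero_mul, sub_zero, Real.norm_eq_abs] at h2
  rwa [sub_right_comm] at h2

theorem size1_sq_le_of_dx {h : Sm n} {z : SpaceTime n} {b : ℝ} (hb : ∀ i, |ev z (dx i h)| ≤ b) :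
    |∑ k, ev z (dx k h) ^ 2| ≤ n * b ^ 2 :=
  abs_sum_fin_le fun i => by
    rw [abs_pow]; exact pow_le_pow_left₀ (abs_nonneg _) (hb i) 2

section Origin

variable {q B : ℝ} {h : Sm n} {z : SpaceTime n}

theorem abs_dt_origin_le (hq : 0 ≤ q) (hB : 0 < B) (hh : IsFlow q B h) (hz : z.1.2 = 0) {M b : ℝ}
    (ha : |ev z h| ≤ 1) (hM : size2 h z ≤ M) (hb : ∀ i, |ev z (dx i h)| ≤ b) :
    |ev z (dt h)| ≤ (B + 1) * (n * M) + q * (n * b ^ 2) := by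
  have h1 : ev z (dt h) = (B + ev z h) * ev z (lapD dx h) - q * ∑ k, ev z (dx k h) ^ 2 := by
    have := congrArg (ev z) hh
    simpa [ev_statP, hz] using this
  have h2 : |ev z (lapD dx h)| ≤ n * M :=
    (abs_lapD_le h z).trans (by gcongr)
  have h3 : |B + ev z h| ≤ B + 1 := by rw [abs_le] at *; constructor <;> linarith
  have h4 := abs_mul_le_mul h3 h2
  have h5 := abs_mul_le_mul (abs_of_nonneg hq).le (size1_sq_le_of_dx hb)
  rw [h1]
  exact (abs_sub _ _).trans (add_le_add h4 h5)

theorem abs_dt_dx_origin_le (hq : 0 ≤ q) (hB : 0 < B) (hh : IsFlow q B h) (hz : z.1.2 = 0)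
    {M G : ℝ} (ha : |ev z h| ≤ 1) (hM : size2 h z ≤ M) (hG : ∀ i, |ev z (gradLap h i)| ≤ G)
    (hb : ∀ i, |ev z (dx i h)| ≤ 1) (i : Fin n) :
    |ev z (dt (dx i h)) + 2 * q * ev z (dx i h)| ≤ (B + 1) * G + n * M + n * (2 * q * M) := by
  have h1 := congrArg (ev z) (hh.pressureFlow.parOp_dh i)
  have h2 : ev z (dt (dx i h)) + 2 * q * ev z (dx i h) = (B + ev z h) * ev z (gradLap h i) +
      ev z (dx i h) * ev z (lapD dx h) - ∑ k, 2 * q * ev z (dx k h) * ev z (dx k (dx i h)) := by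
    rw [parOp, lapD_deriv dx_comm] at h1
    simp only [map_add, map_sub, map_mul, map_sum, drift, ev_two, ev_X, hz, ev_statP,
      ev_algebraMap] at h1
    simp only [PiLp.zero_apply, ne_eq, OfNat.ofNat_ne_zero, not_false_eq_true, zero_pow,
      Finset.sum_const_zero, add_zero, zero_add, mul_zero] at h1
    simp only [gradLap]
    linarith
  have h3 : |ev z (lapD dx h)| ≤ n * M := (abs_lapD_le h z).trans (by gcongr)
  have h4 : |B + ev z h| ≤ B + 1 := by rw [abs_le] at *; constructor <;> linarith
  have h5 := abs_mul_le_mul h4 (hG i)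
  have h6 := abs_mul_le_mul (hb i) h3
  have h7 : |∑ k, 2 * q * ev z (dx k h) * ev z (dx k (dx i h))| ≤ n * (2 * q * M) :=
    abs_sum_fin_le fun k => by
      have e1 := abs_mul_le_mul (abs_mul_le_mul (abs_of_nonneg (by linarith : 0 ≤ 2 * q)).le (hb k))
        ((abs_ddx_le h z i k).trans hM)
      linarith
  rw [h2]
  refine (abs_sub _ _).trans ?_
  have := abs_add_le ((B + ev z h) * ev z (gradLap h i)) (ev z (dx i h) * ev z (lapD dx h))
  linarith

end Origin

end Sm

theorem exists_mul_exp_le {c δ : ℝ} (hc : 0 < c) (hδ : 0 < δ) (M : ℝ) :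
    ∃ T : ℝ, 0 < T ∧ ∀ t, T ≤ t → M * Real.exp (-c * t) ≤ δ := by
  have h1 : Tendsto (fun t : ℝ => M * Real.exp (-c * t)) atTop (𝓝 (M * 0)) :=
    (Real.tendsto_exp_atBot.comp (tendsto_id.const_mul_atTop_of_neg (neg_neg_of_pos hc))).const_mul M
  rw [mul_zero] at h1
  obtain ⟨T, hT⟩ := eventually_atTop.1 (h1.eventually_le_const hδ)
  exact ⟨max T 1, by positivity, fun t ht => hT t ((le_max_left _ _).trans ht)⟩

theorem exp_neg_mul_le {a b t : ℝ} (hab : a ≤ b) (ht : 0 ≤ t) :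
    Real.exp (-b * t) ≤ Real.exp (-a * t) :=
  Real.exp_le_exp.2 (by nlinarith)

namespace Sm

variable {n : ℕ}

/-- The second derivatives and the weighted gradient of the Laplacian decay exponentially. -/
def HessDecay (B : ℝ) (h : Sm n) (T c M : ℝ) : Prop :=
  ∀ z : SpaceTime n, T ≤ z.1.1 → size2 h z ≤ M * Real.exp (-c * z.1.1) ∧
    ∀ i, √(ev z (statP n B)) * |ev z (gradLap h i)| ≤ M * Real.exp (-c * z.1.1)

/-- At the origin, the deviation tends to zero and its gradient is bounded. -/
structure OriginSmall (h : Sm n) (T : ℝ) : Prop where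
  pos : 0 < T
  zero : ∀ t, T ≤ t → |toFun h (t, 0)| ≤ 1
  one : ∀ t, T ≤ t → ∀ i, |toFun (dx i h) (t, 0)| ≤ 1
  tendsto : Tendsto (fun t => toFun h (t, 0)) atTop (𝓝 0)

variable {q B : ℝ} {h : Sm n}

theorem exists_origin_decay (hq : 0 ≤ q) (hB : 0 < B) (hh : IsFlow q B h) {T c c' M : ℝ}
    (hM : 0 ≤ M) (hO : OriginSmall h T) (hH : HessDecay B h T c M) (hc : 0 < c) (hc'q : c' < 2 * q)
    (hc'c : c' ≤ c) (hcc' : c ≤ 2 * c') : ∃ C : ℝ, 0 ≤ C ∧ ∀ t, T ≤ t →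
      |toFun h (t, 0)| ≤ C * Real.exp (-c * t) ∧
      ∀ i, |toFun (dx i h) (t, 0)| ≤ C * Real.exp (-c' * t) ∧
        |toFun (dt (dx i h)) (t, 0) + 2 * q * toFun (dx i h) (t, 0)| ≤ C * Real.exp (-c * t) := by
  have hT := hO.pos
  set C₁ : ℝ := (B + 1) * (M / √B) + n * M + n * (2 * q * M) with hC₁
  have hC₁0 : 0 ≤ C₁ := by positivity
  have hode : ∀ i, ∀ t, T ≤ t → |toFun (dt (dx i h)) (t, 0) + 2 * q * toFun (dx i h) (t, 0)| ≤
      C₁ * Real.exp (-c * t) := by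
    intro i t ht
    have ht0 := hT.trans_le ht
    have hz := hH (pt t ht0 0) ht
    have h1 : ∀ i, |ev (pt t ht0 0) (gradLap h i)| ≤ M / √B * Real.exp (-c * t) := by
      intro i
      have e1 := hz.2 i
      rw [ev_statP_eq_norm] at e1
      simp only [pt_space, norm_zero, pt_time] at e1
      rw [div_mul_eq_mul_div, le_div_iff₀ (Real.sqrt_pos.2 hB), mul_comm]
      simpa using e1
    have h2 := abs_dt_dx_origin_le hq hB hh (z := pt t ht0 0) rfl
      (by rw [← toFun_eq_ev]; exact hO.zero t ht) hz.1 h1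
      (fun i => by rw [← toFun_eq_ev]; exact hO.one t ht i) i
    simp only [← toFun_eq_ev, pt_time] at h2
    refine h2.trans (le_of_eq ?_)
    simp only [hC₁]; ring
  have hb : ∀ i, ∃ C : ℝ, 0 ≤ C ∧ ∀ t, T ≤ t → |toFun (dx i h) (t, 0)| ≤ C * Real.exp (-c' * t) := by
    intro i
    refine exists_abs_le_exp_of_damped hT.le hC₁0 hc'q
      (fun t ht => hasDerivAt_time (dx i h) (hT.trans_le ht) 0) fun t ht => ?_
    refine (hode i t ht).trans ?_
    have := exp_neg_mul_le hc'c (hT.le.trans ht)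
    gcongr
  choose Cb hCb0 hCb using hb
  set b : ℝ := ∑ i, Cb i with hbdef
  have hb0 : 0 ≤ b := Finset.sum_nonneg fun i _ => hCb0 i
  have hbb : ∀ i t, T ≤ t → |toFun (dx i h) (t, 0)| ≤ b * Real.exp (-c' * t) := fun i t ht =>
    (hCb i t ht).trans (mul_le_mul_of_nonneg_right
      (Finset.single_le_sum (fun i _ => hCb0 i) (Finset.mem_univ i)) (Real.exp_pos _).le)
  set C₂ : ℝ := (B + 1) * (n * M) + q * (n * b ^ 2) with hC₂
  have ha : ∀ t, T ≤ t → |toFun (dt h) (t, 0)| ≤ C₂ * Real.exp (-c * t) := by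
    intro t ht
    have ht0 := hT.trans_le ht
    have h2 := abs_dt_origin_le hq hB hh (z := pt t ht0 0) rfl
      (by rw [← toFun_eq_ev]; exact hO.zero t ht) (hH (pt t ht0 0) ht).1
      (fun i => by rw [← toFun_eq_ev]; exact hbb i t ht)
    simp only [← toFun_eq_ev, pt_time] at h2
    refine h2.trans ?_
    have h3 : Real.exp (-c' * t) ^ 2 ≤ Real.exp (-c * t) := by
      rw [← Real.exp_nat_mul]
      refine Real.exp_le_exp.2 ?_
      have := mul_le_mul_of_nonneg_right hcc' ht0.le
      push_cast; linarith
    have h4 : q * (n * (b * Real.exp (-c' * t)) ^ 2) ≤ q * (n * b ^ 2) * Real.exp (-c * t) := by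
      rw [mul_pow]
      calc _ = q * (n * b ^ 2) * Real.exp (-c' * t) ^ 2 := by ring
        _ ≤ _ := by gcongr
    simp only [hC₂]
    linarith
  have ha' := abs_le_exp_of_deriv_le_of_tendsto hc
    (fun t ht => hasDerivAt_time h (hT.trans_le ht) 0) ha hO.tendsto
  refine ⟨C₁ + b + C₂ / c, by positivity, fun t ht => ?_⟩
  have e1 := Real.exp_pos (-c * t)
  have e2 := Real.exp_pos (-c' * t)
  refine ⟨(ha' t ht).trans ?_, fun i => ⟨(hbb i t ht).trans ?_, (hode i t ht).trans ?_⟩⟩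
  · exact mul_le_mul_of_nonneg_right (by linarith) e1.le
  · refine mul_le_mul_of_nonneg_right ?_ e2.le
    have : 0 ≤ C₂ / c := by positivity
    linarith
  · refine mul_le_mul_of_nonneg_right ?_ e1.le
    have : 0 ≤ C₂ / c := by positivity
    linarith

theorem norm_le_statP {B : ℝ} (hB : 0 < B) (z : SpaceTime n) :
    ‖z.1.2‖ ≤ (1 + 1 / B) * ev z (statP n B) := by
  rw [ev_statP_eq_norm]
  have h1 : 0 ≤ 1 / B * ‖z.1.2‖ ^ 2 := by positivity
  have h2 : 1 / B * B = 1 := by field_simp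
  nlinarith [sq_nonneg (‖z.1.2‖ - 1), norm_nonneg z.1.2]

theorem one_le_statP {B : ℝ} (hB : 0 < B) (z : SpaceTime n) :
    1 ≤ 1 / B * ev z (statP n B) := by
  rw [ev_statP_eq_norm]
  have h1 : 0 ≤ 1 / B * ‖z.1.2‖ ^ 2 := by positivity
  have h2 : 1 / B * B = 1 := by field_simp
  linarith

/-- Exponential decay relative to the stationary pressure. -/
theorem exists_flow_decay (hq : 0 ≤ q) (hB : 0 < B) (hh : IsFlow q B h) {T c c' M : ℝ}
    (hM : 0 ≤ M) (hO : OriginSmall h T) (hH : HessDecay B h T c M) (hc : 0 < c) (hc'q : c' < 2 * q)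
    (hc'c : c' ≤ c) (hcc' : c ≤ 2 * c') : ∃ C : ℝ, 0 ≤ C ∧ ∀ z : SpaceTime n, T ≤ z.1.1 →
      |ev z h| ≤ C * Real.exp (-c' * z.1.1) * ev z (statP n B) := by
  obtain ⟨C, hC, H⟩ := exists_origin_decay hq hB hh hM hO hH hc hc'q hc'c hcc'
  refine ⟨C * (1 / B) + n * (C * (1 + 1 / B)) + n ^ 2 * M, by positivity, fun z hz => ?_⟩
  obtain ⟨⟨t, x⟩, ht⟩ := z
  simp only at hz ht ⊢
  have h1 := abs_taylor_le (h := h) (M := M * Real.exp (-c * t)) ht (fun z hz' => by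
    have := (hH z (by rw [hz']; exact hz)).1
    rwa [hz'] at this) 0 x
  set w := ev (⟨(t, x), ht⟩ : SpaceTime n) (statP n B) with hw
  have hw0 : 0 < w := statP_pos hB _
  have hxw : ‖x‖ ^ 2 ≤ w := by rw [hw, ev_statP_eq_norm]; simp only; linarith
  have hx1 : ‖x‖ ≤ (1 + 1 / B) * w := norm_le_statP hB (⟨(t, x), ht⟩ : SpaceTime n)
  have h1w : 1 ≤ 1 / B * w := one_le_statP hB _
  have hE : Real.exp (-c * t) ≤ Real.exp (-c' * t) := exp_neg_mul_le hc'c ht.le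
  set E := Real.exp (-c' * t) with hEd
  have hE0 : 0 < E := Real.exp_pos _
  have h2 : |toFun h (t, 0)| ≤ C * E * (1 / B * w) := by
    refine ((H t hz).1.trans (mul_le_mul_of_nonneg_left hE hC)).trans ?_
    exact le_mul_of_one_le_right (by positivity) h1w
  have h3 : |∑ i, x i * toFun (dx i h) (t, 0)| ≤ n * ((1 + 1 / B) * w * (C * E)) :=
    abs_sum_fin_le fun i => abs_mul_le_mul ((abs_coord_le_norm x i).trans hx1) ((H t hz).2 i).1
  have h4 : n ^ 2 * (M * Real.exp (-c * t)) * ‖x‖ ^ 2 ≤ n ^ 2 * (M * E) * w := by gcongr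
  have h5 : ev (⟨(t, x), ht⟩ : SpaceTime n) h = toFun h (t, 0 + x) := by
    rw [zero_add]; exact (toFun_eq_ev ht h x).symm
  rw [h5]
  have h6 := h1.trans h4
  rw [abs_le] at *
  constructor <;> linarith

end Sm

namespace Sm

variable {n : ℕ} {q B : ℝ}

theorem exists_smallAt (hq : 0 ≤ q) (hB : 0 < B) (n : ℕ) : ∃ C δ₁ : ℝ, 1 ≤ C ∧ 0 < δ₁ ∧
    ∀ h : Sm n, IsFlow q B h → ∀ (T : ℝ) (δ : ℝ → ℝ), 0 < T → Antitone δ →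
      (∀ t, T ≤ t → 0 < δ t ∧ δ t ≤ δ₁) →
      (∀ z : SpaceTime n, T ≤ z.1.1 → |ev z h| ≤ δ z.1.1 * ev z (statP n B)) →
      ∀ z : SpaceTime n, T + 3 ≤ z.1.1 → SmallAt B h z (C * δ (z.1.1 - 3)) := by
  obtain ⟨C, δ₁, hC, hδ₁, H⟩ := exists_regularity hq hB n
  refine ⟨C, δ₁, hC, hδ₁, fun h hh T δ hT hanti hδ hsm z hz => ?_⟩
  have ht : T ≤ z.1.1 - 3 := by linarith
  have h0 := hδ _ ht
  have h1 := H h hh (z.1.1 - 3) (hT.trans_le ht) _ h0.1 h0.2 (fun y hy _ =>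
    (hsm y (ht.trans hy)).trans (mul_le_mul_of_nonneg_right (hanti hy) (statP_pos hB y).le))
    z (by ring)
  refine ⟨?_, h1.1, h1.2.1, h1.2.2⟩
  refine (hsm z (by linarith)).trans (mul_le_mul_of_nonneg_right ?_ (statP_pos hB z).le)
  have h2 : δ z.1.1 ≤ δ (z.1.1 - 3) := hanti (by linarith)
  exact h2.trans (le_mul_of_one_le_left h0.1.le hC)

theorem hessDecay_of_le (hB : 0 < B) {h : Sm n} {K C Y T c : ℝ} (hK : 0 ≤ K) (hC : 1 ≤ C)
    (hY : 0 ≤ Y) (H : ∀ z : SpaceTime n, T ≤ z.1.1 →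
      ev z (lapForm K B h) ≤ Y * Real.exp (-(2 * c) * z.1.1) ∧
      size2 h z ^ 2 ≤ C * (Y * Real.exp (-(2 * c) * z.1.1))) :
    HessDecay B h T c √(C * Y) := by
  intro z hz
  have hE : Real.exp (-(2 * c) * z.1.1) = Real.exp (-c * z.1.1) ^ 2 := by
    rw [← Real.exp_nat_mul]; push_cast; ring_nf
  have hsq : (√(C * Y) * Real.exp (-c * z.1.1)) ^ 2 = C * (Y * Real.exp (-(2 * c) * z.1.1)) := by
    rw [mul_pow, Real.sq_sqrt (by positivity), hE]; ring
  have h0 : 0 ≤ √(C * Y) * Real.exp (-c * z.1.1) := by positivity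
  have hH := H z hz
  have hw := (statP_pos hB z).le
  refine ⟨le_of_abs_le (abs_le_of_sq_le_sq (by rw [hsq]; exact hH.2) h0),
    fun i => le_of_abs_le (abs_le_of_sq_le_sq ?_ h0)⟩
  rw [hsq, mul_pow, sq_abs, Real.sq_sqrt hw]
  have h1 : Y * Real.exp (-(2 * c) * z.1.1) ≤ C * (Y * Real.exp (-(2 * c) * z.1.1)) :=
    le_mul_of_one_le_left (by positivity) hC
  have h2 := Finset.single_le_sum (f := fun i => ev z (gradLap h i) ^ 2)
    (fun i _ => sq_nonneg _) (Finset.mem_univ i)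
  have h3 := hH.1
  rw [ev_lapForm, ev_sqSum] at h3
  have h4 := mul_le_mul_of_nonneg_left h2 hw
  have h5 : 0 ≤ K * ev z (lapD dx h) ^ 2 := by positivity
  linarith

theorem originSmall_of_smallAt (hB : 0 < B) {h : Sm n} {T ε : ℝ} (hT : 0 < T)
    (hsmall : ∀ δ : ℝ, 0 < δ → ∃ T : ℝ, 0 < T ∧
      ∀ z : SpaceTime n, T ≤ z.1.1 → |ev z h| ≤ δ * ev z (statP n B))
    (hε : ε * B ≤ 1) (hε' : ε * √B ≤ 1)
    (hS : ∀ z : SpaceTime n, T ≤ z.1.1 → SmallAt B h z ε) : OriginSmall h T := by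
  have hw : ∀ {t : ℝ} (ht : 0 < t), ev (pt t ht (0 : EuclideanSpace ℝ (Fin n))) (statP n B) = B :=
    fun ht => by rw [ev_statP_eq_norm]; simp
  refine ⟨hT, fun t ht => ?_, fun t ht i => ?_, ?_⟩
  · rw [toFun_eq_ev (hT.trans_le ht)]
    have := (hS (pt t (hT.trans_le ht) 0) ht).zero
    rw [hw] at this
    exact this.trans hε
  · rw [toFun_eq_ev (hT.trans_le ht)]
    have := (hS (pt t (hT.trans_le ht) 0) ht).one
    rw [hw] at this
    exact (abs_dx_le h _ i).trans (this.trans hε')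
  · rw [Metric.tendsto_atTop]
    intro η hη
    obtain ⟨T', hT', H⟩ := hsmall (η / (2 * B)) (by positivity)
    refine ⟨T', fun t ht => ?_⟩
    have h1 := H (pt t (hT'.trans_le ht) 0) ht
    rw [hw] at h1
    rw [Real.dist_eq, sub_zero, toFun_eq_ev (hT'.trans_le ht)]
    refine h1.trans_lt ?_
    have : η / (2 * B) * B = η / 2 := by field_simp
    rw [this]; linarith

theorem exists_hessDecay {p : ℝ} (hn : 1 ≤ n) (hp : 0 < p) (hpq : 2 * q = p + n) (hB : 0 < B)
    {h : Sm n} (hh : IsFlow q B h)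
    (hsmall : ∀ δ : ℝ, 0 < δ → ∃ T : ℝ, 0 < T ∧
      ∀ z : SpaceTime n, T ≤ z.1.1 → |ev z h| ≤ δ * ev z (statP n B)) :
    ∃ T M : ℝ, 0 ≤ M ∧ OriginSmall h T ∧ HessDecay B h T (2 * p) M := by
  have hn1 : (1 : ℝ) ≤ n := by exact_mod_cast hn
  have hq : 0 < q := by linarith
  obtain ⟨C₀, δ₁, hC₀, hδ₁, HS⟩ := exists_smallAt hq.le hB n
  obtain ⟨K, C, ε₀, hK, hC, hε₀, -, HP⟩ := exists_pair_comparison (n := n) hn hp hpq hB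
  have hCp : 0 < C := by linarith
  have hC₀p : 0 < C₀ := by linarith
  have hKp : 0 < K := by linarith
  -- a uniform bound first
  obtain ⟨ε, hε, hεε₀, hεp, hεB, hεsB, hεδ⟩ : ∃ ε : ℝ, 0 < ε ∧ ε ≤ ε₀ ∧ C * ε ≤ p ∧ ε * B ≤ 1 ∧
      ε * √B ≤ 1 ∧ ε ≤ δ₁ := by
    have hsB := Real.sqrt_pos.2 hB
    refine ⟨min ε₀ (min (p / C) (min (1 / B) (min (1 / √B) δ₁))), by positivity,
      min_le_left _ _, ?_, ?_, ?_, ?_⟩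
    · rw [mul_comm, ← le_div_iff₀ hCp]
      exact (min_le_right _ _).trans (min_le_left _ _)
    · rw [← le_div_iff₀ hB]
      exact (min_le_right _ _).trans ((min_le_right _ _).trans (min_le_left _ _))
    · rw [← le_div_iff₀ hsB]
      exact (min_le_right _ _).trans ((min_le_right _ _).trans ((min_le_right _ _).trans
        (min_le_left _ _)))
    · exact (min_le_right _ _).trans ((min_le_right _ _).trans ((min_le_right _ _).trans
        (min_le_right _ _)))
  have hεC₀ : ε / C₀ ≤ δ₁ := (div_le_self hε.le hC₀).trans hεδ
  obtain ⟨T₀, hT₀, H₀⟩ := hsmall (ε / C₀) (by positivity)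
  have hS₁ : ∀ z : SpaceTime n, T₀ + 3 ≤ z.1.1 → SmallAt B h z ε := by
    intro z hz
    have := HS h hh T₀ (fun _ => ε / C₀) hT₀ antitone_const (fun _ _ => ⟨by positivity, hεC₀⟩) H₀ z hz
    rwa [mul_div_cancel₀ _ hC₀p.ne'] at this
  have hT₁ : 0 < T₀ + 3 := by linarith
  have hO₁ := originSmall_of_smallAt hB hT₁ hsmall hεB hεsB hS₁
  set L₀ : ℝ := K * n ^ 2 + n ^ 3 + 1 with hL₀
  have hL₀0 : 0 < L₀ := by positivity
  have hinit : ∀ {z : SpaceTime n} {ε : ℝ}, 0 ≤ ε → SmallAt B h z ε →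
      ev z (lapForm K B h) ≤ L₀ * ε ^ 2 ∧ size2 h z ^ 2 ≤ L₀ * ε ^ 2 := by
    intro z ε hε hs
    have h1 := lapForm_le hB hKp.le hε hs
    have h2 : size2 h z ^ 2 ≤ ε ^ 2 := pow_le_pow_left₀ (size2_nonneg _ _) hs.two 2
    have h3 : 0 ≤ (K * n ^ 2 + n ^ 3) * ε ^ 2 := by positivity
    have h4 : L₀ * ε ^ 2 = (K * n ^ 2 + n ^ 3) * ε ^ 2 + ε ^ 2 := by rw [hL₀]; ring
    have h5 := sq_nonneg ε
    rw [h4]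
    constructor <;> linarith
  -- a first exponential rate
  have hD₁ : ∃ M : ℝ, 0 ≤ M ∧ HessDecay B h (T₀ + 3) (3 * p / 2) M := by
    set Y : ℝ := L₀ * ε ^ 2 * Real.exp (3 * p * (T₀ + 3)) with hY
    have hY0 : 0 ≤ Y := by positivity
    have hy₀ : Y * Real.exp (-(3 * p) * (T₀ + 3)) = L₀ * ε ^ 2 := by
      rw [hY, mul_assoc, ← Real.exp_add]
      ring_nf
      simp
    refine ⟨√(C * Y), Real.sqrt_nonneg _, hessDecay_of_le hB hKp.le hC hY0 fun z hz => ?_⟩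
    have h1 := HP h hh (fun _ => ε) (fun t => Y * Real.exp (-(3 * p) * t)) (T₀ + 3) hT₁
      (fun _ _ => ⟨hε.le, hεε₀⟩) hS₁ (contDiff_mul_exp _ _) (fun _ _ => by positivity)
      (fun t _ => by
        rw [deriv_mul_exp]
        refine mul_le_mul_of_nonneg_right ?_ (by positivity)
        linarith)
      (fun y hy => by
        simp only [hy₀]
        exact hinit hε.le (hS₁ y hy.ge)) z hz
    have h2 : 2 * (3 * p / 2) = 3 * p := by ring
    rw [h2]
    exact h1
  obtain ⟨M₁, hM₁, hD₁⟩ := hD₁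
  set c : ℝ := min (3 * p / 2) q with hc
  have hc0 : 0 < c := by positivity
  have hcp : c ≤ 3 * p / 2 := min_le_left _ _
  have hcq : c ≤ q := min_le_right _ _
  have hD₁' : HessDecay B h (T₀ + 3) c M₁ := fun z hz => by
    have h1 := hD₁ z hz
    have h2 : M₁ * Real.exp (-(3 * p / 2) * z.1.1) ≤ M₁ * Real.exp (-c * z.1.1) :=
      mul_le_mul_of_nonneg_left (exp_neg_mul_le hcp z.2.le) hM₁
    exact ⟨h1.1.trans h2, fun i => (h1.2 i).trans h2⟩
  obtain ⟨C₂, hC₂, H₂⟩ := exists_flow_decay hq.le hB hh hM₁ hO₁ hD₁' hc0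
    (by linarith) le_rfl (by linarith)
  -- the improved smallness
  set D : ℝ := C₂ + 1 with hD
  have hD0 : 0 < D := by positivity
  obtain ⟨T₂, hT₂, HT₂⟩ := exists_mul_exp_le hc0 hδ₁ D
  set E : ℝ := C₀ * D * Real.exp (3 * c) with hE
  have hE0 : 0 < E := by positivity
  obtain ⟨T₃, hT₃, HT₃⟩ := exists_mul_exp_le hc0 hε₀ E
  set T₄ : ℝ := max (T₀ + 3) T₂ with hT₄
  have hT₄0 : 0 < T₄ := by positivity
  set t₀ : ℝ := max (T₄ + 3) T₃ with ht₀
  have ht₀0 : 0 < t₀ := by positivity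
  have hT₄t : T₄ + 3 ≤ t₀ := le_max_left _ _
  have hS₂ : ∀ z : SpaceTime n, t₀ ≤ z.1.1 → SmallAt B h z (E * Real.exp (-c * z.1.1)) := by
    intro z hz
    have h1 := HS h hh T₄ (fun t => D * Real.exp (-c * t)) hT₄0
      (fun a b hab => by
        refine mul_le_mul_of_nonneg_left (Real.exp_le_exp.2 ?_) hD0.le
        have := mul_le_mul_of_nonneg_left hab hc0.le
        linarith)
      (fun t ht => ⟨by positivity, HT₂ t ((le_max_right _ _).trans ht)⟩)
      (fun z hz => (H₂ z ((le_max_left _ _).trans hz)).trans (by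
        refine mul_le_mul_of_nonneg_right (mul_le_mul_of_nonneg_right ?_ (Real.exp_pos _).le)
          (statP_pos hB z).le
        linarith)) z (hT₄t.trans hz)
    have h2 : C₀ * (D * Real.exp (-c * (z.1.1 - 3))) = E * Real.exp (-c * z.1.1) := by
      have : Real.exp (-c * (z.1.1 - 3)) = Real.exp (3 * c) * Real.exp (-c * z.1.1) := by
        rw [← Real.exp_add]; ring_nf
      rw [this, hE]; ring
    rwa [h2] at h1
  have hO₂ : OriginSmall h t₀ :=
    ⟨ht₀0, fun t ht => hO₁.zero t ((le_max_left _ _).trans (by linarith : T₄ ≤ t)),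
      fun t ht => hO₁.one t ((le_max_left _ _).trans (by linarith : T₄ ≤ t)), hO₁.tendsto⟩
  set L : ℝ := C * E / c with hL
  have hL0 : 0 ≤ L := by positivity
  set ε₁ : ℝ := E * Real.exp (-c * t₀) with hε₁
  have hε₁0 : 0 ≤ ε₁ := by positivity
  set Y : ℝ := L₀ * ε₁ ^ 2 * Real.exp (4 * p * t₀ + L * Real.exp (-c * t₀)) with hY
  have hY0 : 0 ≤ Y := by positivity
  set y : ℝ → ℝ := fun t => Y * Real.exp (-(4 * p) * t - L * Real.exp (-c * t)) with hy
  have hysm : ContDiff ℝ (⊤ : ℕ∞) y := by simp only [hy]; fun_prop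
  have hyd : ∀ t, deriv y t = (-(4 * p) + C * (E * Real.exp (-c * t))) * y t := by
    intro t
    have h1 : HasDerivAt (fun t => -(4 * p) * t - L * Real.exp (-c * t))
        (-(4 * p) - L * (-c * Real.exp (-c * t))) t :=
      (by simpa using (hasDerivAt_id t).const_mul (-(4 * p)) :
        HasDerivAt (fun t => -(4 * p) * t) (-(4 * p)) t).sub ((hasDerivAt_exp_mul (-c) t).const_mul L)
    have h2 : HasDerivAt y _ t := (h1.exp).const_mul Y
    rw [h2.deriv]
    have h3 : L * c = C * E := by rw [hL]; field_simp
    simp only [hy]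
    linear_combination (Y * Real.exp (-(4 * p) * t - L * Real.exp (-c * t)) *
      Real.exp (-c * t)) * h3
  have hy₀ : y t₀ = L₀ * ε₁ ^ 2 := by
    simp only [hy, hY]
    rw [mul_assoc, ← Real.exp_add]
    ring_nf
    simp
  refine ⟨t₀, √(C * Y), Real.sqrt_nonneg _, hO₂, hessDecay_of_le hB hKp.le hC hY0 fun z hz => ?_⟩
  have h1 := HP h hh (fun t => E * Real.exp (-c * t)) y t₀ ht₀0
    (fun t ht => ⟨by positivity, HT₃ t ((le_max_right _ _).trans ht)⟩) hS₂ hysm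
    (fun t _ => by simp only [hy]; positivity) (fun t _ => (hyd t).ge)
    (fun z hz => by
      rw [hy₀]
      have := hS₂ z hz.ge
      rw [hz] at this
      exact hinit hε₁0 this) z hz
  have h2 : y z.1.1 ≤ Y * Real.exp (-(2 * (2 * p)) * z.1.1) := by
    refine mul_le_mul_of_nonneg_left (Real.exp_le_exp.2 ?_) hY0
    have : 0 ≤ L * Real.exp (-c * z.1.1) := by positivity
    linarith
  exact ⟨h1.1.trans h2, h1.2.trans (mul_le_mul_of_nonneg_left h2 hCp.le)⟩

end Sm

namespace Sm

variable {n : ℕ}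

/-- A real power of a positive function. -/
def rpow (f : Sm n) (hf : ∀ z, 0 < ev z f) (s : ℝ) : Sm n :=
  mk' (fun z => toFun f z ^ s) ((Sm.contDiffOn f).rpow_const_of_ne fun z hz => by
    have := hf ⟨z, hz⟩
    rw [← toFun_apply] at this
    exact this.ne')

variable {f : Sm n} (hf : ∀ z, 0 < ev z f)

theorem ev_rpow (s : ℝ) (z : SpaceTime n) : ev z (rpow f hf s) = ev z f ^ s := by
  rw [rpow, ev_mk', toFun_apply]

theorem rpow_mul_rpow (s t : ℝ) : rpow f hf s * rpow f hf t = rpow f hf (s + t) :=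
  ext_ev fun z => by rw [map_mul, ev_rpow, ev_rpow, ev_rpow, Real.rpow_add (hf z)]

theorem rpow_one : rpow f hf 1 = f := ext_ev fun z => by rw [ev_rpow, Real.rpow_one]

theorem dir_rpow (s : ℝ) (v : ℝ × EuclideanSpace ℝ (Fin n)) :
    dir v (rpow f hf s) = algebraMap ℝ (Sm n) s * rpow f hf (s - 1) * dir v f := by
  refine ext_ev fun z => ?_
  have h0 : toFun f z.1 ≠ 0 := by rw [toFun_apply]; exact (hf z).ne'
  rw [ev_dir_of (g := fun z => toFun f z ^ s) (fun z => by rw [ev_rpow, toFun_apply]) v z,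
    ((differentiableAt f z).hasFDerivAt.rpow_const (Or.inl h0)).fderiv, map_mul, map_mul,
    ev_rpow, ev_algebraMap, ev_dir, toFun_apply]
  simp

theorem integrable_weight {B : ℝ} (hB : 0 < B) {s : ℝ} (hs : (n : ℝ) < 2 * s) :
    Integrable fun x : EuclideanSpace ℝ (Fin n) => (B + ‖x‖ ^ 2) ^ (-s) := by
  have hs0 : 0 < s := by have := n.cast_nonneg (α := ℝ); linarith
  have h1 : Integrable fun x : EuclideanSpace ℝ (Fin n) => ((1 : ℝ) + ‖x‖ ^ 2) ^ (-(2 * s) / 2) :=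
    integrable_rpow_neg_one_add_norm_sq (by simpa using hs)
  have hb : 0 < min B 1 := by positivity
  refine (h1.const_mul ((min B 1) ^ (-s))).mono' ?_ (ae_of_all _ fun x => ?_)
  · refine Continuous.aestronglyMeasurable ?_
    refine Continuous.rpow_const (by fun_prop) fun x => Or.inl ?_
    positivity
  · have e1 : 0 < B + ‖x‖ ^ 2 := by positivity
    have e2 : min B 1 * (1 + ‖x‖ ^ 2) ≤ B + ‖x‖ ^ 2 := by
      have := mul_le_mul_of_nonneg_right (min_le_right B 1) (sq_nonneg ‖x‖)
      have := min_le_left B 1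
      linarith
    have e3 : -(2 * s) / 2 = -s := by ring
    rw [Real.norm_eq_abs, abs_of_pos (Real.rpow_pos_of_pos e1 _), e3,
      ← Real.mul_rpow hb.le (by positivity)]
    calc (B + ‖x‖ ^ 2) ^ (-s) ≤ (min B 1 * (1 + ‖x‖ ^ 2)) ^ (-s) :=
          Real.rpow_le_rpow_of_nonpos (by positivity) e2 (by linarith)

section Weight

variable {B : ℝ} (hB : 0 < B)

/-- Real powers of the stationary pressure. -/
def statPow (n : ℕ) {B : ℝ} (hB : 0 < B) (s : ℝ) : Sm n := rpow (statP n B) (statP_pos hB) s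

theorem ev_statPow (s : ℝ) (z : SpaceTime n) :
    ev z (statPow n hB s) = ev z (statP n B) ^ s := ev_rpow _ _ _

theorem statPow_pos (s : ℝ) (z : SpaceTime n) : 0 < ev z (statPow n hB s) := by
  rw [ev_statPow]; exact Real.rpow_pos_of_pos (statP_pos hB z) s

theorem statPow_mul_statPow (s t : ℝ) :
    statPow n hB s * statPow n hB t = statPow n hB (s + t) := rpow_mul_rpow _ s t

theorem statPow_one : statPow n hB 1 = statP n B := rpow_one _

theorem dx_statPow (s : ℝ) (k : Fin n) : dx k (statPow n hB s) =
    algebraMap ℝ (Sm n) (2 * s) * X k * statPow n hB (s - 1) := by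
  rw [dx, statPow, dir_rpow]
  have h1 := dx_statP (n := n) B k
  rw [dx] at h1
  rw [h1, map_mul, map_ofNat, statPow]; ring

theorem dt_statPow (s : ℝ) : dt (statPow n hB s) = 0 := by
  rw [dt, statPow, dir_rpow]
  have h1 := dt_statP (n := n) B
  rw [dt] at h1
  rw [h1, mul_zero]

theorem continuous_toFun (f : Sm n) {t : ℝ} (ht : 0 < t) : Continuous fun x => toFun f (t, x) :=
  continuous_iff_continuousAt.2 fun x =>
    ContinuousAt.comp (f := fun x : EuclideanSpace ℝ (Fin n) => (t, x)) (continuousAt f ht)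
      (by fun_prop)

theorem toFun_statPow {t : ℝ} (ht : 0 < t) (s : ℝ) (x : EuclideanSpace ℝ (Fin n)) :
    toFun (statPow n hB s) (t, x) = (B + ‖x‖ ^ 2) ^ s := by
  rw [toFun_eq_ev ht, ev_statPow, ev_statP_eq_norm]; rfl

end Weight

theorem integrable_of_abs_le {B : ℝ} (hB : 0 < B) {t : ℝ} (ht : 0 < t) {s C : ℝ}
    (hs : (n : ℝ) < 2 * s) {f : Sm n}
    (hf : ∀ z : SpaceTime n, z.1.1 = t → |ev z f| ≤ C * ev z (statP n B) ^ (-s)) :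
    Integrable fun x => toFun f (t, x) := by
  refine ((integrable_weight hB hs).const_mul C).mono'
    (continuous_toFun f ht).aestronglyMeasurable (ae_of_all _ fun x => ?_)
  have := hf (pt t ht x) rfl
  rwa [← toFun_eq_ev, ev_statP_eq_norm] at this

theorem abs_integral_le_of_abs_le {B : ℝ} (hB : 0 < B) {t : ℝ} (ht : 0 < t) {s C : ℝ}
    (hs : (n : ℝ) < 2 * s) {f : Sm n}
    (hf : ∀ z : SpaceTime n, z.1.1 = t → |ev z f| ≤ C * ev z (statP n B) ^ (-s)) :
    |∫ x, toFun f (t, x)| ≤ C * ∫ x : EuclideanSpace ℝ (Fin n), (B + ‖x‖ ^ 2) ^ (-s) := by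
  rw [← integral_const_mul, ← Real.norm_eq_abs]
  refine norm_integral_le_of_norm_le ((integrable_weight hB hs).const_mul C)
    (ae_of_all _ fun x => ?_)
  have := hf (pt t ht x) rfl
  rwa [← toFun_eq_ev, ev_statP_eq_norm] at this

theorem toFun_dx {t : ℝ} (ht : 0 < t) (f : Sm n) (k : Fin n) (x : EuclideanSpace ℝ (Fin n)) :
    DifferentiableAt ℝ (fun x => toFun f (t, x)) x ∧
      fderiv ℝ (fun x => toFun f (t, x)) x (stdBasis n k) = toFun (dx k f) (t, x) := by
  have h1 := (differentiableAt f (pt t ht x)).hasFDerivAt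
  have h2 : HasFDerivAt (fun x : EuclideanSpace ℝ (Fin n) => (t, x))
      (ContinuousLinearMap.inr ℝ ℝ (EuclideanSpace ℝ (Fin n))) x := hasFDerivAt_prodMk_right t x
  have h3 := HasFDerivAt.comp (f := fun x : EuclideanSpace ℝ (Fin n) => (t, x)) x h1 h2
  refine ⟨h3.differentiableAt, ?_⟩
  have h4 : HasFDerivAt (fun x => toFun f (t, x)) _ x := h3
  rw [h4.fderiv, dx, ev_dir_eq_toFun f _ (z := (t, x)) ht]
  simp [pt]

theorem integral_dx_mul {B : ℝ} (hB : 0 < B) {t : ℝ} (ht : 0 < t) {s C : ℝ}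
    (hs : (n : ℝ) < 2 * s) {f g : Sm n}
    (k : Fin n)
    (h1 : ∀ z : SpaceTime n, z.1.1 = t → |ev z (dx k f * g)| ≤ C * ev z (statP n B) ^ (-s))
    (h2 : ∀ z : SpaceTime n, z.1.1 = t → |ev z (f * dx k g)| ≤ C * ev z (statP n B) ^ (-s))
    (h3 : ∀ z : SpaceTime n, z.1.1 = t → |ev z (f * g)| ≤ C * ev z (statP n B) ^ (-s)) :
    ∫ x, toFun (dx k f * g) (t, x) = -∫ x, toFun (f * dx k g) (t, x) := by
  have hmul : ∀ (a b : Sm n) (x : EuclideanSpace ℝ (Fin n)),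
      toFun (a * b) (t, x) = toFun a (t, x) * toFun b (t, x) := fun a b x => by
    simp only [toFun_eq_ev ht, map_mul]
  have i1 := integrable_of_abs_le hB ht hs h1
  have i2 := integrable_of_abs_le hB ht hs h2
  have i3 := integrable_of_abs_le hB ht hs h3
  simp only [hmul] at i1 i2 i3 ⊢
  have h4 := integral_mul_fderiv_eq_neg_fderiv_mul_of_integrable (μ := volume)
    (f := fun x => toFun f (t, x)) (g := fun x => toFun g (t, x)) (v := stdBasis n k)
    (by simpa only [(toFun_dx ht _ k _).2] using i1)
    (by simpa only [(toFun_dx ht _ k _).2] using i2) i3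
    (fun x _ => (toFun_dx ht f k x).1) (fun x _ => (toFun_dx ht g k x).1)
  simp only [(toFun_dx ht _ k _).2] at h4
  rw [h4, neg_neg]

end Sm

namespace Sm

variable {n : ℕ} {B t : ℝ}

/-- At time `t`, the function `f` is bounded by a multiple of the `a`-th power of the stationary
pressure. -/
def WGrowth (B t : ℝ) (f : Sm n) (a : ℝ) : Prop :=
  ∃ C : ℝ, 0 ≤ C ∧ ∀ z : SpaceTime n, z.1.1 = t → |ev z f| ≤ C * ev z (statP n B) ^ a

namespace WGrowth

variable {f g : Sm n} {a b : ℝ}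

theorem mul (hB : 0 < B) (hf : WGrowth B t f a) (hg : WGrowth B t g b) :
    WGrowth B t (f * g) (a + b) := by
  obtain ⟨C, hC, hf⟩ := hf
  obtain ⟨D, hD, hg⟩ := hg
  refine ⟨C * D, by positivity, fun z hz => ?_⟩
  rw [map_mul, Real.rpow_add (statP_pos hB z)]
  exact (abs_mul_le_mul (hf z hz) (hg z hz)).trans_eq (by ring)

theorem add (hf : WGrowth B t f a) (hg : WGrowth B t g a) : WGrowth B t (f + g) a := by
  obtain ⟨C, hC, hf⟩ := hf
  obtain ⟨D, hD, hg⟩ := hg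
  refine ⟨C + D, by positivity, fun z hz => ?_⟩
  rw [map_add, add_mul]
  exact (abs_add_le _ _).trans (add_le_add (hf z hz) (hg z hz))

theorem const_mul (r : ℝ) (hf : WGrowth B t f a) : WGrowth B t (algebraMap ℝ (Sm n) r * f) a := by
  obtain ⟨C, hC, hf⟩ := hf
  refine ⟨|r| * C, by positivity, fun z hz => ?_⟩
  rw [map_mul, ev_algebraMap, mul_assoc]
  exact abs_mul_le_mul le_rfl (hf z hz)

theorem mono (hB : 0 < B) (hf : WGrowth B t f a) (hab : a ≤ b) : WGrowth B t f b := by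
  obtain ⟨C, hC, hf⟩ := hf
  refine ⟨C * B ^ (a - b), by positivity, fun z hz => (hf z hz).trans ?_⟩
  have hw := statP_pos hB z
  have h1 : ev z (statP n B) ^ a = ev z (statP n B) ^ (a - b) * ev z (statP n B) ^ b := by
    rw [← Real.rpow_add hw, sub_add_cancel]
  have h2 : ev z (statP n B) ^ (a - b) ≤ B ^ (a - b) :=
    Real.rpow_le_rpow_of_nonpos hB (by rw [ev_statP_eq_norm]; nlinarith [sq_nonneg ‖z.1.2‖])
      (by linarith)
  rw [h1, mul_assoc]
  exact mul_le_mul_of_nonneg_left (mul_le_mul_of_nonneg_right h2 (by positivity)) hC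

theorem coord (hB : 0 < B) (i : Fin n) : WGrowth B t (X i : Sm n) (1 / 2) :=
  ⟨1, zero_le_one, fun z _ => by
    rw [ev_X, one_mul, ← Real.sqrt_eq_rpow]; exact abs_coord_le hB z i⟩

theorem statPow (hB : 0 < B) (s : ℝ) : WGrowth B t (statPow n hB s) s :=
  ⟨1, zero_le_one, fun z _ => by
    rw [abs_of_pos (statPow_pos hB s z), ev_statPow, one_mul]⟩

theorem integrable (hB : 0 < B) (ht : 0 < t) (hf : WGrowth B t f a) (ha : (n : ℝ) < 2 * -a) :
    Integrable fun x => toFun f (t, x) := by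
  obtain ⟨C, hC, hf⟩ := hf
  exact integrable_of_abs_le hB ht ha fun z hz => by rw [neg_neg]; exact hf z hz

theorem integral_dx_mul (hB : 0 < B) (ht : 0 < t) (ha : (n : ℝ) < 2 * -a) (k : Fin n)
    (h1 : WGrowth B t (dx k f * g) a) (h2 : WGrowth B t (f * dx k g) a)
    (h3 : WGrowth B t (f * g) a) :
    ∫ x, toFun (dx k f * g) (t, x) = -∫ x, toFun (f * dx k g) (t, x) := by
  obtain ⟨C, hC, h1⟩ := h1
  obtain ⟨D, hD, h2⟩ := h2
  obtain ⟨E, hE, h3⟩ := h3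
  have key : ∀ z : SpaceTime n, 0 ≤ ev z (statP n B) ^ a := fun z =>
    (Real.rpow_pos_of_pos (statP_pos hB z) _).le
  refine Sm.integral_dx_mul hB ht (s := -a) (C := C + D + E) ha k (fun z hz => ?_) (fun z hz => ?_)
    fun z hz => ?_
  · rw [neg_neg]
    exact (h1 z hz).trans (mul_le_mul_of_nonneg_right (by linarith) (key z))
  · rw [neg_neg]
    exact (h2 z hz).trans (mul_le_mul_of_nonneg_right (by linarith) (key z))
  · rw [neg_neg]
    exact (h3 z hz).trans (mul_le_mul_of_nonneg_right (by linarith) (key z))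

end WGrowth

theorem toFun_add {t : ℝ} (ht : 0 < t) (f g : Sm n) (x : EuclideanSpace ℝ (Fin n)) :
    toFun (f + g) (t, x) = toFun f (t, x) + toFun g (t, x) := by
  simp only [toFun_eq_ev ht, map_add]

theorem toFun_mul {t : ℝ} (ht : 0 < t) (f g : Sm n) (x : EuclideanSpace ℝ (Fin n)) :
    toFun (f * g) (t, x) = toFun f (t, x) * toFun g (t, x) := by
  simp only [toFun_eq_ev ht, map_mul]

theorem toFun_algebraMap_mul {t : ℝ} (ht : 0 < t) (r : ℝ) (f : Sm n)
    (x : EuclideanSpace ℝ (Fin n)) :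
    toFun (algebraMap ℝ (Sm n) r * f) (t, x) = r * toFun f (t, x) := by
  rw [toFun_mul ht, toFun_eq_ev ht, ev_algebraMap]

theorem toFun_sum {t : ℝ} (ht : 0 < t) (f : Fin n → Sm n) (x : EuclideanSpace ℝ (Fin n)) :
    toFun (∑ k, f k) (t, x) = ∑ k, toFun (f k) (t, x) := by
  simp only [toFun_eq_ev ht, map_sum]

/-- The first moments of the gradient against a power of the stationary pressure. -/
theorem integral_dx_mul_statPow (hB : 0 < B) (ht : 0 < t) {h : Sm n} {r : ℝ}
    (hr : (n : ℝ) + 2 < 2 * r) (h0 : WGrowth B t h 1) (h1 : ∀ k, WGrowth B t (dx k h) (1 / 2))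
    (i : Fin n) :
    ∫ x, toFun (dx i h * statPow n hB (-r)) (t, x) =
      2 * r * ∫ x, toFun (h * (X i * statPow n hB (-(r + 1)))) (t, x) := by
  have e1 : h * dx i (statPow n hB (-r)) =
      algebraMap ℝ (Sm n) (-(2 * r)) * (h * (X i * statPow n hB (-(r + 1)))) := by
    rw [dx_statPow, show -r - 1 = -(r + 1) by ring, show 2 * -r = -(2 * r) by ring]; ring
  rw [WGrowth.integral_dx_mul hB ht (a := 1 - r) (by linarith) i
    (((h1 i).mul hB (WGrowth.statPow hB (-r))).mono hB (by linarith)) ?_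
    ((h0.mul hB (WGrowth.statPow hB (-r))).mono hB (by linarith)), e1]
  · simp only [toFun_algebraMap_mul ht, integral_const_mul]; ring
  · rw [e1]
    refine ((h0.mul hB ((WGrowth.coord hB i).mul hB
      (WGrowth.statPow hB (-(r + 1))))).const_mul _).mono hB (by linarith)

/-- The coordinate functions are dual eigenfunctions of the linearised operator with weight
`r`. -/
theorem integral_linOp_mul (hB : 0 < B) (ht : 0 < t) {h : Sm n} {r : ℝ}
    (hr : (n : ℝ) + 2 < 2 * r) (h0 : WGrowth B t h 1) (h1 : ∀ k, WGrowth B t (dx k h) (1 / 2))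
    (h2 : ∀ k, WGrowth B t (dx k (dx k h)) 0) (i : Fin n) :
    ∫ x, toFun ((statP n B * lapD dx h - 2 * algebraMap ℝ (Sm n) r * ∑ k, X k * dx k h) *
        (X i * statPow n hB (-(r + 1)))) (t, x) =
      -(2 * r) * ∫ x, toFun (h * (X i * statPow n hB (-(r + 1)))) (t, x) := by
  have e0 : statPow n hB (-r) = statP n B * statPow n hB (-(r + 1)) := by
    rw [← statPow_one hB, statPow_mul_statPow]; congr 1; ring
  have e2 : ∀ k, dx k (statPow n hB (-r) * dx k h) * X i =
      (statP n B * dx k (dx k h) - 2 * algebraMap ℝ (Sm n) r * (X k * dx k h)) *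
        (X i * statPow n hB (-(r + 1))) := fun k => by
    rw [Derivation.leibniz, dx_statPow, show -r - 1 = -(r + 1) by ring,
      show 2 * -r = -(2 * r) by ring, map_neg, map_mul, map_ofNat, e0, smul_eq_mul, smul_eq_mul]
    ring
  have e3 : (statP n B * lapD dx h - 2 * algebraMap ℝ (Sm n) r * ∑ k, X k * dx k h) *
      (X i * statPow n hB (-(r + 1))) = ∑ k, dx k (statPow n hB (-r) * dx k h) * X i := by
    simp only [e2, lapD]
    rw [← Finset.sum_mul, Finset.mul_sum, Finset.mul_sum, ← Finset.sum_sub_distrib]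
  have g1 : ∀ k, WGrowth B t (dx k (statPow n hB (-r) * dx k h) * X i) (1 - r) := fun k => by
    have e4 : dx k (statPow n hB (-r) * dx k h) * X i =
        statPow n hB (-r) * dx k (dx k h) * X i + algebraMap ℝ (Sm n) (-(2 * r)) *
        (X k * dx k h * (X i * statPow n hB (-(r + 1)))) := by
      rw [e2, map_neg, map_mul, map_ofNat, e0]; ring
    rw [e4]
    refine WGrowth.add ?_ (WGrowth.const_mul _ ?_)
    · exact (((WGrowth.statPow hB _).mul hB (h2 k)).mul hB (WGrowth.coord hB i)).mono hB
        (by linarith)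
    · exact (((WGrowth.coord hB k).mul hB (h1 k)).mul hB ((WGrowth.coord hB i).mul hB
        (WGrowth.statPow hB _))).mono hB (by linarith)
  have e5 : ∀ k, ∫ x, toFun (dx k (statPow n hB (-r) * dx k h) * X i) (t, x) =
      if k = i then -∫ x, toFun (dx i h * statPow n hB (-r)) (t, x) else 0 := fun k => by
    rw [WGrowth.integral_dx_mul hB ht (a := 1 - r) (by linarith) k (g1 k)]
    · by_cases hk : k = i
      · subst hk
        simp only [dx_X, if_true, mul_one]
        simp only [mul_comm]
      · simp only [dx_X, if_neg hk, mul_zero]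
        have : ∀ x : EuclideanSpace ℝ (Fin n), toFun (0 : Sm n) (t, x) = 0 := fun x => by
          rw [toFun_eq_ev ht, map_zero]
        simp [this]
    · by_cases hk : k = i
      · simp only [dx_X, if_pos hk, mul_one]
        exact ((WGrowth.statPow hB _).mul hB (h1 k)).mono hB (by linarith)
      · simp only [dx_X, if_neg hk, mul_zero]
        exact ⟨0, le_rfl, fun z _ => by simp⟩
    · exact (((WGrowth.statPow hB _).mul hB (h1 k)).mul hB (WGrowth.coord hB i)).mono hB
        (by linarith)
  rw [e3]
  simp only [toFun_sum ht]
  rw [integral_finsetSum _ fun k _ => (g1 k).integrable hB ht (by linarith)]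
  simp only [e5, Finset.sum_ite_eq', Finset.mem_univ, if_true]
  rw [integral_dx_mul_statPow hB ht hr h0 h1]
  ring

end Sm

/-- A solution of a damped equation with forcing `η + M exp (-c t)`. -/
theorem abs_le_of_damped_forced {u u' : ℝ → ℝ} {T S l c M η : ℝ} (hT : 0 ≤ T) (hTS : T ≤ S)
    (hl : 0 < l) (hlc : l < c) (hM : 0 ≤ M) (hη : 0 ≤ η)
    (hu : ∀ t, T ≤ t → HasDerivAt u (u' t) t)
    (hb : ∀ t, T ≤ t → |u' t + l * u t| ≤ η + M * Real.exp (-c * t)) :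
    |u S| ≤ (|u T| * Real.exp (l * T) + M / (c - l)) * Real.exp (-l * S) + η / l := by
  have hcl : 0 < c - l := by linarith
  set g : ℝ → ℝ := fun t => η / l * Real.exp (l * t) - M / (c - l) * Real.exp (-(c - l) * t) with hg
  have hgd : ∀ t, HasDerivAt g (η * Real.exp (l * t) + M * Real.exp (-(c - l) * t)) t := fun t => by
    refine (((hasDerivAt_exp_mul l t).const_mul (η / l)).sub
      ((hasDerivAt_exp_mul (-(c - l)) t).const_mul (M / (c - l)))).congr_deriv ?_
    field_simp
    ring
  have hgb : g S - g T ≤ η / l * Real.exp (l * S) + M / (c - l) := by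
    have h1 : Real.exp (-(c - l) * T) ≤ 1 := Real.exp_le_one_iff.2 (by nlinarith)
    have h2 := mul_le_mul_of_nonneg_left h1 (div_nonneg hM hcl.le)
    have h3 : 0 ≤ M / (c - l) * Real.exp (-(c - l) * S) := by positivity
    have h4 : 0 ≤ η / l * Real.exp (l * T) := by positivity
    simp only [hg]; linarith
  have hside : ∀ e : ℝ, |e| = 1 → e * u S * Real.exp (l * S) ≤
      |u T| * Real.exp (l * T) + M / (c - l) + η / l * Real.exp (l * S) := by
    intro e he
    have hanti := antitoneOn_Ici_of_hasDerivAt_nonpos (T := T)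
      (v := fun t => Real.exp (l * t) * (e * u t) - g t)
      (v' := fun t => l * Real.exp (l * t) * (e * u t) + Real.exp (l * t) * (e * u' t) -
        (η * Real.exp (l * t) + M * Real.exp (-(c - l) * t)))
      (fun t ht => ((hasDerivAt_exp_mul l t).mul ((hu t ht).const_mul e)).sub (hgd t))
      (fun t ht => by
        have h1 : e * (u' t + l * u t) ≤ η + M * Real.exp (-c * t) := by
          refine (le_abs_self _).trans ?_
          rw [abs_mul, he, one_mul]; exact hb t ht
        have h2 : Real.exp (-(c - l) * t) = Real.exp (l * t) * Real.exp (-c * t) := by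
          rw [← Real.exp_add]; congr 1; ring
        rw [h2]
        have h3 := mul_le_mul_of_nonneg_left h1 (Real.exp_pos (l * t)).le
        linarith)
    have h4 := hanti (Set.mem_Ici.2 le_rfl) (Set.mem_Ici.2 hTS) hTS
    simp only at h4
    have h5 : e * u T ≤ |u T| := by
      refine (le_abs_self _).trans ?_
      rw [abs_mul, he, one_mul]
    have h6 := mul_le_mul_of_nonneg_left h5 (Real.exp_pos (l * T)).le
    linarith
  have hE : Real.exp (-l * S) * Real.exp (l * S) = 1 := by
    rw [← Real.exp_add]; simp
  have hfin : |u S| * Real.exp (l * S) ≤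
      |u T| * Real.exp (l * T) + M / (c - l) + η / l * Real.exp (l * S) := by
    rcases abs_cases (u S) with ⟨h, _⟩ | ⟨h, _⟩
    · rw [h]; simpa using hside 1 (by simp)
    · rw [h]; simpa using hside (-1) (by simp)
  have h7 := mul_le_mul_of_nonneg_left hfin (Real.exp_pos (-l * S)).le
  have e1 : Real.exp (-l * S) * (|u S| * Real.exp (l * S)) = |u S| := by
    rw [mul_comm |u S|, ← mul_assoc, hE, one_mul]
  have e2 : Real.exp (-l * S) * (η / l * Real.exp (l * S)) = η / l := by
    rw [mul_comm (η / l), ← mul_assoc, hE, one_mul]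
  rw [e1, mul_add, e2] at h7
  linarith

namespace Sm

variable {n : ℕ} {q B : ℝ} {h : Sm n}

/-- Decay of the deviation together with its gradient and Laplacian. -/
def FlowDecay (B : ℝ) (h : Sm n) (T c C : ℝ) : Prop :=
  ∀ z : SpaceTime n, T ≤ z.1.1 →
    |ev z h| ≤ C * Real.exp (-c * z.1.1) * ev z (statP n B) ∧
    (∀ k, |ev z (dx k h)| ≤ C * Real.exp (-c * z.1.1) * √(ev z (statP n B))) ∧
    |ev z (lapD dx h)| ≤ C * Real.exp (-c * z.1.1)

theorem exists_flowDecay (hq : 0 ≤ q) (hB : 0 < B) (hh : IsFlow q B h) {T c c' M : ℝ}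
    (hM : 0 ≤ M) (hO : OriginSmall h T) (hH : HessDecay B h T c M) (hc : 0 < c) (hc'q : c' < 2 * q)
    (hc'c : c' ≤ c) (hcc' : c ≤ 2 * c') : ∃ C : ℝ, 0 ≤ C ∧ FlowDecay B h T c' C := by
  obtain ⟨C₀, hC₀, H0⟩ := exists_origin_decay hq hB hh hM hO hH hc hc'q hc'c hcc'
  obtain ⟨C₁, hC₁, H1⟩ := exists_flow_decay hq hB hh hM hO hH hc hc'q hc'c hcc'
  have hsB : 0 < √B := Real.sqrt_pos.2 hB
  refine ⟨C₁ + (C₀ / √B + n * M), by positivity, fun z hz => ?_⟩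
  have hw := statP_pos hB z
  have hE : Real.exp (-c * z.1.1) ≤ Real.exp (-c' * z.1.1) := exp_neg_mul_le hc'c z.2.le
  have hE0 := Real.exp_pos (-c' * z.1.1)
  have hD : 0 ≤ C₀ / √B + n * M := by positivity
  have hD' : 0 ≤ C₀ / √B := by positivity
  refine ⟨(H1 z hz).trans ?_, fun k => ?_, ?_⟩
  · gcongr; linarith
  · obtain ⟨⟨t, x⟩, ht⟩ := z
    have h1 := abs_dx_sub_le (h := h) (M := M * Real.exp (-c * t)) ht (fun z hz' => by
      have := (hH z (by rw [hz']; exact hz)).1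
      rwa [hz'] at this) x k
    have h2 := ((H0 t hz).2 k).1
    have hx : ‖x‖ ≤ √(ev (⟨(t, x), ht⟩ : SpaceTime n) (statP n B)) := by
      refine Real.le_sqrt_of_sq_le ?_
      rw [ev_statP_eq_norm]; simp only; linarith
    have hBw : √B ≤ √(ev (⟨(t, x), ht⟩ : SpaceTime n) (statP n B)) := by
      refine Real.sqrt_le_sqrt ?_
      rw [ev_statP_eq_norm]; simp only; nlinarith [sq_nonneg ‖x‖]
    have e1 : ev (⟨(t, x), ht⟩ : SpaceTime n) (dx k h) = toFun (dx k h) (t, x) :=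
      (toFun_eq_ev ht (dx k h) x).symm
    rw [e1]
    simp only at hE hE0 ⊢
    set s := √(ev (⟨(t, x), ht⟩ : SpaceTime n) (statP n B)) with hs
    have h3 : |toFun (dx k h) (t, x)| ≤ C₀ * Real.exp (-c' * t) + n * (M * Real.exp (-c * t)) * ‖x‖ := by
      have := abs_add_le (toFun (dx k h) (t, x) - toFun (dx k h) (t, 0)) (toFun (dx k h) (t, 0))
      rw [sub_add_cancel] at this
      linarith
    have h4 : C₀ * Real.exp (-c' * t) ≤ C₀ / √B * Real.exp (-c' * t) * s := by
      have : C₀ * Real.exp (-c' * t) = C₀ / √B * Real.exp (-c' * t) * √B := by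
        field_simp
      rw [this]; gcongr
    have h5 : n * (M * Real.exp (-c * t)) * ‖x‖ ≤ n * (M * Real.exp (-c' * t)) * s := by gcongr
    have h6 : 0 ≤ C₁ * Real.exp (-c' * t) * s := by positivity
    linarith
  · have h1 := (abs_lapD_le h z).trans (mul_le_mul_of_nonneg_left (hH z hz).1 n.cast_nonneg)
    have h2 : (n : ℝ) * (M * Real.exp (-c * z.1.1)) ≤ n * (M * Real.exp (-c' * z.1.1)) := by gcongr
    have h3 : 0 ≤ (C₁ + C₀ / √B) * Real.exp (-c' * z.1.1) := by positivity
    linarith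

/-- The quadratic part of the flow equation. -/
theorem FlowDecay.abs_quadratic_le {T c C : ℝ} (hq : 0 ≤ q) (hB : 0 < B)
    (hF : FlowDecay B h T c C) {z : SpaceTime n} (hz : T ≤ z.1.1) :
    |ev z (h * lapD dx h - algebraMap ℝ (Sm n) q * ∑ k, dx k h ^ 2)| ≤
      (1 + q * n) * C ^ 2 * Real.exp (-(2 * c) * z.1.1) * ev z (statP n B) := by
  obtain ⟨h0, h1, h2⟩ := hF z hz
  have hw := statP_pos hB z
  have hE : Real.exp (-(2 * c) * z.1.1) = Real.exp (-c * z.1.1) ^ 2 := by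
    rw [← Real.exp_nat_mul]; congr 1; push_cast; ring
  rw [hE, map_sub, map_mul, map_mul, map_sum, ev_algebraMap]
  simp only [map_pow]
  set E := Real.exp (-c * z.1.1)
  set w := ev z (statP n B)
  have a1 : |ev z h * ev z (lapD dx h)| ≤ C * E * w * (C * E) := abs_mul_le_mul h0 h2
  have a2 : |q * ∑ k, ev z (dx k h) ^ 2| ≤ q * (n * ((C * E * √w) * (C * E * √w))) := by
    rw [abs_mul, abs_of_nonneg hq]
    refine mul_le_mul_of_nonneg_left (abs_sum_fin_le fun k => ?_) hq
    rw [pow_two]; exact abs_mul_le_mul (h1 k) (h1 k)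
  have a3 : C * E * √w * (C * E * √w) = C ^ 2 * E ^ 2 * w := by
    have := Real.mul_self_sqrt hw.le
    linear_combination C ^ 2 * E ^ 2 * this
  rw [a3] at a2
  refine (abs_sub _ _).trans ?_
  linarith

theorem FlowDecay.abs_euler_le {T c C : ℝ} (hB : 0 < B)
    (hF : FlowDecay B h T c C) {z : SpaceTime n} (hz : T ≤ z.1.1) :
    |ev z (∑ k, X k * dx k h)| ≤ n * (C * Real.exp (-c * z.1.1) * ev z (statP n B)) := by
  have hw := statP_pos hB z
  rw [map_sum]
  refine abs_sum_fin_le fun k => ?_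
  rw [map_mul, ev_X]
  refine (abs_mul_le_mul (abs_coord_le hB z k) ((hF z hz).2.1 k)).trans_eq ?_
  have := Real.mul_self_sqrt hw.le
  linear_combination C * Real.exp (-c * z.1.1) * this

theorem IsFlow.dt_eq (hh : IsFlow q B h) (r : ℝ) : dt h =
    (statP n B * lapD dx h - 2 * algebraMap ℝ (Sm n) r * ∑ k, X k * dx k h) +
      (algebraMap ℝ (Sm n) (2 * (r - q)) * (∑ k, X k * dx k h) +
        (h * lapD dx h - algebraMap ℝ (Sm n) q * ∑ k, dx k h ^ 2)) := by
  unfold IsFlow at hh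
  rw [hh, map_mul, map_sub, map_ofNat]; ring

theorem FlowDecay.abs_dt_le {T c C : ℝ} (hq : 0 ≤ q) (hB : 0 < B) (hC : 0 ≤ C) (hc : 0 ≤ c)
    (hh : IsFlow q B h) (hF : FlowDecay B h T c C) {z : SpaceTime n} (hz : T ≤ z.1.1) :
    |ev z (dt h)| ≤ (C + 2 * q * (n * C) + (1 + q * n) * C ^ 2) * ev z (statP n B) := by
  have hw := statP_pos hB z
  have h1 := hF.abs_quadratic_le hq hB hz
  have h2 := hF.abs_euler_le hB hz
  have h3 := (hF z hz).2.2
  have hE1 : Real.exp (-c * z.1.1) ≤ 1 := Real.exp_le_one_iff.2 (by have := z.2; nlinarith)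
  have hE2 : Real.exp (-(2 * c) * z.1.1) ≤ 1 := Real.exp_le_one_iff.2 (by have := z.2; nlinarith)
  have e1 : ev z (dt h) = ev z (statP n B) * ev z (lapD dx h) - 2 * q * ev z (∑ k, X k * dx k h) +
      ev z (h * lapD dx h - algebraMap ℝ (Sm n) q * ∑ k, dx k h ^ 2) := by
    rw [hh.dt_eq q]
    simp only [map_add, map_sub, map_mul, ev_algebraMap, ev_two]
    ring
  rw [e1]
  set w := ev z (statP n B)
  have b1 : |w * ev z (lapD dx h)| ≤ w * (C * 1) :=
    abs_mul_le_mul (abs_of_pos hw).le (h3.trans (mul_le_mul_of_nonneg_left hE1 hC))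
  have b2 : |2 * q * ev z (∑ k, X k * dx k h)| ≤ 2 * q * (n * (C * 1 * w)) := by
    refine abs_mul_le_mul (abs_of_nonneg (by positivity)).le (h2.trans ?_)
    gcongr
  have b3 := h1.trans (show _ ≤ (1 + q * n) * C ^ 2 * 1 * w by gcongr)
  refine (abs_add_le _ _).trans ?_
  refine (add_le_add ((abs_sub _ _).trans (add_le_add b1 b2)) b3).trans_eq ?_
  ring

end Sm

namespace Sm

variable {n : ℕ} {q B : ℝ} {h : Sm n}

/-- The dual eigenfunction of the linearised operator with weight `r`. -/
def dualCoord (hB : 0 < B) (r : ℝ) (i : Fin n) : Sm n := X i * statPow n hB (-(r + 1))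

theorem dt_dualCoord (hB : 0 < B) (r : ℝ) (i : Fin n) : dt (dualCoord hB r i) = 0 := by
  rw [dualCoord, Derivation.leibniz, dt_X, dt_statPow, smul_zero, smul_zero, add_zero]

theorem le_statP (B : ℝ) (z : SpaceTime n) : B ≤ ev z (statP n B) := by
  rw [ev_statP_eq_norm]; linarith [sq_nonneg ‖z.1.2‖]

theorem statP_rpow_le (hB : 0 < B) (z : SpaceTime n) {δ s : ℝ} (h0 : 0 ≤ δ) (h1 : δ ≤ 1) :
    ev z (statP n B) ^ (s - δ) ≤ max 1 (1 / B) * ev z (statP n B) ^ s := by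
  have hw := statP_pos hB z
  have e1 : ev z (statP n B) ^ (s - δ) = ev z (statP n B) ^ (-δ) * ev z (statP n B) ^ s := by
    rw [← Real.rpow_add hw]; congr 1; ring
  rw [e1]
  refine mul_le_mul_of_nonneg_right ?_ (by positivity)
  calc ev z (statP n B) ^ (-δ) ≤ B ^ (-δ) :=
        Real.rpow_le_rpow_of_nonpos hB (le_statP B z) (by linarith)
    _ = (1 / B) ^ δ := by rw [one_div, Real.inv_rpow hB.le, Real.rpow_neg hB.le]
    _ ≤ (max 1 (1 / B)) ^ δ := Real.rpow_le_rpow (by positivity) (le_max_right _ _) h0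
    _ ≤ (max 1 (1 / B)) ^ (1 : ℝ) := Real.rpow_le_rpow_of_exponent_le (le_max_left _ _) h1
    _ = _ := Real.rpow_one _

theorem abs_mul_dualCoord_le (hB : 0 < B) {r D : ℝ} (hqr : q ≤ r) (hrq : r ≤ q + 1) (i : Fin n)
    {f : Sm n} {z : SpaceTime n} (hf : |ev z f| ≤ D * ev z (statP n B)) :
    |ev z (f * dualCoord hB r i)| ≤ D * max 1 (1 / B) * ev z (statP n B) ^ (-(q - 1 / 2)) := by
  have hw := statP_pos hB z
  have hD : 0 ≤ D := by
    by_contra hD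
    have := mul_neg_of_neg_of_pos (not_le.1 hD) hw
    have := abs_nonneg (ev z f)
    linarith
  have h1 : |ev z (dualCoord hB r i)| ≤ √(ev z (statP n B)) * ev z (statP n B) ^ (-(r + 1)) := by
    rw [dualCoord, map_mul, ev_X]
    refine abs_mul_le_mul (abs_coord_le hB z i) ?_
    rw [abs_of_pos (statPow_pos hB _ z), ev_statPow]
  rw [map_mul]
  refine (abs_mul_le_mul hf h1).trans ?_
  have h2 := statP_rpow_le hB z (s := -(q - 1 / 2)) (sub_nonneg.2 hqr) (by linarith)
  have e1 : D * ev z (statP n B) * (√(ev z (statP n B)) * ev z (statP n B) ^ (-(r + 1))) =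
      D * ev z (statP n B) ^ (-(q - 1 / 2) - (r - q)) := by
    have e0 : -(q - 1 / 2) - (r - q) = 1 + (1 / 2 + -(r + 1)) := by ring
    rw [e0, Real.rpow_add hw, Real.rpow_one, Real.rpow_add hw, ← Real.sqrt_eq_rpow, mul_assoc]
  rw [e1, mul_assoc]
  exact mul_le_mul_of_nonneg_left h2 hD

/-- The moment of the deviation against a dual eigenfunction. -/
def dualMoment (hB : 0 < B) (h : Sm n) (r : ℝ) (i : Fin n) (t : ℝ) : ℝ :=
  ∫ x, toFun (h * dualCoord hB r i) (t, x)

theorem hasDerivAt_dualMoment (hB : 0 < B) {T t C D r : ℝ} (hT : 0 < T) (ht : T < t)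
    (hnq : (n : ℝ) < 2 * (q - 1 / 2)) (hqr : q ≤ r) (hrq : r ≤ q + 1) (i : Fin n)
    (h0 : ∀ z : SpaceTime n, T ≤ z.1.1 → |ev z h| ≤ C * ev z (statP n B))
    (h1 : ∀ z : SpaceTime n, T ≤ z.1.1 → |ev z (dt h)| ≤ D * ev z (statP n B)) :
    HasDerivAt (dualMoment hB h r i) (∫ x, toFun (dt h * dualCoord hB r i) (t, x)) t := by
  have ht0 := hT.trans ht
  have e1 : dt (h * dualCoord hB r i) = dt h * dualCoord hB r i := by
    rw [Derivation.leibniz, dt_dualCoord, smul_zero, zero_add, smul_eq_mul, mul_comm]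
  refine (hasDerivAt_integral_of_dominated_loc_of_deriv_le (s := Set.Ioi T)
    (F := fun s x => toFun (h * dualCoord hB r i) (s, x))
    (F' := fun s x => toFun (dt h * dualCoord hB r i) (s, x))
    (bound := fun x => D * max 1 (1 / B) * (B + ‖x‖ ^ 2) ^ (-(q - 1 / 2)))
    (Ioi_mem_nhds ht) ?_ ?_ ?_ ?_ ?_ ?_).2
  · filter_upwards [Ioi_mem_nhds ht0] with s hs
    exact (continuous_toFun _ hs).aestronglyMeasurable
  · exact integrable_of_abs_le hB ht0 hnq fun z hz =>
      abs_mul_dualCoord_le hB hqr hrq i (h0 z (by rw [hz]; exact ht.le))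
  · exact (continuous_toFun _ ht0).aestronglyMeasurable
  · refine ae_of_all _ fun x s hs => ?_
    have hs' : T < s := hs
    have := abs_mul_dualCoord_le hB hqr hrq i (h1 (pt s (hT.trans hs') x) hs'.le)
    rwa [← toFun_eq_ev, ev_statP_eq_norm] at this
  · exact (integrable_weight hB hnq).const_mul _
  · refine ae_of_all _ fun x s hs => ?_
    have hs' : T < s := hs
    rw [← e1]
    exact hasDerivAt_time _ (hT.trans hs') x

/-- The moments against the dual eigenfunctions satisfy a damped equation. -/
theorem exists_abs_deriv_dualMoment_le (hn : 2 ≤ n) (hq : q = n) (hB : 0 < B) (hh : IsFlow q B h)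
    {T C M : ℝ} (hT : 0 < T) (hC : 0 ≤ C) (hF : FlowDecay B h T (3 / 2 * q) C)
    (hH : HessDecay B h T (2 * q) M) :
    ∃ D : ℝ, 0 ≤ D ∧ ∀ r, q < r → r ≤ q + 1 → ∀ i,
      (∀ t, T < t → HasDerivAt (dualMoment hB h r i)
        (∫ x, toFun (dt h * dualCoord hB r i) (t, x)) t) ∧
      (∀ t, T ≤ t → |dualMoment hB h r i t| ≤ D) ∧
      ∀ t, T ≤ t → |(∫ x, toFun (dt h * dualCoord hB r i) (t, x)) +
        2 * r * dualMoment hB h r i t| ≤ D * (r - q) + D * Real.exp (-(3 * q) * t) := by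
  have hn2 : (2 : ℝ) ≤ n := by exact_mod_cast hn
  have hq0 : 0 ≤ q := by linarith
  have hnq : (n : ℝ) < 2 * (q - 1 / 2) := by linarith
  set I : ℝ := ∫ x : EuclideanSpace ℝ (Fin n), (B + ‖x‖ ^ 2) ^ (-(q - 1 / 2)) with hI
  have hI0 : 0 ≤ I := integral_nonneg fun x => by positivity
  set K : ℝ := max 1 (1 / B) with hK
  have hK0 : 0 ≤ K := zero_le_one.trans (le_max_left _ _)
  set D₁ : ℝ := (1 + q * n) * C ^ 2 with hD₁
  have hD₁0 : 0 ≤ D₁ := by positivity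
  have hE1 : ∀ t, T ≤ t → Real.exp (-(3 / 2 * q) * t) ≤ 1 := fun t ht =>
    Real.exp_le_one_iff.2 (by nlinarith [mul_nonneg hq0 (hT.le.trans ht)])
  have hbd0 : ∀ z : SpaceTime n, T ≤ z.1.1 → |ev z h| ≤ C * ev z (statP n B) := fun z hz => by
    refine (hF z hz).1.trans (mul_le_mul_of_nonneg_right ?_ (statP_pos hB z).le)
    exact mul_le_of_le_one_right hC (hE1 _ hz)
  have hbd1 : ∀ z : SpaceTime n, T ≤ z.1.1 →
      |ev z (dt h)| ≤ (C + 2 * q * (n * C) + D₁) * ev z (statP n B) :=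
    fun z hz => hF.abs_dt_le hq0 hB hC (by positivity) hh hz
  refine ⟨C * K * I + 2 * (n * C) * K * I + D₁ * K * I, by positivity, fun r hqr hrq i =>
    ⟨fun t ht => hasDerivAt_dualMoment hB hT ht hnq hqr.le hrq i hbd0 hbd1, fun t ht => ?_,
      fun t ht => ?_⟩⟩
  · have h1 := abs_integral_le_of_abs_le hB (hT.trans_le ht) hnq fun z hz =>
      abs_mul_dualCoord_le hB hqr.le hrq i (hbd0 z (by rw [hz]; exact ht))
    refine h1.trans ?_
    have : 0 ≤ 2 * (n * C) * K * I + D₁ * K * I := by positivity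
    linarith
  · have ht0 := hT.trans_le ht
    set f₁ : Sm n := statP n B * lapD dx h - 2 * algebraMap ℝ (Sm n) r * ∑ k, X k * dx k h with hf₁
    set f₂ : Sm n := algebraMap ℝ (Sm n) (2 * (r - q)) * ∑ k, X k * dx k h with hf₂
    set f₃ : Sm n := h * lapD dx h - algebraMap ℝ (Sm n) q * ∑ k, dx k h ^ 2 with hf₃
    have hdt : dt h = f₁ + (f₂ + f₃) := hh.dt_eq r
    have hb₂ : ∀ z : SpaceTime n, z.1.1 = t →
        |ev z f₂| ≤ 2 * (r - q) * (n * C) * ev z (statP n B) := fun z hz => by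
      have hz' : T ≤ z.1.1 := by rw [hz]; exact ht
      have hw := statP_pos hB z
      rw [hf₂, map_mul, ev_algebraMap, mul_assoc (2 * (r - q))]
      refine abs_mul_le_mul (abs_of_nonneg (by linarith)).le ((hF.abs_euler_le hB hz').trans ?_)
      rw [mul_assoc (n : ℝ)]
      refine mul_le_mul_of_nonneg_left (mul_le_mul_of_nonneg_right ?_ hw.le) n.cast_nonneg
      exact mul_le_of_le_one_right hC (hE1 _ hz')
    have hb₃ : ∀ z : SpaceTime n, z.1.1 = t →
        |ev z f₃| ≤ D₁ * Real.exp (-(3 * q) * t) * ev z (statP n B) := fun z hz => by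
      have := hF.abs_quadratic_le hq0 hB (z := z) (by rw [hz]; exact ht)
      rwa [hz, show 2 * (3 / 2 * q) = 3 * q by ring] at this
    have hk₂ := fun (z : SpaceTime n) (hz : z.1.1 = t) =>
      abs_mul_dualCoord_le hB hqr.le hrq i (hb₂ z hz)
    have hk₃ := fun (z : SpaceTime n) (hz : z.1.1 = t) =>
      abs_mul_dualCoord_le hB hqr.le hrq i (hb₃ z hz)
    have hkt := fun (z : SpaceTime n) (hz : z.1.1 = t) =>
      abs_mul_dualCoord_le hB hqr.le hrq i (hbd1 z (by rw [hz]; exact ht))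
    have i₂ := integrable_of_abs_le hB ht0 hnq hk₂
    have i₃ := integrable_of_abs_le hB ht0 hnq hk₃
    have it := integrable_of_abs_le hB ht0 hnq hkt
    have hmulsub : ∀ x : EuclideanSpace ℝ (Fin n), toFun (dt h * dualCoord hB r i) (t, x) =
        toFun (f₁ * dualCoord hB r i) (t, x) + (toFun (f₂ * dualCoord hB r i) (t, x) +
          toFun (f₃ * dualCoord hB r i) (t, x)) := fun x => by
      rw [hdt, add_mul, add_mul, toFun_add ht0, toFun_add ht0]
    have i₁ : Integrable fun x => toFun (f₁ * dualCoord hB r i) (t, x) := by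
      refine (it.sub (i₂.add i₃)).congr (ae_of_all _ fun x => ?_)
      simp only [Pi.sub_apply, Pi.add_apply, hmulsub]; ring
    have hint : ∫ x, toFun (dt h * dualCoord hB r i) (t, x) =
        (∫ x, toFun (f₁ * dualCoord hB r i) (t, x)) +
          ((∫ x, toFun (f₂ * dualCoord hB r i) (t, x)) +
            ∫ x, toFun (f₃ * dualCoord hB r i) (t, x)) := by
      simp only [hmulsub]
      have := integral_add i₁ (i₂.add i₃)
      simp only [Pi.add_apply] at this
      rw [this, integral_add i₂ i₃]
    have hlin : ∫ x, toFun (f₁ * dualCoord hB r i) (t, x) = -(2 * r) * dualMoment hB h r i t := by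
      refine integral_linOp_mul hB ht0 (by linarith) ?_ ?_ ?_ i
      · exact ⟨C, hC, fun z hz => by rw [Real.rpow_one]; exact hbd0 z (by rw [hz]; exact ht)⟩
      · refine fun k => ⟨C, hC, fun z hz => ?_⟩
        have hz' : T ≤ z.1.1 := by rw [hz]; exact ht
        rw [← Real.sqrt_eq_rpow]
        refine ((hF z hz').2.1 k).trans (mul_le_mul_of_nonneg_right ?_ (Real.sqrt_nonneg _))
        exact mul_le_of_le_one_right hC (hE1 _ hz')
      · refine fun k => ⟨|M|, abs_nonneg _, fun z hz => ?_⟩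
        have hz' : T ≤ z.1.1 := by rw [hz]; exact ht
        rw [Real.rpow_zero, mul_one]
        refine ((abs_ddx_le h z k k).trans (hH z hz').1).trans ?_
        refine (mul_le_mul_of_nonneg_right (le_abs_self M) (Real.exp_pos _).le).trans ?_
        refine mul_le_of_le_one_right (abs_nonneg _) (Real.exp_le_one_iff.2 ?_)
        have := mul_nonneg hq0 z.2.le
        linarith
    have j₂ := abs_integral_le_of_abs_le hB ht0 hnq hk₂
    have j₃ := abs_integral_le_of_abs_le hB ht0 hnq hk₃
    have hfin : (∫ x, toFun (dt h * dualCoord hB r i) (t, x)) + 2 * r * dualMoment hB h r i t =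
        (∫ x, toFun (f₂ * dualCoord hB r i) (t, x)) +
            ∫ x, toFun (f₃ * dualCoord hB r i) (t, x) := by
      rw [hint, hlin]; ring
    rw [hfin]
    refine (abs_add_le _ _).trans ((add_le_add j₂ j₃).trans ?_)
    have hrq0 : 0 ≤ r - q := by linarith
    have p1 : 0 ≤ (C * K * I + D₁ * K * I) * (r - q) := by positivity
    have p2 : 0 ≤ (C * K * I + 2 * (n * C) * K * I) * Real.exp (-(3 * q) * t) := by positivity
    linarith

end Sm

namespace Sm

variable {n : ℕ} {q B : ℝ} {h : Sm n}

theorem integral_weight_pos (hB : 0 < B) {s : ℝ} (hs : (n : ℝ) < 2 * s) :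
    0 < ∫ x : EuclideanSpace ℝ (Fin n), (B + ‖x‖ ^ 2) ^ (-s) := by
  have hpos : ∀ x : EuclideanSpace ℝ (Fin n), 0 < (B + ‖x‖ ^ 2) ^ (-s) := fun x => by positivity
  rw [integral_pos_iff_support_of_nonneg (fun x => (hpos x).le) (integrable_weight hB hs)]
  have : Function.support (fun x : EuclideanSpace ℝ (Fin n) => (B + ‖x‖ ^ 2) ^ (-s)) = Set.univ :=
    Set.eq_univ_of_forall fun x => (hpos x).ne'
  rw [this]
  exact Measure.measure_univ_pos.2 (NeZero.ne _)

/-- The gradient at the origin is controlled by the dual moments. -/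
theorem abs_dx_origin_le_dualMoment (hB : 0 < B) {t r M C : ℝ} (ht : 0 < t) (hM : 0 ≤ M)
    (hnr : (n : ℝ) + 2 < 2 * r)
    (hnq : (n : ℝ) < 2 * (q - 1 / 2)) (hqr : q ≤ r) (hrq : r ≤ q + 1) (i : Fin n)
    (h0 : WGrowth B t h 1) (h1 : ∀ k, WGrowth B t (dx k h) (1 / 2))
    (h2 : ∀ z : SpaceTime n, z.1.1 = t → size2 h z ≤ M) (hC : |dualMoment hB h r i t| ≤ C) :
    |toFun (dx i h) (t, 0)| * ∫ x : EuclideanSpace ℝ (Fin n), (B + ‖x‖ ^ 2) ^ (-(q + 1)) ≤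
      max 1 (1 / B) * (2 * r * C + n * M * max 1 (1 / B) *
        ∫ x : EuclideanSpace ℝ (Fin n), (B + ‖x‖ ^ 2) ^ (-(q - 1 / 2))) := by
  set b := toFun (dx i h) (t, 0) with hb
  set K : ℝ := max 1 (1 / B) with hK
  have hK0 : 0 ≤ K := zero_le_one.trans (le_max_left _ _)
  set J : ℝ := ∫ x : EuclideanSpace ℝ (Fin n), (B + ‖x‖ ^ 2) ^ (-r) with hJ
  have hr0 : 0 ≤ r := by have := n.cast_nonneg (α := ℝ); linarith
  have hJle : ∫ x : EuclideanSpace ℝ (Fin n), (B + ‖x‖ ^ 2) ^ (-(q + 1)) ≤ K * J := by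
    rw [hJ, ← integral_const_mul]
    refine integral_mono (integrable_weight hB (by linarith))
      ((integrable_weight hB (by linarith)).const_mul _) fun x => ?_
    have := statP_rpow_le hB (pt t ht x) (s := -r) (δ := q + 1 - r) (by linarith) (by linarith)
    rwa [ev_statP_eq_norm, show -r - (q + 1 - r) = -(q + 1) by ring] at this
  set f : Sm n := (dx i h - algebraMap ℝ (Sm n) b) * statPow n hB (-r) with hf
  have hfb : ∀ z : SpaceTime n, z.1.1 = t →
      |ev z f| ≤ n * M * K * ev z (statP n B) ^ (-(q - 1 / 2)) := fun z hz => by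
    have hw := statP_pos hB z
    have a1 : |ev z (dx i h) - b| ≤ n * M * √(ev z (statP n B)) := by
      obtain ⟨⟨s, x⟩, hs⟩ := z
      obtain rfl : s = t := hz
      have := abs_dx_sub_le ht h2 x i
      have e1 : ev (⟨(s, x), hs⟩ : SpaceTime n) (dx i h) = toFun (dx i h) (s, x) :=
        (toFun_eq_ev ht (dx i h) x).symm
      rw [e1]
      refine this.trans (mul_le_mul_of_nonneg_left (Real.le_sqrt_of_sq_le ?_) (by positivity))
      rw [ev_statP_eq_norm]; simp only; linarith
    have a2 := statP_rpow_le hB z (s := -(q - 1 / 2)) (sub_nonneg.2 hqr) (by linarith)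
    rw [hf, map_mul, map_sub, ev_algebraMap, ev_statPow]
    refine (abs_mul_le_mul a1 (abs_of_pos (Real.rpow_pos_of_pos hw _)).le).trans ?_
    have e0 : -(q - 1 / 2) - (r - q) = 1 / 2 + -r := by ring
    rw [e0, Real.rpow_add hw, ← Real.sqrt_eq_rpow] at a2
    have := mul_le_mul_of_nonneg_left a2 (by positivity : 0 ≤ n * M)
    linarith
  have hfi := integrable_of_abs_le hB ht hnq hfb
  have hfa := abs_integral_le_of_abs_le hB ht hnq hfb
  have hwi : Integrable fun x : EuclideanSpace ℝ (Fin n) => (B + ‖x‖ ^ 2) ^ (-r) :=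
    integrable_weight hB (by linarith)
  have hmain := integral_dx_mul_statPow hB ht hnr h0 h1 i
  have hsplit : ∀ x : EuclideanSpace ℝ (Fin n), toFun (dx i h * statPow n hB (-r)) (t, x) =
      toFun f (t, x) + b * (B + ‖x‖ ^ 2) ^ (-r) := fun x => by
    have e1 : dx i h * statPow n hB (-r) = f + algebraMap ℝ (Sm n) b * statPow n hB (-r) := by
      rw [hf]; ring
    rw [e1, toFun_add ht, toFun_algebraMap_mul ht, toFun_statPow hB ht]
  simp only [hsplit] at hmain
  rw [integral_add hfi (hwi.const_mul b), integral_const_mul] at hmain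
  change _ = 2 * r * dualMoment hB h r i t at hmain
  have hbJ : |b| * J ≤ 2 * r * C + n * M * K *
      ∫ x : EuclideanSpace ℝ (Fin n), (B + ‖x‖ ^ 2) ^ (-(q - 1 / 2)) := by
    have hJ0 : 0 ≤ J := integral_nonneg fun x => by positivity
    rw [← abs_of_nonneg hJ0, ← abs_mul]
    have e2 : b * J = 2 * r * dualMoment hB h r i t - ∫ x, toFun f (t, x) := by linarith
    rw [e2]
    exact (abs_sub _ _).trans (add_le_add
      (abs_mul_le_mul (abs_of_nonneg (by linarith)).le hC) hfa)
  calc |b| * ∫ x : EuclideanSpace ℝ (Fin n), (B + ‖x‖ ^ 2) ^ (-(q + 1)) ≤ |b| * (K * J) :=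
        mul_le_mul_of_nonneg_left hJle (abs_nonneg b)
    _ = K * (|b| * J) := by ring
    _ ≤ _ := mul_le_mul_of_nonneg_left hbJ hK0

/-- In the resonant case the gradient at the origin decays at the full rate. -/
theorem exists_dx_origin_decay_of_resonant (hn : 2 ≤ n) (hq : q = n) (hB : 0 < B)
    (hh : IsFlow q B h) {T M : ℝ} (hM : 0 ≤ M) (hO : OriginSmall h T)
    (hH : HessDecay B h T (2 * q) M) :
    ∃ C : ℝ, ∀ t, T + 1 ≤ t → ∀ i, |toFun (dx i h) (t, 0)| ≤ C * Real.exp (-(2 * q) * t) := by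
  have hn2 : (2 : ℝ) ≤ n := by exact_mod_cast hn
  have hq0 : 0 < q := by linarith
  have hT := hO.pos
  obtain ⟨C, hC, hF⟩ := exists_flowDecay (c' := 3 / 2 * q) hq0.le hB hh hM hO hH (by linarith)
    (by linarith) (by linarith) (by linarith)
  obtain ⟨D, hD, H⟩ := exists_abs_deriv_dualMoment_le hn hq hB hh hT hC hF hH
  set J : ℝ := ∫ x : EuclideanSpace ℝ (Fin n), (B + ‖x‖ ^ 2) ^ (-(q + 1)) with hJ
  have hJ0 : 0 < J := integral_weight_pos hB (by linarith)
  set I : ℝ := ∫ x : EuclideanSpace ℝ (Fin n), (B + ‖x‖ ^ 2) ^ (-(q - 1 / 2)) with hI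
  set K : ℝ := max 1 (1 / B) with hK
  have hK0 : 0 ≤ K := zero_le_one.trans (le_max_left _ _)
  set D₂ : ℝ := D * Real.exp ((2 * q + 2) * (T + 1)) + 2 * D with hD₂
  have hD₂0 : 0 ≤ D₂ := by positivity
  refine ⟨K * (2 * (q + 1) * D₂ + n * M * K * I) / J, fun S hS i => ?_⟩
  have hS0 : 0 < S := by linarith
  set E := Real.exp (-(2 * q) * S) with hE
  have hE0 : 0 < E := Real.exp_pos _
  have hE1 : E ≤ 1 := Real.exp_le_one_iff.2 (by nlinarith)
  set r := q + E / 2 with hr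
  obtain ⟨hd, hb0, hb1⟩ := H r (by linarith) (by linarith) i
  have hu := abs_le_of_damped_forced (T := T + 1) (S := S) (l := 2 * r) (c := 3 * q) (M := D)
    (η := D * (r - q)) (by linarith) hS (by linarith) (by linarith) hD
    (mul_nonneg hD (by linarith)) (fun t ht => hd t (by linarith))
    (fun t ht => hb1 t (by linarith))
  have hu' : |dualMoment hB h r i S| ≤ D₂ * E := by
    refine hu.trans ?_
    have a1 : D / (3 * q - 2 * r) ≤ D := div_le_self hD (by linarith)
    have a2 : D * (r - q) / (2 * r) ≤ D * E := by
      refine (div_le_self (mul_nonneg hD (by linarith)) (by linarith)).trans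
        (mul_le_mul_of_nonneg_left (by linarith) hD)
    have a3 : Real.exp (-(2 * r) * S) ≤ E := Real.exp_le_exp.2 (by nlinarith)
    have a4 : |dualMoment hB h r i (T + 1)| * Real.exp (2 * r * (T + 1)) ≤
        D * Real.exp ((2 * q + 2) * (T + 1)) := by
      refine mul_le_mul (hb0 _ (by linarith)) (Real.exp_le_exp.2 ?_) (Real.exp_pos _).le hD
      exact mul_le_mul_of_nonneg_right (by linarith) (by linarith)
    have a5 : 0 ≤ D * Real.exp ((2 * q + 2) * (T + 1)) + D := by positivity
    have a6 := mul_le_mul (add_le_add a4 a1) a3 (Real.exp_pos _).le a5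
    have a7 : D₂ * E = (D * Real.exp ((2 * q + 2) * (T + 1)) + D) * E + D * E := by
      rw [hD₂]; ring
    rw [a7]
    exact add_le_add a6 a2
  have hTS : T ≤ S := by linarith
  have hEE : Real.exp (-(3 / 2 * q) * S) ≤ 1 := Real.exp_le_one_iff.2 (by nlinarith)
  have hfin := abs_dx_origin_le_dualMoment (h := h) (q := q) hB (r := r) (M := M * E) hS0
    (by positivity) (by linarith) (by linarith) (by linarith) (by linarith) i ?_ ?_ ?_ hu'
  · rw [div_mul_eq_mul_div, le_div_iff₀ hJ0]
    refine hfin.trans ?_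
    have b1 : 2 * r * (D₂ * E) ≤ 2 * (q + 1) * (D₂ * E) :=
      mul_le_mul_of_nonneg_right (by linarith) (by positivity)
    rw [show K * (2 * (q + 1) * D₂ + n * M * K * I) * E =
      K * ((2 * (q + 1) * D₂ + n * M * K * I) * E) by ring]
    refine mul_le_mul_of_nonneg_left (b := 2 * r * (D₂ * E) + n * (M * E) * K * I) ?_ hK0
    linarith
  · refine ⟨C, hC, fun z hz => ?_⟩
    rw [Real.rpow_one]
    have := (hF z (by rw [hz]; exact hTS)).1
    rw [hz] at this
    refine this.trans (mul_le_mul_of_nonneg_right ?_ (statP_pos hB z).le)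
    exact mul_le_of_le_one_right hC hEE
  · refine fun k => ⟨C, hC, fun z hz => ?_⟩
    rw [← Real.sqrt_eq_rpow]
    have := (hF z (by rw [hz]; exact hTS)).2.1 k
    rw [hz] at this
    refine this.trans (mul_le_mul_of_nonneg_right ?_ (Real.sqrt_nonneg _))
    exact mul_le_of_le_one_right hC hEE
  · intro z hz
    have := (hH z (by rw [hz]; exact hTS)).1
    rwa [hz] at this

end Sm

namespace Sm

variable {n : ℕ} {p q B : ℝ} {h : Sm n}

theorem exists_origin_asymptotic (hn : 1 ≤ n) (hp : 0 < p) (hq1 : 1 < q) (hpq : 2 * q = p + n)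
    (hB : 0 < B) (hh : IsFlow q B h) {T M : ℝ} (hM : 0 ≤ M) (hO : OriginSmall h T)
    (hH : HessDecay B h T (2 * p) M) :
    ∃ (C : ℝ) (b : Fin n → ℝ), 0 ≤ C ∧ ∀ t, T + 1 ≤ t →
      |toFun h (t, 0)| ≤ C * Real.exp (-(2 * p) * t) ∧
      ∀ i, |toFun (dx i h) (t, 0) - b i * Real.exp (-(2 * q) * t)| ≤
        C * Real.exp (-(2 * p) * t) := by
  have hn1 : (1 : ℝ) ≤ n := by exact_mod_cast hn
  have hq0 : 0 ≤ q := by linarith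
  rcases lt_trichotomy p n with hpn | hpn | hpn
  · obtain ⟨C, hC, H⟩ := exists_origin_decay (c' := 2 * p) hq0 hB hh hM hO hH (by linarith)
      (by linarith) le_rfl (by linarith)
    refine ⟨C, 0, hC, fun t ht => ⟨(H t (by linarith)).1, fun i => ?_⟩⟩
    simpa using ((H t (by linarith)).2 i).1
  · have hqp : q = p := by linarith
    have hn2 : 2 ≤ n := by
      have : (1 : ℝ) < n := by linarith
      exact_mod_cast this
    obtain ⟨C, hC, H⟩ := exists_origin_decay (c' := p) hq0 hB hh hM hO hH (by linarith)
      (by linarith) (by linarith) (by linarith)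
    obtain ⟨D, hD⟩ := exists_dx_origin_decay_of_resonant hn2 (by linarith) hB hh hM hO
      (by rwa [hqp])
    refine ⟨C + |D|, 0, by positivity, fun t ht => ⟨?_, fun i => ?_⟩⟩
    · refine (H t (by linarith)).1.trans (mul_le_mul_of_nonneg_right ?_ (Real.exp_pos _).le)
      linarith [abs_nonneg D]
    · have := hD t ht i
      rw [hqp] at this
      simp only [Pi.zero_apply, zero_mul, sub_zero]
      refine this.trans (mul_le_mul_of_nonneg_right ?_ (Real.exp_pos _).le)
      linarith [le_abs_self D]
  · obtain ⟨C, hC, H⟩ := exists_origin_decay (c' := p) hq0 hB hh hM hO hH (by linarith)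
      (by linarith) (by linarith) (by linarith)
    have key : ∀ i, ∃ L D : ℝ, ∀ t, T ≤ t →
        |toFun (dx i h) (t, 0) - L * Real.exp (-(2 * q) * t)| ≤ D * Real.exp (-(2 * p) * t) :=
      fun i => exists_asymptotic_of_damped hC (by linarith)
        (fun t ht => hasDerivAt_time (dx i h) (hO.pos.trans_le ht) 0)
        fun t ht => ((H t ht).2 i).2
    choose b D hbD using key
    refine ⟨C + ∑ i, |D i|, b, by positivity, fun t ht => ⟨?_, fun i => ?_⟩⟩
    · refine (H t (by linarith)).1.trans (mul_le_mul_of_nonneg_right ?_ (Real.exp_pos _).le)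
      have : 0 ≤ ∑ i, |D i| := by positivity
      linarith
    · refine (hbD i t (by linarith)).trans (mul_le_mul_of_nonneg_right ?_ (Real.exp_pos _).le)
      have h1 : |D i| ≤ ∑ i, |D i| :=
        Finset.single_le_sum (f := fun i => |D i|) (fun _ _ => abs_nonneg _) (Finset.mem_univ i)
      linarith [le_abs_self (D i)]

/-- The deviation agrees with a translation mode up to the second relaxation rate. -/
theorem exists_first_order (hn : 1 ≤ n) (hp : 0 < p) (hq1 : 1 < q) (hpq : 2 * q = p + n)
    (hB : 0 < B) (hh : IsFlow q B h)
    (hsmall : ∀ δ > 0, ∃ T : ℝ, 0 < T ∧ ∀ z : SpaceTime n, T ≤ z.1.1 →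
      |ev z h| ≤ δ * ev z (statP n B)) :
    ∃ (T C : ℝ) (b : Fin n → ℝ), 0 ≤ C ∧ ∀ z : SpaceTime n, T ≤ z.1.1 →
      |ev z h - Real.exp (-(2 * q) * z.1.1) * ∑ i, b i * z.1.2 i| ≤
        C * Real.exp (-(2 * p) * z.1.1) * ev z (statP n B) := by
  obtain ⟨T, M, hM, hO, hH⟩ := exists_hessDecay hn hp hpq hB hh hsmall
  obtain ⟨C, b, hC, H⟩ := exists_origin_asymptotic hn hp hq1 hpq hB hh hM hO hH
  refine ⟨T + 1, C * (1 / B) + n * (C * (1 + 1 / B)) + n ^ 2 * M, b, by positivity,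
    fun z hz => ?_⟩
  obtain ⟨⟨t, x⟩, ht⟩ := z
  simp only at hz ht ⊢
  have h1 := abs_taylor_le (h := h) (M := M * Real.exp (-(2 * p) * t)) ht (fun z hz' => by
    have := (hH z (by rw [hz']; linarith)).1
    rwa [hz'] at this) 0 x
  set w := ev (⟨(t, x), ht⟩ : SpaceTime n) (statP n B) with hw
  have hw0 : 0 < w := statP_pos hB _
  have hxw : ‖x‖ ^ 2 ≤ w := by rw [hw, ev_statP_eq_norm]; simp only; linarith
  have hx1 : ‖x‖ ≤ (1 + 1 / B) * w := norm_le_statP hB (⟨(t, x), ht⟩ : SpaceTime n)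
  have h1w : 1 ≤ 1 / B * w := one_le_statP hB _
  set E := Real.exp (-(2 * p) * t) with hEd
  have hE0 : 0 < E := Real.exp_pos _
  have h2 : |toFun h (t, 0)| ≤ C * E * (1 / B * w) :=
    (H t hz).1.trans (le_mul_of_one_le_right (by positivity) h1w)
  have h3 : |∑ i, x i * (toFun (dx i h) (t, 0) - b i * Real.exp (-(2 * q) * t))| ≤
      n * ((1 + 1 / B) * w * (C * E)) :=
    abs_sum_fin_le fun i => abs_mul_le_mul ((abs_coord_le_norm x i).trans hx1) ((H t hz).2 i)
  have h4 : n ^ 2 * (M * E) * ‖x‖ ^ 2 ≤ n ^ 2 * (M * E) * w := by gcongr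
  have h5 : ev (⟨(t, x), ht⟩ : SpaceTime n) h = toFun h (t, 0 + x) := by
    rw [zero_add]; exact (toFun_eq_ev ht h x).symm
  have h7 : ∑ i, x i * (toFun (dx i h) (t, 0) - b i * Real.exp (-(2 * q) * t)) =
      ∑ i, x i * toFun (dx i h) (t, 0) - Real.exp (-(2 * q) * t) * ∑ i, b i * x i := by
    rw [Finset.mul_sum, ← Finset.sum_sub_distrib]
    exact Finset.sum_congr rfl fun i _ => by ring
  rw [h5]
  rw [h7] at h3
  have h6 := h1.trans h4
  rw [abs_le] at *
  constructor <;> linarith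

end Sm

namespace Sm

variable {n : ℕ}

/-- The pressure of a solution of the fast diffusion equation solves the pressure equation. -/
theorem dt_rpow_of_fastDiffusion {R : Sm n} (hR : ∀ z, 0 < ev z R) {m q : ℝ} (hm : m ≠ 0)
    (hq : q * (1 - m) = 1)
    (h : algebraMap ℝ (Sm n) m * dt R = lapD dx (rpow R hR m)) :
    dt (rpow R hR (m - 1)) = rpow R hR (m - 1) * lapD dx (rpow R hR (m - 1)) -
      algebraMap ℝ (Sm n) q * ∑ k, dx k (rpow R hR (m - 1)) ^ 2 := by
  set a := rpow R hR (m - 3) with ha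
  have hmul : ∀ s, rpow R hR (s + 1) = rpow R hR s * R := fun s => by
    rw [← rpow_mul_rpow, rpow_one]
  have e2 : rpow R hR (m - 2) = a * R := by rw [ha, ← hmul]; congr 1; ring
  have e1 : rpow R hR (m - 1) = a * R * R := by rw [← e2, ← hmul]; congr 1; ring
  have d2 : ∀ v, dir v (a * R) = algebraMap ℝ (Sm n) (m - 2) * a * dir v R := fun v => by
    rw [← e2, dir_rpow, ha]; congr 3; ring
  have d1 : ∀ v, dir v (a * R * R) = algebraMap ℝ (Sm n) (m - 1) * (a * R) * dir v R := fun v => by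
    rw [← e1, dir_rpow, ← e2]; congr 3; ring
  have d0 : ∀ v, dir v (rpow R hR m) = algebraMap ℝ (Sm n) m * (a * R * R) * dir v R := fun v => by
    rw [dir_rpow, e1]
  have cst : ∀ (v) (r : ℝ), dir v (algebraMap ℝ (Sm n) r) = 0 := fun v r =>
    Derivation.map_algebraMap _ r
  have hμ : IsUnit (algebraMap ℝ (Sm n) m) := (IsUnit.mk0 m hm).map _
  have hflow : dt R = ∑ k, (algebraMap ℝ (Sm n) (m - 1) * (a * R) * dx k R * dx k R +
      a * R * R * dx k (dx k R)) := by
    refine hμ.mul_left_cancel ?_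
    rw [h, lapD, Finset.mul_sum]
    refine Finset.sum_congr rfl fun k _ => ?_
    have d0' : dx k (rpow R hR m) = algebraMap ℝ (Sm n) m * (a * R * R) * dx k R := d0 _
    have d1' : dx k (a * R * R) = algebraMap ℝ (Sm n) (m - 1) * (a * R) * dx k R := d1 _
    have c0 : dx k (algebraMap ℝ (Sm n) m) = 0 := cst _ _
    rw [d0', mul_assoc, Derivation.leibniz, c0, smul_zero, add_zero, Derivation.leibniz, d1']
    simp only [smul_eq_mul]; ring
  have hq' : algebraMap ℝ (Sm n) q * (1 - algebraMap ℝ (Sm n) m) = 1 := by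
    rw [← map_one (algebraMap ℝ (Sm n)), ← map_sub, ← map_mul, hq]
  rw [e1]
  have t1 : dt (a * R * R) = algebraMap ℝ (Sm n) (m - 1) * (a * R) * dt R := d1 _
  rw [t1, hflow, lapD, Finset.mul_sum, Finset.mul_sum, Finset.mul_sum, ← Finset.sum_sub_distrib]
  refine Finset.sum_congr rfl fun k _ => ?_
  have x1 : dx k (a * R * R) = algebraMap ℝ (Sm n) (m - 1) * (a * R) * dx k R := d1 _
  have x2 : dx k (dx k (a * R * R)) = algebraMap ℝ (Sm n) (m - 1) *
      (algebraMap ℝ (Sm n) (m - 2) * a * dx k R * dx k R + a * R * dx k (dx k R)) := by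
    have d2' : dx k (a * R) = algebraMap ℝ (Sm n) (m - 2) * a * dx k R := d2 _
    have c0 : dx k (algebraMap ℝ (Sm n) (m - 1)) = 0 := cst _ _
    rw [x1, mul_assoc, Derivation.leibniz, c0, smul_zero, add_zero, Derivation.leibniz, d2']
    simp only [smul_eq_mul]; ring
  rw [x2, x1]
  simp only [map_sub, map_one, map_ofNat]
  linear_combination (-(algebraMap ℝ (Sm n) m - 1) * a ^ 2 * R ^ 2 * dx k R ^ 2) * hq'

theorem ev_lapD (f : Sm n) {t : ℝ} (ht : 0 < t) (x : EuclideanSpace ℝ (Fin n)) :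
    ev (pt t ht x) (lapD dx f) = lap n (fun x => toFun f (t, x)) x := by
  have h1 : ∀ (g : Sm n) i, (fun y => fderiv ℝ (fun x => toFun g (t, x)) y (stdBasis n i)) =
      fun y => toFun (dx i g) (t, y) := fun g i => funext fun y => (toFun_dx ht g i y).2
  simp only [lap, lapD, map_sum, h1]
  exact Finset.sum_congr rfl fun i _ => by rw [(toFun_dx ht _ i x).2, toFun_eq_ev ht]

section SelfSimilar

/-- The change of variables to self-similar coordinates. -/
def selfSim (n : ℕ) (p q : ℝ) (z : ℝ × EuclideanSpace ℝ (Fin n)) : ℝ × EuclideanSpace ℝ (Fin n) :=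
  ((Real.exp (2 * p * z.1) - 1) / (2 * p), Real.exp (2 * q * z.1) • z.2)

variable {p q : ℝ}

theorem selfSim_pos (hp : 0 < p) (q : ℝ) {z : ℝ × EuclideanSpace ℝ (Fin n)} (hz : 0 < z.1) :
    0 < (selfSim n p q z).1 :=
  div_pos (sub_pos.2 (Real.one_lt_exp_iff.2 (by positivity))) (by positivity)

theorem contDiff_selfSim (n : ℕ) (p q : ℝ) : ContDiff ℝ (⊤ : ℕ∞) (selfSim n p q) := by
  unfold selfSim; fun_prop

/-- A smooth function in self-similar coordinates. -/
def pullback (hp : 0 < p) (q : ℝ) (f : Sm n) : Sm n :=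
  mk' (fun z => toFun f (selfSim n p q z))
    ((Sm.contDiffOn f).comp (contDiff_selfSim n p q).contDiffOn fun _ hz => selfSim_pos hp q hz)

/-- A point in self-similar coordinates. -/
def simPt (hp : 0 < p) (q : ℝ) (z : SpaceTime n) : SpaceTime n :=
  ⟨selfSim n p q z.1, selfSim_pos hp q z.2⟩

theorem ev_pullback (hp : 0 < p) (q : ℝ) (f : Sm n) (z : SpaceTime n) :
    ev z (pullback hp q f) = ev (simPt hp q z) f := by
  rw [pullback, ev_mk', ← toFun_apply]; rfl

theorem hasFDerivAt_selfSim (hp : 0 < p) (q : ℝ) (z : ℝ × EuclideanSpace ℝ (Fin n)) :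
    ∃ L : ℝ × EuclideanSpace ℝ (Fin n) →L[ℝ] ℝ × EuclideanSpace ℝ (Fin n),
      HasFDerivAt (selfSim n p q) L z ∧
      L (1, 0) = (Real.exp (2 * p * z.1), (2 * q * Real.exp (2 * q * z.1)) • z.2) ∧
      ∀ v, L (0, v) = (0, Real.exp (2 * q * z.1) • v) := by
  have h1 : HasFDerivAt (fun z : ℝ × EuclideanSpace ℝ (Fin n) =>
      (Real.exp (2 * p * z.1) - 1) / (2 * p)) _ z :=
    (((hasDerivAt_exp_mul (2 * p) z.1).sub_const 1).div_const (2 * p)).comp_hasFDerivAt z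
      (hasFDerivAt_fst (𝕜 := ℝ) (p := z))
  have h2 : HasFDerivAt (fun z : ℝ × EuclideanSpace ℝ (Fin n) => Real.exp (2 * q * z.1)) _ z :=
    (hasDerivAt_exp_mul (2 * q) z.1).comp_hasFDerivAt z (hasFDerivAt_fst (𝕜 := ℝ) (p := z))
  refine ⟨_, h1.prodMk (h2.smul hasFDerivAt_snd), ?_, fun v => ?_⟩
  · simp [hp.ne']
  · simp

theorem ev_dir_pullback (hp : 0 < p) (q : ℝ) (f : Sm n) (z : SpaceTime n)
    {L : ℝ × EuclideanSpace ℝ (Fin n) →L[ℝ] ℝ × EuclideanSpace ℝ (Fin n)}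
    (hL : HasFDerivAt (selfSim n p q) L z.1) (v : ℝ × EuclideanSpace ℝ (Fin n)) :
    ev z (dir v (pullback hp q f)) = ev (simPt hp q z) (dir (L v) f) := by
  rw [ev_dir_of (g := fun z => toFun f (selfSim n p q z)) fun z => by
    rw [ev_pullback, ← toFun_apply]; rfl]
  have h1 := (differentiableAt f (simPt hp q z)).hasFDerivAt
  have h2 : HasFDerivAt (fun z => toFun f (selfSim n p q z)) _ z.1 := HasFDerivAt.comp z.1 h1 hL
  rw [h2.fderiv, ev_dir]; rfl

theorem ev_dx_pullback (hp : 0 < p) (q : ℝ) (f : Sm n) (z : SpaceTime n) (k : Fin n) :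
    ev z (dx k (pullback hp q f)) =
      Real.exp (2 * q * z.1.1) * ev z (pullback hp q (dx k f)) := by
  obtain ⟨L, hL, -, h2⟩ := hasFDerivAt_selfSim hp q z.1
  rw [dx, ev_dir_pullback hp q f z hL, h2, ev_pullback, ev_dir, ev_dir]
  have : ((0, Real.exp (2 * q * z.1.1) • stdBasis n k) : ℝ × EuclideanSpace ℝ (Fin n)) =
      Real.exp (2 * q * z.1.1) • (0, stdBasis n k) := by simp
  rw [this, map_smul, smul_eq_mul]

theorem ev_dt_pullback (hp : 0 < p) (q : ℝ) (f : Sm n) (z : SpaceTime n) :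
    ev z (dt (pullback hp q f)) = Real.exp (2 * p * z.1.1) * ev z (pullback hp q (dt f)) +
      2 * q * ∑ k, z.1.2 k * ev z (dx k (pullback hp q f)) := by
  obtain ⟨L, hL, h1, -⟩ := hasFDerivAt_selfSim hp q z.1
  have : ((Real.exp (2 * p * z.1.1), (2 * q * Real.exp (2 * q * z.1.1)) • z.1.2) :
      ℝ × EuclideanSpace ℝ (Fin n)) = Real.exp (2 * p * z.1.1) • (1, 0) +
        (2 * q * Real.exp (2 * q * z.1.1)) • (0, z.1.2) := by simp
  rw [dt, ev_dir_pullback hp q f z hL, h1, this, ev_dir, map_add, map_smul, map_smul, smul_eq_mul,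
    smul_eq_mul, ← ev_dir, ← ev_dir, ev_dir_space, ev_pullback, mul_assoc (2 * q), Finset.mul_sum]
  simp only [ev_dx_pullback, ev_pullback]
  congr 2
  exact Finset.sum_congr rfl fun k _ => by ring

/-- In self-similar coordinates the rescaled pressure is a perturbation of the stationary
pressure evolving by the flow. -/
theorem isFlow_pullback (hp : 0 < p) (hpq : 2 * q = p + n) (B : ℝ) {V : Sm n}
    (hV : dt V = V * lapD dx V - algebraMap ℝ (Sm n) q * ∑ k, dx k V ^ 2) :
    IsFlow q B (time (fun t => Real.exp (-(2 * n) * t)) (by fun_prop) * pullback hp q V -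
      statP n B) := by
  set G : ℝ → ℝ := fun t => Real.exp (-(2 * n) * t) with hG
  have hGd : ContDiff ℝ (⊤ : ℕ∞) G := by simp only [hG]; fun_prop
  set P : Sm n := time G hGd * pullback hp q V with hP
  have e1 : ∀ k, dx k P = time G hGd * dx k (pullback hp q V) := fun k => by
    rw [hP, Derivation.leibniz, dx_time, smul_zero, add_zero, smul_eq_mul]
  have e2 : ∀ k, dx k (dx k P) = time G hGd * dx k (dx k (pullback hp q V)) := fun k => by
    rw [e1, Derivation.leibniz, dx_time, smul_zero, add_zero, smul_eq_mul]
  have e2' : ∀ k z, ev z (dx k (dx k (pullback hp q V))) = Real.exp (2 * q * z.1.1) *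
      (Real.exp (2 * q * z.1.1) * ev (simPt hp q z) (dx k (dx k V))) := fun k z => by
    have h1 : dx k (pullback hp q V) =
        time (fun t => Real.exp (2 * q * t)) (by fun_prop) * pullback hp q (dx k V) :=
      ext_ev fun z => by rw [ev_dx_pullback, map_mul, ev_time]
    rw [h1, Derivation.leibniz, dx_time, smul_zero, add_zero, smul_eq_mul, map_mul, ev_time,
      ev_dx_pullback, ev_pullback]
  have hpde : dt P = P * lapD dx P - algebraMap ℝ (Sm n) q * ∑ k, dx k P ^ 2 +
      2 * algebraMap ℝ (Sm n) q * ∑ k, X k * dx k P - 2 * algebraMap ℝ (Sm n) n * P := by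
    refine ext_ev fun z => ?_
    have hGt : ev z (dt (time G hGd)) = -(2 * n) * G z.1.1 := by
      rw [ev_dt_time]
      exact (hasDerivAt_exp_mul (-(2 * n)) z.1.1).deriv
    have hexp : G z.1.1 * Real.exp (2 * p * z.1.1) =
        G z.1.1 ^ 2 * Real.exp (2 * q * z.1.1) ^ 2 := by
      simp only [hG]
      rw [← Real.exp_nat_mul, ← Real.exp_nat_mul, ← Real.exp_add, ← Real.exp_add]
      congr 1; push_cast; linear_combination (-2 * z.1.1) * hpq
    have hVz := congrArg (ev (simPt hp q z)) hV
    simp only [map_sub, map_mul, map_sum, map_pow, lapD, ev_algebraMap] at hVz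
    have s1 : ev z (lapD dx P) = G z.1.1 * Real.exp (2 * q * z.1.1) ^ 2 *
        ∑ k, ev (simPt hp q z) (dx k (dx k V)) := by
      rw [lapD, map_sum, Finset.mul_sum]
      refine Finset.sum_congr rfl fun k _ => ?_
      rw [e2, map_mul, e2', ev_time]; ring
    simp only [map_sub, map_add, map_mul, map_sum, map_pow, ev_algebraMap, ev_two, e1, s1,
      ev_X, ev_time, ev_dx_pullback, ev_pullback]
    rw [hP, Derivation.leibniz]
    simp only [map_add, smul_eq_mul, map_mul, hGt, ev_dt_pullback, ev_time, ev_pullback, hVz,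
      ev_dx_pullback]
    set g := G z.1.1
    set l := Real.exp (2 * q * z.1.1)
    set v := ev (simPt hp q z) V
    have s2 : ∑ k, (g * (l * ev (simPt hp q z) (dx k V))) ^ 2 =
        g ^ 2 * l ^ 2 * ∑ k, ev (simPt hp q z) (dx k V) ^ 2 := by
      rw [Finset.mul_sum]; exact Finset.sum_congr rfl fun k _ => by ring
    have s3 : ∑ k, z.1.2 k * (g * (l * ev (simPt hp q z) (dx k V))) =
        g * ∑ k, z.1.2 k * (l * ev (simPt hp q z) (dx k V)) := by
      rw [Finset.mul_sum]; exact Finset.sum_congr rfl fun k _ => by ring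
    rw [s2, s3]
    linear_combination (v * ∑ k, ev (simPt hp q z) (dx k (dx k V)) -
      q * ∑ k, ev (simPt hp q z) (dx k V) ^ 2) * hexp
  have hPW : P = statP n B + (P - statP n B) := by ring
  set h := P - statP n B with hh
  have f1 : ∀ k, dx k P = 2 * X k + dx k h := fun k => by
    rw [hh, map_sub, dx_statP]; ring
  have f2 : lapD dx P = 2 * algebraMap ℝ (Sm n) n + lapD dx h := by
    have : ∀ k, dx k (dx k P) = 2 + dx k (dx k h) := fun k => by
      rw [f1, map_add, Derivation.leibniz, dx_X, if_pos rfl, Derivation.map_two]; simp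
    simp only [lapD, this, Finset.sum_add_distrib]
    simp [mul_comm]
  have f3 : dt P = dt h := by rw [hh, map_sub, dt_statP, sub_zero]
  have f4 : ∑ k, dx k P ^ 2 = 4 * ∑ k, X k ^ 2 + 4 * ∑ k, X k * dx k h + ∑ k, dx k h ^ 2 := by
    rw [Finset.mul_sum, Finset.mul_sum, ← Finset.sum_add_distrib, ← Finset.sum_add_distrib]
    exact Finset.sum_congr rfl fun k _ => by rw [f1]; ring
  have f5 : ∑ k, X k * dx k P = 2 * ∑ k, X k ^ 2 + ∑ k, X k * dx k h := by
    rw [Finset.mul_sum, ← Finset.sum_add_distrib]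
    exact Finset.sum_congr rfl fun k _ => by rw [f1]; ring
  unfold IsFlow
  rw [← f3, hpde, f4, f5, f2, ← hPW]
  ring

end SelfSimilar

end Sm

namespace Sm

variable {n : ℕ}

/-- After a suitable translation, the pressure converges at the fast rate to the stationary
pressure. -/
theorem exists_translation_pressure (hn : 1 ≤ n) {p q B : ℝ} (hp : 0 < p) (hq1 : 1 < q)
    (hpq : 2 * q = p + n) (hB : 0 < B) {P : Sm n} (hh : IsFlow q B (P - statP n B))
    (hsmall : ∀ δ > 0, ∃ T, 0 < T ∧ ∀ z : SpaceTime n, T ≤ z.1.1 →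
      |ev z (P - statP n B)| ≤ δ * ev z (statP n B)) :
    ∃ (a : EuclideanSpace ℝ (Fin n)) (K T : ℝ), 0 ≤ K ∧ ∀ t (ht : 0 < t), T ≤ t → ∀ x,
      |ev (pt t ht (x - Real.exp (-(2 * q) * t) • a)) P - (B + ‖x‖ ^ 2)| ≤
        K * Real.exp (-(2 * p) * t) * (B + ‖x‖ ^ 2) := by
  obtain ⟨T, C, b, hC, hb⟩ := exists_first_order hn hp hq1 hpq hB hh hsmall
  set a : EuclideanSpace ℝ (Fin n) := WithLp.toLp 2 fun i => b i / 2 with ha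
  refine ⟨a, ‖a‖ ^ 2 / B + C * (2 + 2 * ‖a‖ ^ 2 / B), T, by positivity, fun t ht hT x => ?_⟩
  set e := Real.exp (-(2 * p) * t) with he
  set s := Real.exp (-(2 * q) * t) with hs
  set c : EuclideanSpace ℝ (Fin n) := s • a with hc
  have hs0 : 0 ≤ s := (Real.exp_pos _).le
  have hs1 : s ^ 2 ≤ e := by
    rw [hs, he, ← Real.exp_nat_mul]
    refine Real.exp_le_exp.2 ?_
    have : 0 ≤ t * n := by positivity
    push_cast
    linear_combination 2 * this - 2 * t * hpq
  have he1 : e ≤ 1 := Real.exp_le_one_iff.2 (by nlinarith [mul_pos hp ht])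
  have hcn : ‖c‖ ^ 2 = s ^ 2 * ‖a‖ ^ 2 := by
    rw [hc, norm_smul, Real.norm_of_nonneg hs0, mul_pow]
  have hW : B ≤ B + ‖x‖ ^ 2 := by have := sq_nonneg ‖x‖; linarith
  have hce : ‖c‖ ^ 2 ≤ ‖a‖ ^ 2 / B * e * (B + ‖x‖ ^ 2) := by
    have h1 : ‖c‖ ^ 2 ≤ e * ‖a‖ ^ 2 := hcn ▸ mul_le_mul_of_nonneg_right hs1 (by positivity)
    have h2 : e * ‖a‖ ^ 2 = ‖a‖ ^ 2 / B * e * B := by field_simp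
    exact h1.trans (h2.le.trans (mul_le_mul_of_nonneg_left hW (by positivity)))
  have hc1 : ‖c‖ ^ 2 ≤ ‖a‖ ^ 2 / B * (B + ‖x‖ ^ 2) :=
    hce.trans (mul_le_mul_of_nonneg_right (mul_le_of_le_one_right (by positivity) he1)
      (by positivity))
  have hsum : s * ∑ i, b i * (x - c) i = 2 * inner ℝ x c - 2 * ‖c‖ ^ 2 := by
    have h1 : ∑ i, b i * (x - c) i = 2 * inner ℝ (x - c) a := by
      rw [PiLp.inner_apply, Finset.mul_sum]
      refine Finset.sum_congr rfl fun i _ => ?_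
      simp only [ha, RCLike.inner_apply, conj_trivial]; ring
    have h2 : s * inner ℝ (x - c) a = inner ℝ (x - c) c := by rw [hc, inner_smul_right]
    rw [h1, ← real_inner_self_eq_norm_sq, ← mul_sub, ← inner_sub_left, ← h2]; ring
  have hsub : ‖x - c‖ ^ 2 = ‖x‖ ^ 2 - 2 * inner ℝ x c + ‖c‖ ^ 2 := norm_sub_sq_real x c
  have hadd : ‖x - c‖ ^ 2 ≤ 2 * ‖x‖ ^ 2 + 2 * ‖c‖ ^ 2 := by
    have h1 := norm_add_sq_real x c
    have h2 := sq_nonneg ‖x + c‖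
    linarith
  have h1 := hb (pt t ht (x - c)) hT
  rw [map_sub, ev_statP_eq_norm] at h1
  simp only [pt_time, pt_space] at h1
  rw [hsum] at h1
  have h2 : C * e * (B + ‖x - c‖ ^ 2) ≤ C * (2 + 2 * ‖a‖ ^ 2 / B) * e * (B + ‖x‖ ^ 2) := by
    have h3 : B + ‖x - c‖ ^ 2 ≤ (2 + 2 * ‖a‖ ^ 2 / B) * (B + ‖x‖ ^ 2) := by
      have h4 : 2 * ‖a‖ ^ 2 / B * (B + ‖x‖ ^ 2) = 2 * (‖a‖ ^ 2 / B * (B + ‖x‖ ^ 2)) := by ring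
      linarith
    calc C * e * (B + ‖x - c‖ ^ 2) ≤ C * e * ((2 + 2 * ‖a‖ ^ 2 / B) * (B + ‖x‖ ^ 2)) :=
          mul_le_mul_of_nonneg_left h3 (mul_nonneg hC (Real.exp_pos _).le)
      _ = _ := by ring
  have h3 : (‖a‖ ^ 2 / B + C * (2 + 2 * ‖a‖ ^ 2 / B)) * e * (B + ‖x‖ ^ 2) =
      ‖a‖ ^ 2 / B * e * (B + ‖x‖ ^ 2) + C * (2 + 2 * ‖a‖ ^ 2 / B) * e * (B + ‖x‖ ^ 2) := by ring
  have h4 := sq_nonneg ‖c‖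
  rw [h3]
  rw [hsub] at h1 h2
  rw [abs_le] at *
  constructor <;> linarith

/-- The pressure equation for a smooth positive solution of the fast diffusion equation. -/
theorem fastDiffusion_mk' {m : ℝ} (hm : m ≠ 0) {ρ : ℝ → EuclideanSpace ℝ (Fin n) → ℝ}
    (hρ : IsFDESol n m ρ)
    (hs : ContDiffOn ℝ (⊤ : ℕ∞) (fun z : ℝ × EuclideanSpace ℝ (Fin n) => ρ z.1 z.2) (posTime n))
    (hR : ∀ z, 0 < ev z (mk' _ hs)) :
    algebraMap ℝ (Sm n) m * dt (mk' _ hs) = lapD dx (rpow (mk' _ hs) hR m) := by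
  refine ext_ev fun z => ?_
  obtain ⟨⟨t, x⟩, ht⟩ := z
  have ht' : 0 < t := ht
  have h1 : deriv (fun s => ρ s x) t = ev (pt t ht' x) (dt (mk' _ hs)) := by
    rw [← toFun_eq_ev, ← (hasDerivAt_time _ ht' x).deriv]
    refine Filter.EventuallyEq.deriv_eq ?_
    filter_upwards [lt_mem_nhds ht'] with s hs'
    rw [toFun_eq_ev hs']; rfl
  have h2 : (fun x => toFun (rpow (mk' _ hs) hR m) (t, x)) = fun x => ρ t x ^ m :=
    funext fun x => by rw [toFun_eq_ev ht', ev_rpow]; rfl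
  have h3 := hρ.2.2.2 t ht' x
  rw [h1, ← h2, ← ev_lapD _ ht'] at h3
  rw [map_mul, ev_algebraMap]
  change m * ev (pt t ht' x) _ = ev (pt t ht' x) _
  rw [h3]; field_simp

end Sm


theorem pPar_pos {n : ℕ} (hn : 1 ≤ n) {m : ℝ} (hm1 : m < 1) (hm : ((n : ℝ) - 2) / n < m) :
    0 < pPar n m := by
  have hn' : (0 : ℝ) < n := by exact_mod_cast hn
  have h1 : (n : ℝ) - 2 < m * n := (div_lt_iff₀ hn').1 hm
  rw [pPar, sub_pos, lt_div_iff₀ (sub_pos.2 hm1)]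
  linarith

theorem pPar_add (n : ℕ) {m : ℝ} : 2 * (1 / (1 - m)) = pPar n m + n := by
  rw [pPar]; ring

theorem betaPar_mul {n : ℕ} {m : ℝ} (hp : 0 < pPar n m) :
    2 * pPar n m * betaPar n m = 2 * (1 / (1 - m)) := by
  rw [pPar_add n, betaPar]; field_simp

/-- The Barenblatt solution in self-similar coordinates. -/
theorem rhoB_selfSim {n : ℕ} {m : ℝ} (hp : 0 < pPar n m) (B t : ℝ) (x : EuclideanSpace ℝ (Fin n)) :
    rhoB n m B ((Real.exp (2 * pPar n m * t) - 1) / (2 * pPar n m))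
        (Real.exp (2 * (1 / (1 - m)) * t) • x) =
      Real.exp (-(2 * n) * (1 / (1 - m)) * t) * (B + ‖x‖ ^ 2) ^ (-(1 / (1 - m))) := by
  have h1 : 1 + 2 * pPar n m * ((Real.exp (2 * pPar n m * t) - 1) / (2 * pPar n m)) =
      Real.exp (2 * pPar n m * t) := by field_simp; ring
  have h2 : Real.exp (2 * pPar n m * t) ^ (-betaPar n m) = Real.exp (-(2 * (1 / (1 - m)) * t)) := by
    rw [← Real.exp_mul]; congr 1; linear_combination (-t) * betaPar_mul hp
  have h3 : Real.exp (2 * pPar n m * t) ^ (-(n : ℝ) * betaPar n m) =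
      Real.exp (-(2 * n) * (1 / (1 - m)) * t) := by
    rw [← Real.exp_mul]; congr 1; linear_combination (-t * n) * betaPar_mul hp
  rw [rhoB, uB, h1, h2, h3, smul_smul, ← Real.exp_add, neg_add_cancel, Real.exp_zero, one_smul]

/-- The relative deviation from the Barenblatt solution in terms of pressures. -/
theorem div_rhoB_selfSim {n : ℕ} {m B : ℝ} (hm1 : m < 1) (hp : 0 < pPar n m) (hB : 0 < B) (t : ℝ)
    (x : EuclideanSpace ℝ (Fin n)) {r : ℝ} (hr : 0 < r) :
    r / rhoB n m B ((Real.exp (2 * pPar n m * t) - 1) / (2 * pPar n m))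
        (Real.exp (2 * (1 / (1 - m)) * t) • x) =
      (Real.exp (-(2 * n) * t) * r ^ (m - 1) / (B + ‖x‖ ^ 2)) ^ (-(1 / (1 - m))) := by
  have hW : 0 < B + ‖x‖ ^ 2 := by positivity
  have hm' : 1 - m ≠ 0 := (sub_pos.2 hm1).ne'
  have h1 : (r ^ (m - 1)) ^ (-(1 / (1 - m))) = r := by
    rw [← Real.rpow_mul hr.le]
    have : (m - 1) * -(1 / (1 - m)) = 1 := by field_simp; ring
    rw [this, Real.rpow_one]
  have h2 : Real.exp (-(2 * n) * t) ^ (-(1 / (1 - m))) =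
      (Real.exp (-(2 * n) * (1 / (1 - m)) * t))⁻¹ := by
    rw [← Real.exp_mul, ← Real.exp_neg]; congr 1; ring
  rw [rhoB_selfSim hp, Real.div_rpow (by positivity) hW.le,
    Real.mul_rpow (Real.exp_pos _).le (Real.rpow_nonneg hr.le _), h1, h2]
  field_simp

theorem eventually_abs_rpow_sub_one_le (s : ℝ) {δ : ℝ} (hδ : 0 < δ) :
    ∃ ε > 0, ∀ r : ℝ, |r - 1| ≤ ε → |r ^ s - 1| ≤ δ := by
  have h1 : ContinuousAt (fun r : ℝ => r ^ s) 1 :=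
    Real.continuousAt_rpow_const 1 s (Or.inl one_ne_zero)
  obtain ⟨ε, hε, h2⟩ := Metric.continuousAt_iff.1 h1 δ hδ
  refine ⟨ε / 2, half_pos hε, fun r hr => ?_⟩
  have h3 := h2 (x := r) (by rw [Real.dist_eq]; linarith)
  rw [Real.dist_eq, Real.one_rpow] at h3
  exact h3.le

theorem exists_abs_rpow_sub_one_le_mul (s : ℝ) :
    ∃ ε > 0, ∃ K ≥ 0, ∀ r : ℝ, |r - 1| ≤ ε → |r ^ s - 1| ≤ K * |r - 1| := by
  have h1 : (fun r : ℝ => r ^ s - 1 ^ s) =O[𝓝 1] fun r => r - 1 :=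
    (Real.hasDerivAt_rpow_const (Or.inl one_ne_zero)).isBigO_sub
  obtain ⟨K, hK, h2⟩ := h1.exists_nonneg
  obtain ⟨ε, hε, h3⟩ := Metric.eventually_nhds_iff.1 h2.bound
  refine ⟨ε / 2, half_pos hε, K, hK, fun r hr => ?_⟩
  have h4 := h3 (y := r) (by rw [Real.dist_eq]; linarith)
  simpa using h4

theorem tendsto_selfSim_time {p : ℝ} (hp : 0 < p) :
    Tendsto (fun t => (Real.exp (2 * p * t) - 1) / (2 * p)) atTop atTop :=
  (tendsto_atTop_add_const_right _ _ (Real.tendsto_exp_atTop.comp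
    (tendsto_id.const_mul_atTop (by positivity)))).atTop_div_const (by positivity)

open Sm in
/-- Uniform relative convergence to a Barenblatt solution improves to the rate `1 / τ` after a
translation. -/
theorem exists_translation {n : ℕ} (hn : 1 ≤ n) {m : ℝ} (hm0 : 0 < m) (hm1 : m < 1)
    (hm : ((n : ℝ) - 2) / n < m) {B : ℝ} (hB : 0 < B)
    {ρ : ℝ → EuclideanSpace ℝ (Fin n) → ℝ} (hρ : IsFDESol n m ρ)
    (hconv : ∀ ε > (0 : ℝ), ∀ᶠ τ in atTop, ∀ y, |ρ τ y / rhoB n m B τ y - 1| ≤ ε) :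
    ∃ (z : EuclideanSpace ℝ (Fin n)) (C : ℝ), ∀ᶠ τ in atTop, ∀ y,
      τ * |ρ τ (y - z) / rhoB n m B τ y - 1| ≤ C := by
  have hp := pPar_pos hn hm1 hm
  have hpq := pPar_add n (m := m)
  have hdiv := fun t x r => div_rhoB_selfSim (n := n) hm1 hp hB t x (r := r)
  have hq : 1 / (1 - m) * (1 - m) = 1 := one_div_mul_cancel (sub_pos.2 hm1).ne'
  have hq1 : 1 < 1 / (1 - m) := by rw [lt_div_iff₀ (sub_pos.2 hm1)]; linarith
  set p := pPar n m
  set q := 1 / (1 - m)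
  have hs : ContDiffOn ℝ (⊤ : ℕ∞) (fun z : ℝ × EuclideanSpace ℝ (Fin n) => ρ z.1 z.2)
      (posTime n) := hρ.2.2.1.mono fun z hz => ⟨hz, Set.mem_univ _⟩
  have hR : ∀ z, 0 < ev z (mk' _ hs) := fun z => hρ.1 _ z.2.le _
  have hflow := isFlow_pullback hp hpq B
    (dt_rpow_of_fastDiffusion hR hm0.ne' hq (fastDiffusion_mk' hm0.ne' hρ hs hR))
  set P : Sm n := time (fun t => Real.exp (-(2 * n) * t)) (by fun_prop) *
    pullback hp q (rpow (mk' _ hs) hR (m - 1)) with hP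
  set σ : ℝ → ℝ := fun t => (Real.exp (2 * p * t) - 1) / (2 * p) with hσ
  have hσ0 : ∀ t, 0 < t → 0 < σ t := fun t ht =>
    div_pos (sub_pos.2 (Real.one_lt_exp_iff.2 (by positivity))) (by positivity)
  have hPt : ∀ t (ht : 0 < t) x, ev (pt t ht x) P =
      Real.exp (-(2 * n) * t) * ρ (σ t) (Real.exp (2 * q * t) • x) ^ (m - 1) := fun t ht x => by
    rw [hP, map_mul, ev_time, ev_pullback, ev_rpow]; rfl
  have hrho : ∀ t (ht : 0 < t) x x', ρ (σ t) (Real.exp (2 * q * t) • x') /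
      rhoB n m B (σ t) (Real.exp (2 * q * t) • x) =
        (ev (pt t ht x') P / (B + ‖x‖ ^ 2)) ^ (-q) := fun t ht x x' => by
    rw [hPt]; exact hdiv t x _ (hρ.1 _ (hσ0 t ht).le _)
  have hσt : Tendsto σ atTop atTop := tendsto_selfSim_time hp
  have hPpos : ∀ t (ht : 0 < t) x, 0 < ev (pt t ht x) P := fun t ht x => by
    rw [hPt]
    exact mul_pos (Real.exp_pos _) (Real.rpow_pos_of_pos (hρ.1 _ (hσ0 t ht).le _) _)
  have hsmall : ∀ δ > 0, ∃ T, 0 < T ∧ ∀ z : SpaceTime n, T ≤ z.1.1 →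
      |ev z (P - statP n B)| ≤ δ * ev z (statP n B) := fun δ hδ => by
    obtain ⟨ε, hε, h1⟩ := eventually_abs_rpow_sub_one_le (-q)⁻¹ hδ
    obtain ⟨T, hT⟩ := eventually_atTop.1 (hσt.eventually (hconv ε hε))
    refine ⟨max T 1, by positivity, fun z hz => ?_⟩
    obtain ⟨⟨t, x⟩, ht⟩ := z
    have ht' : 0 < t := ht
    change |ev (pt t ht' x) _| ≤ δ * ev (pt t ht' x) _
    have h2 := hT t ((le_max_left _ _).trans hz) (Real.exp (2 * q * t) • x)
    rw [hrho t ht'] at h2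
    have hW : 0 < B + ‖x‖ ^ 2 := by positivity
    have h3 := h1 _ h2
    rw [Real.rpow_rpow_inv (div_pos (hPpos t ht' x) hW).le (by linarith)] at h3
    rw [map_sub, ev_statP_eq_norm, pt_space]
    have h4 : ev (pt t ht' x) P - (B + ‖x‖ ^ 2) =
        (ev (pt t ht' x) P / (B + ‖x‖ ^ 2) - 1) * (B + ‖x‖ ^ 2) := by field_simp
    rw [h4, abs_mul, abs_of_pos hW]
    exact mul_le_mul_of_nonneg_right h3 hW.le
  obtain ⟨a, K, T, hK, ha⟩ := exists_translation_pressure hn hp hq1 hpq hB hflow hsmall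
  obtain ⟨ε, hε, L, hL, hlin⟩ := exists_abs_rpow_sub_one_le_mul (-q)
  obtain ⟨S, hS, hKS⟩ := exists_mul_exp_le (c := 2 * p) (by positivity) hε K
  refine ⟨a, L * K / (2 * p), ?_⟩
  filter_upwards [eventually_ge_atTop (σ (max T S)), eventually_gt_atTop 0] with τ hτ hτ0 y
  set t : ℝ := Real.log (1 + 2 * p * τ) / (2 * p) with ht
  have hpos : 1 < 1 + 2 * p * τ := by have : 0 < 2 * p * τ := by positivity
                                      linarith
  have hexp : Real.exp (2 * p * t) = 1 + 2 * p * τ := by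
    rw [ht, mul_div_cancel₀ _ (by positivity), Real.exp_log (by linarith)]
  have hστ : σ t = τ := by simp only [hσ, hexp]; field_simp; ring
  have ht0 : 0 < t := div_pos (Real.log_pos hpos) (by positivity)
  have htm : max T S ≤ t := by
    rw [← hστ] at hτ
    simp only [hσ] at hτ
    have h1 := (div_le_div_iff_of_pos_right (show 0 < 2 * p by positivity)).1 hτ
    have h2 := Real.exp_le_exp.1 (sub_le_sub_iff_right _ |>.1 h1)
    exact le_of_mul_le_mul_left h2 (by positivity)
  set x : EuclideanSpace ℝ (Fin n) := Real.exp (-(2 * q) * t) • y with hx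
  have hqe : Real.exp (2 * q * t) * Real.exp (-(2 * q) * t) = 1 := by
    rw [← Real.exp_add]; simp
  have hy : Real.exp (2 * q * t) • x = y := by rw [hx, smul_smul, hqe, one_smul]
  have hya : Real.exp (2 * q * t) • (x - Real.exp (-(2 * q) * t) • a) = y - a := by
    rw [smul_sub, hy, smul_smul, hqe, one_smul]
  have h1 := hrho t ht0 x (x - Real.exp (-(2 * q) * t) • a)
  rw [hy, hya, hστ] at h1
  have hW : 0 < B + ‖x‖ ^ 2 := by positivity
  have h2 := ha t ht0 ((le_max_left _ _).trans htm) x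
  set P₁ := ev (pt t ht0 (x - Real.exp (-(2 * q) * t) • a)) P
  have h3 : |P₁ / (B + ‖x‖ ^ 2) - 1| ≤ K * Real.exp (-(2 * p) * t) := by
    have : P₁ / (B + ‖x‖ ^ 2) - 1 = (P₁ - (B + ‖x‖ ^ 2)) / (B + ‖x‖ ^ 2) := by field_simp
    rwa [this, abs_div, abs_of_pos hW, div_le_iff₀ hW]
  have h4 := hlin _ (h3.trans (hKS t ((le_max_right _ _).trans htm)))
  have h5 : τ * Real.exp (-(2 * p) * t) ≤ 1 / (2 * p) := by
    rw [neg_mul, Real.exp_neg, hexp, ← div_eq_mul_inv, div_le_div_iff₀ (by linarith)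
      (by positivity)]
    linarith
  rw [h1]
  calc τ * |(P₁ / (B + ‖x‖ ^ 2)) ^ (-q) - 1|
      ≤ τ * (L * (K * Real.exp (-(2 * p) * t))) :=
        mul_le_mul_of_nonneg_left (h4.trans (mul_le_mul_of_nonneg_left h3 hL)) hτ0.le
    _ = L * K * (τ * Real.exp (-(2 * p) * t)) := by ring
    _ ≤ L * K * (1 / (2 * p)) := mul_le_mul_of_nonneg_left h5 (mul_nonneg hL hK)
    _ = L * K / (2 * p) := by ring

/-- **Exact leading-order asymptotics in the relative `L^∞` norm.**
If `ρ` solves the fast diffusion equation with `m > (n-2)/n`, `0 < m < 1`, and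
`ρ/ρ_B → 1` uniformly, then (i) if `m ≠ m₂ = n/(n+2)`, or if `m = m₂` together with
the moment condition, there is a translation `z` such that the relative deviation
decays like `1/τ`; (ii) if `m = m₂` (without the moment condition) the rate
`τ^{1-ε}` holds for every `ε > 0`. -/
theorem statement0
    (n : ℕ) (hn : 1 ≤ n) (m : ℝ) (hm0 : 0 < m) (hm1 : m < 1)
    (hm : ((n : ℝ) - 2) / n < m)
    (B : ℝ) (hB : 0 < B)
    (ρ : ℝ → EuclideanSpace ℝ (Fin n) → ℝ) (hρ : IsFDESol n m ρ)
    (hconv : ∀ ε > (0 : ℝ), ∀ᶠ τ in atTop, ∀ y, |ρ τ y / rhoB n m B τ y - 1| ≤ ε) :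
    ((m ≠ (n : ℝ) / (n + 2) ∨
        Integrable (fun y : EuclideanSpace ℝ (Fin n) =>
          |1 - ρ 0 y / rhoB n m B 0 y| ^ 2 * (1 + ‖y‖ ^ 2) ^ (-(n : ℝ) / 2))) →
      ∃ z : EuclideanSpace ℝ (Fin n), ∃ C : ℝ, ∀ᶠ τ in atTop, ∀ y,
        τ * |ρ τ (y - z) / rhoB n m B τ y - 1| ≤ C) ∧
    (m = (n : ℝ) / (n + 2) →
      ∀ ε > (0 : ℝ), ∃ z : EuclideanSpace ℝ (Fin n), ∃ C : ℝ, ∀ᶠ τ in atTop, ∀ y,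
        τ ^ (1 - ε) * |ρ τ (y - z) / rhoB n m B τ y - 1| ≤ C) := by
  obtain ⟨z, C, hC⟩ := exists_translation hn hm0 hm1 hm hB hρ hconv
  refine ⟨fun _ => ⟨z, C, hC⟩, fun _ ε hε => ⟨z, C, ?_⟩⟩
  filter_upwards [hC, eventually_ge_atTop 1] with τ hτ h1 y
  refine le_trans ?_ (hτ y)
  refine mul_le_mul_of_nonneg_right ?_ (abs_nonneg _)
  exact (Real.rpow_le_rpow_of_exponent_le h1 (by linarith)).trans_eq (Real.rpow_one τ)
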